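/- Let N be an integer with 5 ≤ N ≤ 12 and let p > 1 be a real number. Then there exists no classical stable solution of Δ²u = u^p, u > 0, in ℝ^N: there is no u ∈ C⁴(ℝ^N) with u > 0 everywhere, Δ(Δu) = u^p, and ∫_{ℝ^N} |Δφ|² dx ≥ p ∫_{ℝ^N} u^{p−1} φ² dx for every φ ∈ C_c^∞(ℝ^N). -/

import Mathlib

open MeasureTheory Real

/-- The Laplacian of a function on `ℝ^N` (sum of pure second derivatives). -/
noncomputable def lap {N : ℕ} (u : EuclideanSpace ℝ (Fin N) → ℝ)
    (x : EuclideanSpace ℝ (Fin N)) : ℝ :=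
  ∑ i : Fin N, fderiv ℝ (fun y => fderiv ℝ u y (EuclideanSpace.single i 1)) x
    (EuclideanSpace.single i 1)

open scoped ContDiff ENNReal

/-- The partial derivative of `f` in the `i`-th coordinate direction. -/
noncomputable def pd {N : ℕ} (f : EuclideanSpace ℝ (Fin N) → ℝ) (i : Fin N)
    (x : EuclideanSpace ℝ (Fin N)) : ℝ :=
  fderiv ℝ f x (EuclideanSpace.single i 1)

/-- The inner product of the gradients of `f` and `g`. -/
noncomputable def gradDot {N : ℕ} (f g : EuclideanSpace ℝ (Fin N) → ℝ)
    (x : EuclideanSpace ℝ (Fin N)) : ℝ :=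
  ∑ i : Fin N, pd f i x * pd g i x

section Calculus

variable {N : ℕ} {f g h : EuclideanSpace ℝ (Fin N) → ℝ} {x : EuclideanSpace ℝ (Fin N)}

theorem lap_eq_sum_pd (f : EuclideanSpace ℝ (Fin N) → ℝ) (x : EuclideanSpace ℝ (Fin N)) :
    lap f x = ∑ i : Fin N, pd (pd f i) i x := rfl

theorem contDiff_pd {n m : WithTop ℕ∞} (hf : ContDiff ℝ n f) (hmn : m + 1 ≤ n) (i : Fin N) :
    ContDiff ℝ m (pd f i) :=
  (hf.fderiv_right hmn).clm_apply contDiff_const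

theorem contDiff_lap {n m : WithTop ℕ∞} (hf : ContDiff ℝ n f) (hmn : m + 1 + 1 ≤ n) :
    ContDiff ℝ m (lap f) :=
  ContDiff.sum fun i _ => contDiff_pd (contDiff_pd hf hmn i) le_rfl i

theorem contDiff_gradDot {n m : WithTop ℕ∞} (hf : ContDiff ℝ n f) (hg : ContDiff ℝ n g)
    (hmn : m + 1 ≤ n) : ContDiff ℝ m (gradDot f g) :=
  ContDiff.sum fun i _ => (contDiff_pd hf hmn i).mul (contDiff_pd hg hmn i)

theorem continuous_pd (hf : ContDiff ℝ 1 f) (i : Fin N) : Continuous (pd f i) :=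
  (contDiff_pd (m := 0) hf (by norm_num) i).continuous

theorem continuous_lap (hf : ContDiff ℝ 2 f) : Continuous (lap f) :=
  (contDiff_lap (m := 0) hf (by norm_num [one_add_one_eq_two])).continuous

theorem continuous_gradDot (hf : ContDiff ℝ 1 f) (hg : ContDiff ℝ 1 g) :
    Continuous (gradDot f g) :=
  (contDiff_gradDot (m := 0) hf hg (by norm_num)).continuous

theorem contDiff_one_pd (hf : ContDiff ℝ 2 f) (i : Fin N) : ContDiff ℝ 1 (pd f i) :=
  contDiff_pd hf (by norm_num [one_add_one_eq_two]) i

theorem pd_add (hf : DifferentiableAt ℝ f x) (hg : DifferentiableAt ℝ g x) (i : Fin N) :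
    pd (fun y => f y + g y) i x = pd f i x + pd g i x := by
  simp [pd, fderiv_fun_add hf hg]

theorem pd_mul (hf : DifferentiableAt ℝ f x) (hg : DifferentiableAt ℝ g x) (i : Fin N) :
    pd (fun y => f y * g y) i x = f x * pd g i x + pd f i x * g x := by
  simp [pd, fderiv_fun_mul hf hg, mul_comm]

theorem pd_const_mul (c : ℝ) (hf : DifferentiableAt ℝ f x) (i : Fin N) :
    pd (fun y => c * f y) i x = c * pd f i x := by
  simp [pd, fderiv_const_mul hf c]

theorem pd_comp {φ : ℝ → ℝ} {φ' : ℝ} (hφ : HasDerivAt φ φ' (f x))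
    (hf : DifferentiableAt ℝ f x) (i : Fin N) :
    pd (fun y => φ (f y)) i x = φ' * pd f i x := by
  have := (hφ.hasFDerivAt.comp x hf.hasFDerivAt).fderiv
  simp only [pd, Function.comp_def] at this ⊢
  rw [this]; simp [mul_comm]

theorem gradDot_comm (f g : EuclideanSpace ℝ (Fin N) → ℝ) (x : EuclideanSpace ℝ (Fin N)) :
    gradDot f g x = gradDot g f x := by
  simp [gradDot, mul_comm]

theorem gradDot_self_nonneg (f : EuclideanSpace ℝ (Fin N) → ℝ) (x : EuclideanSpace ℝ (Fin N)) :
    0 ≤ gradDot f f x :=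
  Finset.sum_nonneg fun _ _ => mul_self_nonneg _

theorem sq_gradDot_le (f g : EuclideanSpace ℝ (Fin N) → ℝ) (x : EuclideanSpace ℝ (Fin N)) :
    gradDot f g x ^ 2 ≤ gradDot f f x * gradDot g g x := by
  have := Finset.sum_mul_sq_le_sq_mul_sq Finset.univ (fun i => pd f i x) (fun i => pd g i x)
  simpa [gradDot, sq] using this

/-- Young's inequality for the product of two gradients. -/
theorem two_mul_gradDot_le (a b : ℝ) (f g : EuclideanSpace ℝ (Fin N) → ℝ)
    (x : EuclideanSpace ℝ (Fin N)) :
    2 * (a * b * gradDot f g x) ≤ a ^ 2 * gradDot f f x + b ^ 2 * gradDot g g x := by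
  have : 0 ≤ ∑ i : Fin N, (a * pd f i x - b * pd g i x) ^ 2 :=
    Finset.sum_nonneg fun _ _ => sq_nonneg _
  have e : ∑ i : Fin N, (a * pd f i x - b * pd g i x) ^ 2 =
      a ^ 2 * gradDot f f x + b ^ 2 * gradDot g g x - 2 * (a * b * gradDot f g x) := by
    simp only [gradDot, Finset.mul_sum, ← Finset.sum_add_distrib, ← Finset.sum_sub_distrib]
    exact Finset.sum_congr rfl fun _ _ => by ring
  linarith

theorem gradDot_mul_left (hf : DifferentiableAt ℝ f x) (hg : DifferentiableAt ℝ g x) :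
    gradDot (fun y => f y * g y) h x = f x * gradDot g h x + g x * gradDot f h x := by
  simp only [gradDot, Finset.mul_sum, ← Finset.sum_add_distrib]
  exact Finset.sum_congr rfl fun i _ => by rw [pd_mul hf hg]; ring

theorem gradDot_comp_left {φ : ℝ → ℝ} {φ' : ℝ} (hφ : HasDerivAt φ φ' (f x))
    (hf : DifferentiableAt ℝ f x) :
    gradDot (fun y => φ (f y)) h x = φ' * gradDot f h x := by
  simp only [gradDot, Finset.mul_sum]
  exact Finset.sum_congr rfl fun i _ => by rw [pd_comp hφ hf]; ring

theorem lap_add (hf : ContDiff ℝ 2 f) (hg : ContDiff ℝ 2 g) :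
    lap (fun y => f y + g y) x = lap f x + lap g x := by
  simp only [lap_eq_sum_pd, ← Finset.sum_add_distrib]
  refine Finset.sum_congr rfl fun i _ => ?_
  have e : pd (fun y => f y + g y) i = fun y => pd f i y + pd g i y :=
    funext fun y => pd_add (hf.differentiable two_ne_zero y) (hg.differentiable two_ne_zero y) i
  rw [e, pd_add ((contDiff_one_pd hf i).differentiable one_ne_zero x)
    ((contDiff_one_pd hg i).differentiable one_ne_zero x)]

theorem lap_const_mul (c : ℝ) (hf : ContDiff ℝ 2 f) :
    lap (fun y => c * f y) x = c * lap f x := by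
  simp only [lap_eq_sum_pd, Finset.mul_sum]
  refine Finset.sum_congr rfl fun i _ => ?_
  have e : pd (fun y => c * f y) i = fun y => c * pd f i y :=
    funext fun y => pd_const_mul c (hf.differentiable two_ne_zero y) i
  rw [e, pd_const_mul c ((contDiff_one_pd hf i).differentiable one_ne_zero x)]

theorem lap_neg (hf : ContDiff ℝ 2 f) : lap (fun y => -f y) x = -lap f x := by
  simpa using lap_const_mul (x := x) (-1) hf

theorem lap_mul (hf : ContDiff ℝ 2 f) (hg : ContDiff ℝ 2 g) :
    lap (fun y => f y * g y) x = f x * lap g x + 2 * gradDot f g x + g x * lap f x := by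
  simp only [lap_eq_sum_pd, gradDot, Finset.mul_sum, ← Finset.sum_add_distrib]
  refine Finset.sum_congr rfl fun i _ => ?_
  have df := hf.differentiable two_ne_zero
  have dg := hg.differentiable two_ne_zero
  have dpf := (contDiff_one_pd hf i).differentiable one_ne_zero
  have dpg := (contDiff_one_pd hg i).differentiable one_ne_zero
  have e : pd (fun y => f y * g y) i = fun y => f y * pd g i y + pd f i y * g y :=
    funext fun y => pd_mul (df y) (dg y) i
  rw [e, pd_add ((df x).fun_mul (dpg x)) ((dpf x).fun_mul (dg x)), pd_mul (df x) (dpg x), pd_mul (dpf x) (dg x)]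
  ring

theorem lap_comp {φ φ' φ'' : ℝ → ℝ} (hφ : ∀ x, HasDerivAt φ (φ' (f x)) (f x))
    (hφ' : ∀ x, HasDerivAt φ' (φ'' (f x)) (f x)) (hf : ContDiff ℝ 2 f) :
    lap (fun y => φ (f y)) x = φ' (f x) * lap f x + φ'' (f x) * gradDot f f x := by
  simp only [lap_eq_sum_pd, gradDot, Finset.mul_sum, ← Finset.sum_add_distrib]
  refine Finset.sum_congr rfl fun i _ => ?_
  have df := hf.differentiable two_ne_zero
  have dpf := (contDiff_one_pd hf i).differentiable one_ne_zero
  have e : pd (fun y => φ (f y)) i = fun y => φ' (f y) * pd f i y :=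
    funext fun y => pd_comp (hφ y) (df y) i
  have d : DifferentiableAt ℝ (fun y => φ' (f y)) x := (hφ' x).differentiableAt.comp x (df x)
  rw [e, pd_mul d (dpf x), pd_comp (hφ' x) (df x)]
  ring

/-- Behaviour of partial derivatives under a similarity of the space. -/
theorem pd_comp_smul_add (r : ℝ) (a : EuclideanSpace ℝ (Fin N)) (hf : Differentiable ℝ f)
    (i : Fin N) : pd (fun y => f (r • y + a)) i x = r * pd f i (r • x + a) := by
  have h1 : HasFDerivAt (fun y : EuclideanSpace ℝ (Fin N) => r • y + a)
      (r • ContinuousLinearMap.id ℝ (EuclideanSpace ℝ (Fin N))) x :=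
    ((hasFDerivAt_id x).const_smul r).add_const a
  have := ((hf (r • x + a)).hasFDerivAt.comp x h1).fderiv
  simp only [pd, Function.comp_def] at this ⊢
  rw [this]; simp

theorem lap_comp_smul_add (r : ℝ) (a : EuclideanSpace ℝ (Fin N)) (hf : ContDiff ℝ 2 f) :
    lap (fun y => f (r • y + a)) x = r ^ 2 * lap f (r • x + a) := by
  simp only [lap_eq_sum_pd, Finset.mul_sum]
  refine Finset.sum_congr rfl fun i _ => ?_
  have df := hf.differentiable two_ne_zero
  have dpf := (contDiff_one_pd hf i).differentiable one_ne_zero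
  have e : pd (fun y => f (r • y + a)) i = fun y => r * pd f i (r • y + a) :=
    funext fun y => pd_comp_smul_add r a df i
  have d : Differentiable ℝ fun y => pd f i (r • y + a) :=
    dpf.comp ((differentiable_id.const_smul r).add_const a)
  rw [e, pd_const_mul r (d x), pd_comp_smul_add r a dpf]
  ring

theorem pd_eq_zero_of_notMem_tsupport (hx : x ∉ tsupport f) (i : Fin N) : pd f i x = 0 := by
  have h1 : x ∉ tsupport (fderiv ℝ f) := fun h => hx (tsupport_fderiv_subset ℝ h)
  simp [pd, image_eq_zero_of_notMem_tsupport h1]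

theorem tsupport_pd_subset (f : EuclideanSpace ℝ (Fin N) → ℝ) (i : Fin N) :
    tsupport (pd f i) ⊆ tsupport f :=
  closure_minimal (fun _ hx => by_contra fun h => hx (pd_eq_zero_of_notMem_tsupport h i))
    (isClosed_tsupport f)

theorem hasCompactSupport_pd (hf : HasCompactSupport f) (i : Fin N) : HasCompactSupport (pd f i) :=
  hf.of_isClosed_subset (isClosed_tsupport _) (tsupport_pd_subset f i)

theorem gradDot_eq_zero_of_notMem_tsupport (hx : x ∉ tsupport f) : gradDot f g x = 0 := by
  simp [gradDot, pd_eq_zero_of_notMem_tsupport hx]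

theorem lap_eq_zero_of_notMem_tsupport (hx : x ∉ tsupport f) : lap f x = 0 := by
  rw [lap_eq_sum_pd]
  exact Finset.sum_eq_zero fun i _ =>
    pd_eq_zero_of_notMem_tsupport (fun h => hx (tsupport_pd_subset f i h)) i

theorem integral_pd_eq_zero (hf : ContDiff ℝ 1 f) (hc : HasCompactSupport f) (i : Fin N) :
    ∫ x, pd f i x = 0 := by
  have hc' : HasCompactSupport (pd f i) :=
    hasCompactSupport_pd hc i
  have := integral_mul_fderiv_eq_neg_fderiv_mul_of_integrable (𝕜 := ℝ)
    (μ := (volume : Measure (EuclideanSpace ℝ (Fin N)))) (f := fun _ => (1 : ℝ)) (g := f)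
    (v := EuclideanSpace.single i 1) (by simp)
    (by simpa using! (continuous_pd hf i).integrable_of_hasCompactSupport hc')
    (by simpa using hf.continuous.integrable_of_hasCompactSupport hc)
    (by simp) (fun y _ => hf.differentiable one_ne_zero y)
  simpa [pd] using this

/-- Green's identity. -/
theorem integral_mul_lap_add_gradDot (hf : ContDiff ℝ 1 f) (hg : ContDiff ℝ 2 g)
    (hc : HasCompactSupport f) : ∫ x, (f x * lap g x + gradDot f g x) = 0 := by
  have e : ∀ x, f x * lap g x + gradDot f g x = ∑ i, pd (fun y => f y * pd g i y) i x := by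
    intro x
    simp only [lap_eq_sum_pd, gradDot, Finset.mul_sum, ← Finset.sum_add_distrib]
    refine Finset.sum_congr rfl fun i _ => ?_
    rw [pd_mul (hf.differentiable one_ne_zero x)
      ((contDiff_one_pd hg i).differentiable one_ne_zero x)]
  have hfg : ∀ i, ContDiff ℝ 1 fun y => f y * pd g i y := fun i => hf.mul (contDiff_one_pd hg i)
  have hcs : ∀ i, HasCompactSupport fun y => f y * pd g i y := fun i => hc.mul_right
  simp_rw [e]
  rw [integral_finsetSum _ fun i _ => (continuous_pd (hfg i) i).integrable_of_hasCompactSupport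
    (hasCompactSupport_pd (hcs i) i)]
  exact Finset.sum_eq_zero fun i _ => integral_pd_eq_zero (hfg i) (hcs i) i

end Calculus

section LoewnerHeinz

variable {H : Type*} [NormedAddCommGroup H] [InnerProductSpace ℂ H] [CompleteSpace H]

theorem norm_mul_mul_le_one {V Y : H →L[ℂ] H} (hV : IsSelfAdjoint V) (hY : IsSelfAdjoint Y)
    (h : ‖V * Y * Y‖ ≤ 1) : ‖Y * (V * Y)‖ ≤ 1 := by
  have hS : IsSelfAdjoint (Y * (V * Y)) := by
    have := hV.conjugate Y
    rwa [hY.star_eq, mul_assoc] at this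
  have hr : spectralRadius ℂ (Y * (V * Y)) ≤ 1 := by
    refine iSup₂_le fun k hk => ?_
    by_cases hk0 : k = 0
    · simp [hk0]
    have hk' : k ∈ spectrum ℂ (V * Y * Y) := by
      have : k ∈ spectrum ℂ (Y * (V * Y)) \ {0} := ⟨hk, hk0⟩
      rw [spectrum.nonzero_mul_comm] at this
      exact this.1
    have h1 := spectrum.norm_le_norm_mul_of_mem hk'
    have h2 : ‖(1 : H →L[ℂ] H)‖ ≤ 1 := ContinuousLinearMap.norm_id_le
    have h3 : ‖k‖ ≤ 1 := h1.trans (mul_le_one₀ h (norm_nonneg _) h2)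
    exact_mod_cast h3
  rw [hS.spectralRadius_eq_nnnorm] at hr
  exact_mod_cast hr

/-- A form of the operator monotonicity of the square root, with `Y⁻²` in place of the larger
operator. -/
theorem re_inner_le_norm_sq {V Y : H →L[ℂ] H} (hV : IsSelfAdjoint V) (hY : IsSelfAdjoint Y)
    (h : ‖V * Y * Y‖ ≤ 1) (f : H) : RCLike.re (inner ℂ (V (Y f)) (Y f)) ≤ ‖f‖ ^ 2 := by
  have h1 : inner ℂ (V (Y f)) (Y f) = inner ℂ ((Y * (V * Y)) f) f := by
    have := ContinuousLinearMap.isSelfAdjoint_iff_isSymmetric.1 hY (V (Y f)) f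
    simpa using this.symm
  rw [h1]
  calc RCLike.re (inner ℂ ((Y * (V * Y)) f) f) ≤ ‖(Y * (V * Y)) f‖ * ‖f‖ := re_inner_le_norm _ _
    _ ≤ (1 * ‖f‖) * ‖f‖ := by
        gcongr
        exact ContinuousLinearMap.le_of_opNorm_le _ (norm_mul_mul_le_one hV hY h) f
    _ = ‖f‖ ^ 2 := by ring

end LoewnerHeinz

section Multiplication

variable {E : Type*} [MeasurableSpace E] {μ : Measure E}

theorem memLp_top_ofReal {W : E → ℝ} (hW : Measurable W) {C : ℝ} (hC : ∀ x, |W x| ≤ C) :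
    MemLp (fun x => (W x : ℂ)) ∞ μ :=
  memLp_top_of_bound (Complex.measurable_ofReal.comp hW).aestronglyMeasurable C
    (.of_forall fun x => by simpa using hC x)

/-- Multiplication by a bounded measurable real function, as an operator on complex `L²`. -/
noncomputable def mulL2 (μ : Measure E) {W : E → ℝ} (hW : Measurable W) {C : ℝ}
    (hC : ∀ x, |W x| ≤ C) : Lp ℂ 2 μ →L[ℂ] Lp ℂ 2 μ :=
  (ContinuousLinearMap.lsmul ℂ ℂ).holderL μ ∞ 2 2 ((memLp_top_ofReal hW hC).toLp _)

theorem coeFn_mulL2 {W : E → ℝ} (hW : Measurable W) {C : ℝ} (hC : ∀ x, |W x| ≤ C)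
    (f : Lp ℂ 2 μ) : mulL2 μ hW hC f =ᵐ[μ] fun x => (W x : ℂ) * f x := by
  have h1 := (ContinuousLinearMap.lsmul ℂ ℂ).coeFn_holder (r := 2)
    ((memLp_top_ofReal (μ := μ) hW hC).toLp _) f
  filter_upwards [h1, (memLp_top_ofReal (μ := μ) hW hC).coeFn_toLp] with x h1 h2
  simpa [h2] using! h1

theorem isSelfAdjoint_mulL2 {W : E → ℝ} (hW : Measurable W) {C : ℝ} (hC : ∀ x, |W x| ≤ C) :
    IsSelfAdjoint (mulL2 μ hW hC) := by
  rw [ContinuousLinearMap.isSelfAdjoint_iff_isSymmetric]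
  intro f g
  simp only [ContinuousLinearMap.coe_coe, L2.inner_def]
  refine integral_congr_ae ?_
  filter_upwards [coeFn_mulL2 hW hC f, coeFn_mulL2 hW hC g] with x h1 h2
  simp [h1, h2]
  ring

end Multiplication

theorem norm_sq_toLp_two {E : Type*} [MeasurableSpace E] {μ : Measure E} {f : Lp ℂ 2 μ} :
    ‖f‖ ^ 2 = ∫ x, ‖f x‖ ^ 2 ∂μ := by
  have h := inner_self_eq_norm_sq (𝕜 := ℂ) f
  rw [← h, L2.inner_def]
  simp only [inner_self_eq_norm_sq_to_K]
  norm_cast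

section FourierMultiplier

open scoped SchwartzMap FourierTransform Laplacian

variable {N : ℕ}

theorem norm_mulL2_le {E : Type*} [MeasurableSpace E] {μ : Measure E} {W : E → ℝ}
    (hW : Measurable W) {C : ℝ} (hC : ∀ x, |W x| ≤ C) (f : Lp ℂ 2 μ) :
    ‖mulL2 μ hW hC f‖ ≤ C * ‖f‖ := by
  refine Lp.norm_le_mul_norm_of_ae_le_mul ?_
  filter_upwards [coeFn_mulL2 hW hC f] with x hx
  rw [hx, norm_mul, Complex.norm_real]
  exact mul_le_mul_of_nonneg_right (hC x) (norm_nonneg _)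

/-- The Fourier multiplier on `L²` with a bounded real symbol. -/
noncomputable def multiplierL2 {m : EuclideanSpace ℝ (Fin N) → ℝ} (hm : Measurable m) {C : ℝ}
    (hC : ∀ x, |m x| ≤ C) :
    Lp ℂ 2 (volume : Measure (EuclideanSpace ℝ (Fin N))) →L[ℂ]
      Lp ℂ 2 (volume : Measure (EuclideanSpace ℝ (Fin N))) :=
  (Lp.fourierTransformₗᵢ (EuclideanSpace ℝ (Fin N)) ℂ).symm.toContinuousLinearEquiv.toContinuousLinearMap ∘L
    mulL2 volume hm hC ∘L
    (Lp.fourierTransformₗᵢ (EuclideanSpace ℝ (Fin N)) ℂ).toContinuousLinearEquiv.toContinuousLinearMap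

variable {m : EuclideanSpace ℝ (Fin N) → ℝ} (hm : Measurable m) {C : ℝ} (hC : ∀ x, |m x| ≤ C)

theorem multiplierL2_apply (f : Lp ℂ 2 (volume : Measure (EuclideanSpace ℝ (Fin N)))) :
    multiplierL2 hm hC f = (Lp.fourierTransformₗᵢ (EuclideanSpace ℝ (Fin N)) ℂ).symm
      (mulL2 volume hm hC (Lp.fourierTransformₗᵢ (EuclideanSpace ℝ (Fin N)) ℂ f)) := rfl

theorem norm_multiplierL2_le (f : Lp ℂ 2 (volume : Measure (EuclideanSpace ℝ (Fin N)))) :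
    ‖multiplierL2 hm hC f‖ ≤ C * ‖f‖ := by
  rw [multiplierL2_apply, LinearIsometryEquiv.norm_map]
  refine (norm_mulL2_le hm hC _).trans_eq ?_
  rw [LinearIsometryEquiv.norm_map]

theorem isSelfAdjoint_multiplierL2 : IsSelfAdjoint (multiplierL2 hm hC) := by
  rw [ContinuousLinearMap.isSelfAdjoint_iff_isSymmetric]
  intro f g
  have h := ContinuousLinearMap.isSelfAdjoint_iff_isSymmetric.1
    (isSelfAdjoint_mulL2 (μ := volume) hm hC)
    (Lp.fourierTransformₗᵢ (EuclideanSpace ℝ (Fin N)) ℂ f)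
    (Lp.fourierTransformₗᵢ (EuclideanSpace ℝ (Fin N)) ℂ g)
  simp only [ContinuousLinearMap.coe_coe] at h ⊢
  rw [multiplierL2_apply, multiplierL2_apply,
    ← (Lp.fourierTransformₗᵢ (EuclideanSpace ℝ (Fin N)) ℂ).inner_map_map,
    LinearIsometryEquiv.apply_symm_apply, h,
    ← (Lp.fourierTransformₗᵢ (EuclideanSpace ℝ (Fin N)) ℂ).inner_map_map f,
    LinearIsometryEquiv.apply_symm_apply]

theorem multiplierL2_toLp (hg : m.HasTemperateGrowth) (f : 𝓢(EuclideanSpace ℝ (Fin N), ℂ)) :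
    multiplierL2 hm hC (f.toLp 2) = (SchwartzMap.fourierMultiplierCLM ℂ m f).toLp 2 := by
  have h1 : Lp.fourierTransformₗᵢ (EuclideanSpace ℝ (Fin N)) ℂ (f.toLp 2) = (𝓕 f).toLp 2 :=
    (SchwartzMap.toLp_fourier_eq f)
  have h2 : mulL2 volume hm hC ((𝓕 f).toLp 2) =
      (SchwartzMap.smulLeftCLM ℂ m (𝓕 f)).toLp 2 := by
    refine Lp.ext ?_
    filter_upwards [coeFn_mulL2 hm hC ((𝓕 f).toLp 2), (𝓕 f).coeFn_toLp 2 volume,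
      (SchwartzMap.smulLeftCLM ℂ m (𝓕 f)).coeFn_toLp 2 volume] with x h1 h2 h3
    rw [h1, h2, h3, SchwartzMap.smulLeftCLM_apply_apply hg, Complex.real_smul]
  rw [multiplierL2_apply, h1, h2, SchwartzMap.fourierMultiplierCLM_apply]
  exact (SchwartzMap.toLp_fourierInv_eq _)

/-- The symbol of `(k² - Δ) ^ r`. -/
noncomputable def resolventSymbol (k r : ℝ) (ξ : EuclideanSpace ℝ (Fin N)) : ℝ :=
  (k ^ 2 + (2 * π) ^ 2 * ‖ξ‖ ^ 2) ^ r

theorem hasTemperateGrowth_resolventSymbol {k : ℝ} (hk : 0 < k) (r : ℝ) :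
    (resolventSymbol (N := N) k r).HasTemperateGrowth := by
  have h1 := (Function.hasTemperateGrowth_one_add_norm_sq_rpow (EuclideanSpace ℝ (Fin N)) r).comp
    (g := (fun x => (1 + ‖x‖ ^ 2) ^ r)) (f := fun x : EuclideanSpace ℝ (Fin N) => (2 * π / k) • x)
    (by fun_prop)
  have h2 : (fun ξ : EuclideanSpace ℝ (Fin N) => (k ^ 2) ^ r *
      (((fun x => (1 + ‖x‖ ^ 2) ^ r)) ∘
      (fun x : EuclideanSpace ℝ (Fin N) => (2 * π / k) • x)) ξ).HasTemperateGrowth :=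
    (Function.HasTemperateGrowth.const _).mul h1
  convert h2 using 2 with ξ
  simp only [Function.comp, resolventSymbol]
  rw [← mul_rpow (by positivity) (by positivity), norm_smul, mul_pow ‖_‖, norm_eq_abs, sq_abs]
  congr 1
  field_simp

theorem resolventSymbol_mul {k : ℝ} (hk : 0 < k) (r s : ℝ) :
    resolventSymbol (N := N) k r * resolventSymbol k s = resolventSymbol k (r + s) := by
  ext ξ
  simp only [Pi.mul_apply, resolventSymbol]
  rw [rpow_add (by positivity)]

theorem resolventSymbol_zero {k : ℝ} : resolventSymbol (N := N) k 0 = fun _ => 1 := by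
  ext ξ; simp [resolventSymbol]

theorem continuous_resolventSymbol {k : ℝ} (hk : 0 < k) (r : ℝ) :
    Continuous (resolventSymbol (N := N) k r) :=
  (hasTemperateGrowth_resolventSymbol hk r).1.continuous

theorem abs_resolventSymbol_le {k r : ℝ} (hk : 0 < k) (hr : r ≤ 0)
    (ξ : EuclideanSpace ℝ (Fin N)) : |resolventSymbol k r ξ| ≤ (k ^ 2) ^ r := by
  have h : 0 < k ^ 2 := by positivity
  rw [abs_of_nonneg (by unfold resolventSymbol; positivity)]
  exact rpow_le_rpow_of_nonpos h (by simp only [le_add_iff_nonneg_right]; positivity) hr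

theorem fourierMultiplier_resolventSymbol_one {k : ℝ} (f : 𝓢(EuclideanSpace ℝ (Fin N), ℂ)) :
    SchwartzMap.fourierMultiplierCLM ℂ (resolventSymbol (N := N) k 1) f =
      (k ^ 2) • f - Δ f := by
  have h0 : (fun ξ : EuclideanSpace ℝ (Fin N) => ‖ξ‖ ^ 2).HasTemperateGrowth := by fun_prop
  have e : resolventSymbol (N := N) k 1 =
      fun ξ => ∑ i : Bool, (if i then (fun _ : EuclideanSpace ℝ (Fin N) => k ^ 2)
        else (2 * π) ^ 2 • (fun ξ => ‖ξ‖ ^ 2)) ξ := by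
    ext ξ; simp [resolventSymbol]
  rw [e, SchwartzMap.fourierMultiplierCLM_sum ℂ, Fintype.sum_bool]
  · simp only [if_true, Bool.false_eq_true, if_false, add_apply,
      SchwartzMap.fourierMultiplierCLM_const, SchwartzMap.fourierMultiplierCLM_smul h0,
      SchwartzMap.laplacian_eq_fourierMultiplierCLM]
    simp
  · intro i _
    cases i
    · simp only [Bool.false_eq_true, if_false]
      exact (Function.HasTemperateGrowth.const _).smul h0
    · simp only [if_true]
      exact Function.HasTemperateGrowth.const _

end FourierMultiplier

section Cutoff

variable {N : ℕ}

/-- A smooth cutoff function between the balls of radii `1` and `2`. -/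
theorem exists_cutoff (N : ℕ) : ∃ χ : EuclideanSpace ℝ (Fin N) → ℝ, ContDiff ℝ ∞ χ ∧
    (∀ x, 0 ≤ χ x) ∧ (∀ x, χ x ≤ 1) ∧ (∀ x, ‖x‖ ≤ 1 → χ x = 1) ∧
    tsupport χ ⊆ Metric.closedBall 0 2 ∧ HasCompactSupport χ := by
  let χ : ContDiffBump (0 : EuclideanSpace ℝ (Fin N)) := ⟨1, 2, one_pos, one_lt_two⟩
  exact ⟨χ, χ.contDiff, fun x => χ.nonneg, fun x => χ.le_one,
    fun x hx => χ.one_of_mem_closedBall (by simpa using hx), χ.tsupport_eq.le, χ.hasCompactSupport⟩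

theorem exists_bound_of_hasCompactSupport {f : EuclideanSpace ℝ (Fin N) → ℝ} (hf : Continuous f)
    (hc : HasCompactSupport f) : ∃ K, 0 ≤ K ∧ ∀ x, |f x| ≤ K := by
  obtain ⟨K, hK⟩ := hf.bounded_above_of_compact_support hc
  exact ⟨K, (norm_nonneg _).trans (hK 0), hK⟩

theorem hasCompactSupport_lap {f : EuclideanSpace ℝ (Fin N) → ℝ} (hc : HasCompactSupport f) :
    HasCompactSupport (lap f) :=
  hc.of_isClosed_subset (isClosed_tsupport _) (closure_minimal
    (fun _ hx => by_contra fun h => hx (lap_eq_zero_of_notMem_tsupport h)) (isClosed_tsupport f))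

theorem hasCompactSupport_gradDot {f g : EuclideanSpace ℝ (Fin N) → ℝ} (hc : HasCompactSupport f) :
    HasCompactSupport (gradDot f g) :=
  hc.of_isClosed_subset (isClosed_tsupport _) (closure_minimal
    (fun _ hx => by_contra fun h => hx (gradDot_eq_zero_of_notMem_tsupport h)) (isClosed_tsupport f))

theorem gradDot_comp_smul_add {f g : EuclideanSpace ℝ (Fin N) → ℝ} (r : ℝ)
    (a : EuclideanSpace ℝ (Fin N)) (hf : Differentiable ℝ f) (hg : Differentiable ℝ g)
    (x : EuclideanSpace ℝ (Fin N)) :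
    gradDot (fun y => f (r • y + a)) (fun y => g (r • y + a)) x =
      r ^ 2 * gradDot f g (r • x + a) := by
  simp only [gradDot, Finset.mul_sum]
  refine Finset.sum_congr rfl fun i _ => ?_
  rw [pd_comp_smul_add r a hf, pd_comp_smul_add r a hg]
  ring

/-- An inequality for test functions extends to smooth functions in the energy space. -/
theorem integral_sq_mul_sq_le_of_integrable {W : EuclideanSpace ℝ (Fin N) → ℝ} {R : ℝ}
    (hR : ∀ x, R < ‖x‖ → W x = 0)
    (hW : ∀ φ : EuclideanSpace ℝ (Fin N) → ℝ, ContDiff ℝ ∞ φ → HasCompactSupport φ →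
      ∫ x, W x ^ 2 * φ x ^ 2 ≤ ∫ x, lap φ x ^ 2)
    {ψ : EuclideanSpace ℝ (Fin N) → ℝ} (hψ : ContDiff ℝ ∞ ψ)
    (h0 : Integrable fun x => ψ x ^ 2) (h1 : Integrable (gradDot ψ ψ))
    (h2 : Integrable fun x => lap ψ x ^ 2) :
    ∫ x, W x ^ 2 * ψ x ^ 2 ≤ ∫ x, lap ψ x ^ 2 := by
  obtain ⟨χ, hχ, hχ0, hχ1, hχe, -, hχc⟩ := exists_cutoff N
  have hχ2 : ContDiff ℝ 2 χ := contDiff_infty.1 hχ 2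
  have hψ2 : ContDiff ℝ 2 ψ := contDiff_infty.1 hψ 2
  obtain ⟨K0, hK0, hK0'⟩ := exists_bound_of_hasCompactSupport (continuous_lap hχ2)
    (hasCompactSupport_lap hχc)
  obtain ⟨K1, hK1, hK1'⟩ := exists_bound_of_hasCompactSupport
    (continuous_gradDot (hχ2.of_le one_le_two) (hχ2.of_le one_le_two))
    (hasCompactSupport_gradDot (g := χ) hχc)
  have hdχ := hχ2.differentiable two_ne_zero
  set K := 2 * K0 ^ 2 + 8 * K1 with hK
  have h01 : Integrable fun x => ψ x ^ 2 + gradDot ψ ψ x := h0.add h1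
  have key : ∀ r ∈ Set.Ioo (0 : ℝ) (1 / (1 + |R|)), ∫ x, W x ^ 2 * ψ x ^ 2 ≤
      (1 + r) * (∫ x, lap ψ x ^ 2) + (r + r ^ 2) * K * ((∫ x, ψ x ^ 2) + ∫ x, gradDot ψ ψ x) := by
    intro r hr
    have hr0 : 0 < r := hr.1
    have hr1 : r ≤ 1 := hr.2.le.trans (by rw [div_le_one (by positivity)]; linarith [abs_nonneg R])
    have hrR : ∀ x : EuclideanSpace ℝ (Fin N), ‖x‖ ≤ R → χ (r • x + 0) = 1 := by
      intro x hx
      apply hχe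
      rw [add_zero, norm_smul, norm_eq_abs, abs_of_pos hr0]
      have := hr.2
      rw [lt_div_iff₀ (by positivity)] at this
      nlinarith [le_abs_self R]
    have hc : HasCompactSupport fun x => χ (r • x + 0) := by
      simpa using hχc.comp_smul hr0.ne'
    have hs : ContDiff ℝ ∞ fun x => χ (r • x + 0) := hχ.comp (by fun_prop)
    have hs2 : ContDiff ℝ 2 fun x => χ (r • x + 0) := contDiff_infty.1 hs 2
    have h := hW (fun x => ψ x * χ (r • x + 0)) (hψ.mul hs) hc.mul_left
    have e : ∀ x, W x ^ 2 * (ψ x * χ (r • x + 0)) ^ 2 = W x ^ 2 * ψ x ^ 2 := by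
      intro x
      rcases le_or_gt ‖x‖ R with hx | hx
      · rw [hrR x hx, mul_one]
      · simp [hR x hx]
    simp_rw [e] at h
    refine h.trans ?_
    rw [← integral_add h0 h1, ← integral_const_mul, ← integral_const_mul,
      ← integral_add (h2.const_mul _) (h01.const_mul _)]
    refine integral_mono_of_nonneg (.of_forall fun x => sq_nonneg _)
      ((h2.const_mul _).add (h01.const_mul _)) (.of_forall fun x => ?_)
    have e1 := lap_mul (x := x) hψ2 hs2
    rw [lap_comp_smul_add r 0 hχ2] at e1
    have e2 := sq_gradDot_le ψ (fun x => χ (r • x + 0)) x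
    rw [gradDot_comp_smul_add r 0 hdχ hdχ] at e2
    beta_reduce
    rw [e1]
    have b0 := abs_le.1 (hK0' (r • x + 0))
    have b1 := abs_le.1 (hK1' (r • x + 0))
    have c0 := hχ0 (r • x + 0)
    have c1 := hχ1 (r • x + 0)
    have g0 := gradDot_self_nonneg ψ x
    set l := lap χ (r • x + 0)
    set G := gradDot ψ (fun x => χ (r • x + 0)) x
    set g := gradDot χ χ (r • x + 0)
    set c := χ (r • x + 0)
    have hl : l ^ 2 ≤ K0 ^ 2 := sq_le_sq' b0.1 b0.2
    have hG : G ^ 2 ≤ r ^ 2 * (K1 * gradDot ψ ψ x) := by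
      refine e2.trans ?_
      have : r ^ 2 * (gradDot ψ ψ x * g) ≤ r ^ 2 * (gradDot ψ ψ x * K1) := by gcongr; exact b1.2
      linarith
    have hE : (ψ x * (r ^ 2 * l) + 2 * G) ^ 2 ≤ r ^ 2 * (K * (ψ x ^ 2 + gradDot ψ ψ x)) := by
      have t1 : ψ x ^ 2 * r ^ 4 * l ^ 2 ≤ ψ x ^ 2 * r ^ 2 * K0 ^ 2 := by
        have : r ^ 4 ≤ r ^ 2 := pow_le_pow_of_le_one hr0.le hr1 (by norm_num)
        gcongr
      have t2 : 0 ≤ r ^ 2 * (8 * K1 * ψ x ^ 2 + 2 * K0 ^ 2 * gradDot ψ ψ x) := by positivity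
      rw [hK]
      nlinarith [sq_nonneg (ψ x * (r ^ 2 * l) - 2 * G)]
    set E := ψ x * (r ^ 2 * l) + 2 * G
    have hc2 : c ^ 2 ≤ 1 := by nlinarith
    have hA : (c * lap ψ x + E) ^ 2 ≤ (1 + r) * lap ψ x ^ 2 + (1 + r⁻¹) * E ^ 2 := by
      have y : 0 ≤ (r * (c * lap ψ x) - E) ^ 2 * r⁻¹ := by positivity
      have y' : (r * (c * lap ψ x) - E) ^ 2 * r⁻¹ =
        r * (c * lap ψ x) ^ 2 - 2 * (c * lap ψ x) * E + r⁻¹ * E ^ 2 := by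
        field_simp; ring
      have y2 : (c * lap ψ x) ^ 2 ≤ lap ψ x ^ 2 := by
        rw [mul_pow]; nlinarith [sq_nonneg (lap ψ x)]
      nlinarith
    have hB : (1 + r⁻¹) * E ^ 2 ≤ (r + r ^ 2) * K * (ψ x ^ 2 + gradDot ψ ψ x) := by
      calc (1 + r⁻¹) * E ^ 2 ≤ (1 + r⁻¹) * (r ^ 2 * (K * (ψ x ^ 2 + gradDot ψ ψ x))) := by
            gcongr
        _ = _ := by field_simp; ring
    calc _ = (c * lap ψ x + E) ^ 2 := by ring
      _ ≤ _ := hA.trans (by linarith)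
  have hlim : Filter.Tendsto (fun r : ℝ => (1 + r) * (∫ x, lap ψ x ^ 2) +
      (r + r ^ 2) * K * ((∫ x, ψ x ^ 2) + ∫ x, gradDot ψ ψ x)) (nhdsWithin 0 (Set.Ioi 0))
      (nhds (∫ x, lap ψ x ^ 2)) := by
    refine Filter.Tendsto.mono_left ?_ nhdsWithin_le_nhds
    refine Continuous.tendsto' (by fun_prop) _ _ (by simp)
  refine ge_of_tendsto hlim ?_
  filter_upwards [Ioo_mem_nhdsGT (show (0 : ℝ) < 1 / (1 + |R|) by positivity)] with r hr
  exact key r hr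

end Cutoff

section HalfStability

open scoped SchwartzMap FourierTransform Laplacian

variable {N : ℕ}

/-- The real part of a Schwartz function. -/
noncomputable def rePart (g : 𝓢(EuclideanSpace ℝ (Fin N), ℂ)) (c : ℂ)
    (x : EuclideanSpace ℝ (Fin N)) : ℝ := (c * g x).re

theorem contDiff_rePart (g : 𝓢(EuclideanSpace ℝ (Fin N), ℂ)) (c : ℂ) :
    ContDiff ℝ ∞ (rePart g c) :=
  Complex.reCLM.contDiff.comp (contDiff_const.mul (g.smooth _))

open scoped LineDeriv in
theorem pd_rePart (g : 𝓢(EuclideanSpace ℝ (Fin N), ℂ)) (c : ℂ) (i : Fin N) :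
    pd (rePart g c) i = rePart (∂_{EuclideanSpace.single i (1 : ℝ)} g) c := by
  ext x
  have h1 : HasFDerivAt g (fderiv ℝ g x) x := g.differentiableAt.hasFDerivAt
  have h2 := (Complex.reCLM.hasFDerivAt (x := c * g x)).comp x (h1.const_mul c)
  have h3 : fderiv ℝ (rePart g c) x = _ := h2.fderiv
  simp [pd, h3, rePart, SchwartzMap.lineDerivOp_apply_eq_fderiv]

theorem lap_rePart (g : 𝓢(EuclideanSpace ℝ (Fin N), ℂ)) (c : ℂ) :
    lap (rePart g c) = rePart (Δ g) c := by
  ext x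
  rw [lap_eq_sum_pd, SchwartzMap.laplacian_eq_sum (EuclideanSpace.basisFun (Fin N) ℝ)]
  simp only [pd_rePart, rePart, sum_apply, EuclideanSpace.basisFun_apply,
    Finset.mul_sum, Complex.re_sum]

theorem integrable_norm_sq (g : 𝓢(EuclideanSpace ℝ (Fin N), ℂ)) :
    Integrable fun x => ‖g x‖ ^ 2 := by
  simpa using (g.memLp 2 volume).integrable_norm_pow two_ne_zero

theorem integrable_rePart_sq (g : 𝓢(EuclideanSpace ℝ (Fin N), ℂ)) (c : ℂ) :
    Integrable fun x => rePart g c x ^ 2 := by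
  refine ((integrable_norm_sq g).const_mul (‖c‖ ^ 2)).mono'
    ((contDiff_rePart g c).continuous.pow 2).aestronglyMeasurable (.of_forall fun x => ?_)
  rw [norm_pow, ← mul_pow, ← norm_mul]
  exact pow_le_pow_left₀ (norm_nonneg _) (Complex.abs_re_le_norm _) 2

theorem integrable_gradDot_rePart (g : 𝓢(EuclideanSpace ℝ (Fin N), ℂ)) (c : ℂ) :
    Integrable (gradDot (rePart g c) (rePart g c)) := by
  refine integrable_finsetSum _ fun i _ => ?_
  simp only [pd_rePart, ← sq]
  exact integrable_rePart_sq _ _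

theorem norm_sq_eq_rePart (g : 𝓢(EuclideanSpace ℝ (Fin N), ℂ)) (x : EuclideanSpace ℝ (Fin N)) :
    ‖g x‖ ^ 2 = rePart g 1 x ^ 2 + rePart g Complex.I x ^ 2 := by
  rw [← Complex.normSq_eq_norm_sq, Complex.normSq_apply]
  simp [rePart]
  ring

theorem integral_sq_mul_norm_sq_le {W : EuclideanSpace ℝ (Fin N) → ℝ} {R C : ℝ}
    (hWm : Measurable W) (hC : ∀ x, |W x| ≤ C) (hR : ∀ x, R < ‖x‖ → W x = 0)
    (hW : ∀ φ : EuclideanSpace ℝ (Fin N) → ℝ, ContDiff ℝ ∞ φ → HasCompactSupport φ →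
      ∫ x, W x ^ 2 * φ x ^ 2 ≤ ∫ x, lap φ x ^ 2) (g : 𝓢(EuclideanSpace ℝ (Fin N), ℂ)) :
    ∫ x, W x ^ 2 * ‖g x‖ ^ 2 ≤ ∫ x, ‖(Δ g) x‖ ^ 2 := by
  have key : ∀ c, ∫ x, W x ^ 2 * rePart g c x ^ 2 ≤ ∫ x, rePart (Δ g) c x ^ 2 := by
    intro c
    have := integral_sq_mul_sq_le_of_integrable hR hW (contDiff_rePart g c)
      (integrable_rePart_sq g c) (integrable_gradDot_rePart g c)
      (by rw [lap_rePart]; exact integrable_rePart_sq _ _)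
    rwa [lap_rePart] at this
  have hi : ∀ c, Integrable fun x => W x ^ 2 * rePart g c x ^ 2 := fun c =>
    (integrable_rePart_sq g c).bdd_mul (hWm.pow_const 2).aestronglyMeasurable
      (.of_forall fun x => by
        rw [norm_pow]; exact pow_le_pow_left₀ (norm_nonneg _) (hC x) 2)
  simp_rw [norm_sq_eq_rePart, mul_add]
  rw [integral_add (hi _) (hi _),
    integral_add (integrable_rePart_sq _ _) (integrable_rePart_sq _ _)]
  exact add_le_add (key _) (key _)

theorem norm_sq_toLp_eq (g : 𝓢(EuclideanSpace ℝ (Fin N), ℂ)) :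
    ‖g.toLp 2 volume‖ ^ 2 = ∫ x, ‖g x‖ ^ 2 := by
  rw [norm_sq_toLp_two]
  refine integral_congr_ae ?_
  filter_upwards [g.coeFn_toLp 2 volume] with x hx
  rw [hx]

end HalfStability

section HalfStability

open scoped SchwartzMap FourierTransform Laplacian

variable {N : ℕ}

theorem fourierMultiplier_resolventSymbol {k : ℝ} (hk : 0 < k) {r s t : ℝ} (h : r + s = t)
    (f : 𝓢(EuclideanSpace ℝ (Fin N), ℂ)) :
    SchwartzMap.fourierMultiplierCLM ℂ (resolventSymbol (N := N) k r)
      (SchwartzMap.fourierMultiplierCLM ℂ (resolventSymbol (N := N) k s) f) =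
    SchwartzMap.fourierMultiplierCLM ℂ (resolventSymbol (N := N) k t) f := by
  rw [SchwartzMap.fourierMultiplierCLM_fourierMultiplierCLM_apply
    (hasTemperateGrowth_resolventSymbol hk r) (hasTemperateGrowth_resolventSymbol hk s),
    resolventSymbol_mul hk, h]

theorem norm_laplacian_resolvent_le {k : ℝ} (hk : 0 < k) (f : 𝓢(EuclideanSpace ℝ (Fin N), ℂ)) :
    ‖(Δ (SchwartzMap.fourierMultiplierCLM ℂ (resolventSymbol (N := N) k (-1)) f)).toLp 2 volume‖ ≤
      ‖f.toLp 2 volume‖ := by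
  have h0 : (fun ξ : EuclideanSpace ℝ (Fin N) => ‖ξ‖ ^ 2).HasTemperateGrowth := by fun_prop
  have h1 := hasTemperateGrowth_resolventSymbol (N := N) hk (-1)
  have hm := h0.mul h1
  have hC : ∀ ξ : EuclideanSpace ℝ (Fin N),
      |((fun ξ => ‖ξ‖ ^ 2) * resolventSymbol k (-1) : EuclideanSpace ℝ (Fin N) → ℝ) ξ| ≤ ((2 * π) ^ 2)⁻¹ := by
    intro ξ
    have e : ((fun ξ => ‖ξ‖ ^ 2) * resolventSymbol k (-1) : EuclideanSpace ℝ (Fin N) → ℝ) ξ =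
        ‖ξ‖ ^ 2 / (k ^ 2 + (2 * π) ^ 2 * ‖ξ‖ ^ 2) := by
      simp [resolventSymbol, rpow_neg_one, div_eq_mul_inv]
    rw [e, abs_of_nonneg (by positivity), div_le_iff₀ (by positivity)]
    have : 0 < π := pi_pos
    field_simp
    nlinarith [sq_nonneg k]
  have hm' := hm.1.continuous.measurable
  have h2 := norm_multiplierL2_le hm' hC (f.toLp 2)
  rw [multiplierL2_toLp hm' hC hm] at h2
  rw [SchwartzMap.laplacian_eq_fourierMultiplierCLM]
  have e : SchwartzMap.fourierMultiplierCLM ℂ (fun ξ : EuclideanSpace ℝ (Fin N) => ‖ξ‖ ^ 2)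
      (SchwartzMap.fourierMultiplierCLM ℂ (resolventSymbol (N := N) k (-1)) f) =
      SchwartzMap.fourierMultiplierCLM ℂ ((fun ξ => ‖ξ‖ ^ 2) * resolventSymbol k (-1)) f :=
    SchwartzMap.fourierMultiplierCLM_fourierMultiplierCLM_apply h0 h1 f
  rw [e]
  have e2 : ∀ (c : ℝ) (g : 𝓢(EuclideanSpace ℝ (Fin N), ℂ)),
      ‖(c • g).toLp 2 volume‖ = |c| * ‖g.toLp 2 volume‖ := by
    intro c g
    have : (c • g).toLp 2 volume = c • g.toLp 2 volume :=
      (SchwartzMap.toLpCLM ℝ ℂ 2 volume).map_smul c g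
    rw [this, norm_smul, norm_eq_abs]
  rw [e2, abs_neg, abs_of_nonneg (by positivity)]
  calc _ ≤ (2 * π) ^ 2 * (((2 * π) ^ 2)⁻¹ * ‖f.toLp 2 volume‖) := by gcongr
    _ = _ := by rw [mul_inv_cancel_left₀ (by positivity)]

set_option maxHeartbeats 2000000 in
theorem half_stability_of_bounded {W : EuclideanSpace ℝ (Fin N) → ℝ} {R C : ℝ}
    (hWm : Measurable W) (hC : ∀ x, |W x| ≤ C) (hR : ∀ x, R < ‖x‖ → W x = 0)
    (hW : ∀ φ : EuclideanSpace ℝ (Fin N) → ℝ, ContDiff ℝ ∞ φ → HasCompactSupport φ →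
      ∫ x, W x ^ 2 * φ x ^ 2 ≤ ∫ x, lap φ x ^ 2)
    {ψ : EuclideanSpace ℝ (Fin N) → ℝ} (hψ : ContDiff ℝ ∞ ψ) (hψc : HasCompactSupport ψ)
    {k : ℝ} (hk : 0 < k) :
    ∫ x, W x * ψ x ^ 2 ≤ k ^ 2 * (∫ x, ψ x ^ 2) + ∫ x, gradDot ψ ψ x := by
  have hm := (continuous_resolventSymbol (N := N) hk (-1 / 2)).measurable
  have hmC := abs_resolventSymbol_le (N := N) (r := -1 / 2) hk (by norm_num)
  have hmt := hasTemperateGrowth_resolventSymbol (N := N) hk (-1 / 2)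
  set Y := multiplierL2 hm hmC with hY
  set V := mulL2 volume hWm hC with hV
  have hYf : ∀ f : 𝓢(EuclideanSpace ℝ (Fin N), ℂ), Y (f.toLp 2) =
      (SchwartzMap.fourierMultiplierCLM ℂ (resolventSymbol k (-1 / 2)) f).toLp 2 :=
    multiplierL2_toLp hm hmC hmt
  have hVYY : ‖V * Y * Y‖ ≤ 1 := by
    refine ContinuousLinearMap.opNorm_le_bound _ zero_le_one fun f => ?_
    refine (SchwartzMap.denseRange_toLpCLM (E := EuclideanSpace ℝ (Fin N)) (F := ℂ) (p := 2)
      (μ := volume) (by norm_num)).induction_on f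
      (isClosed_le (by fun_prop) (by fun_prop)) fun f => ?_
    simp only [SchwartzMap.toLpCLM_apply, mul_apply_eq_comp, one_mul]
    rw [hYf, hYf, fourierMultiplier_resolventSymbol hk (t := -1) (by norm_num)]
    refine le_trans ?_ (norm_laplacian_resolvent_le hk f)
    set g := SchwartzMap.fourierMultiplierCLM ℂ (resolventSymbol (N := N) k (-1)) f
    rw [← sq_le_sq₀ (norm_nonneg _) (norm_nonneg _), norm_sq_toLp_two, norm_sq_toLp_eq]
    refine le_trans (le_of_eq ?_) (integral_sq_mul_norm_sq_le hWm hC hR hW g)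
    refine integral_congr_ae ?_
    filter_upwards [coeFn_mulL2 hWm hC (g.toLp 2 volume), g.coeFn_toLp 2 volume] with x h1 h2
    rw [h1, h2, norm_mul, mul_pow, Complex.norm_real, norm_eq_abs, sq_abs]
  have hψc' : HasCompactSupport fun x => (ψ x : ℂ) := hψc.comp_left Complex.ofReal_zero
  set Ψ : 𝓢(EuclideanSpace ℝ (Fin N), ℂ) :=
    hψc'.toSchwartzMap (Complex.ofRealCLM.contDiff.comp hψ)
  have hΨ : ∀ x, Ψ x = (ψ x : ℂ) := fun x => rfl
  set G := fun r => SchwartzMap.fourierMultiplierCLM ℂ (resolventSymbol (N := N) k r) Ψ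
  have hYG : ∀ r, Y ((G r).toLp 2) = (G (r - 1 / 2)).toLp 2 := by
    intro r
    rw [hYf, fourierMultiplier_resolventSymbol hk (t := r - 1 / 2) (by ring)]
  have hG0 : G 0 = Ψ := by
    simp [G, resolventSymbol_zero]
  have key := re_inner_le_norm_sq (isSelfAdjoint_mulL2 hWm hC) (isSelfAdjoint_multiplierL2 hm hmC)
    hVYY ((G (1 / 2)).toLp 2)
  rw [← hY, ← hV, hYG, sub_self, hG0] at key
  have e1 : RCLike.re (inner ℂ (V (Ψ.toLp 2)) (Ψ.toLp 2)) = ∫ x, W x * ψ x ^ 2 := by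
    rw [L2.inner_def, ← integral_re (L2.integrable_inner _ _)]
    refine integral_congr_ae ?_
    filter_upwards [coeFn_mulL2 hWm hC (Ψ.toLp 2 volume), Ψ.coeFn_toLp 2 volume] with x h1 h2
    rw [h1, h2, hΨ]
    simp
    ring
  have hlap : ∀ x, (Δ Ψ x).re = lap ψ x := by
    intro x
    have h1 : rePart Ψ 1 = ψ := by ext; simp [rePart, hΨ]
    have h2 := congrFun (lap_rePart Ψ 1) x
    rw [h1] at h2
    simp [h2, rePart]
  have e2 : ‖(G (1 / 2)).toLp 2‖ ^ 2 = ∫ x, (k ^ 2 * ψ x - lap ψ x) * ψ x := by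
    have h1 : (G (1 / 2)).toLp 2 volume = Y ((G 1).toLp 2) := by rw [hYG]; norm_num
    have h2 := ContinuousLinearMap.isSelfAdjoint_iff_isSymmetric.1
      (isSelfAdjoint_multiplierL2 hm hmC) ((G 1).toLp 2) ((G (1 / 2)).toLp 2)
    simp only [ContinuousLinearMap.coe_coe] at h2
    rw [← hY, hYG (1 / 2), sub_self, hG0, ← h1] at h2
    rw [← inner_self_eq_norm_sq (𝕜 := ℂ), h2, L2.inner_def,
      ← integral_re (L2.integrable_inner _ _)]
    refine integral_congr_ae ?_
    filter_upwards [(G 1).coeFn_toLp 2 volume, Ψ.coeFn_toLp 2 volume] with x h1 h2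
    rw [h1, h2, hΨ]
    simp only [G, fourierMultiplier_resolventSymbol_one]
    simp [hlap, hΨ, -Complex.ofReal_pow]
    ring
  have hψ2 : ContDiff ℝ 2 ψ := contDiff_infty.1 hψ 2
  have hψ1 : ContDiff ℝ 1 ψ := contDiff_infty.1 hψ 1
  have i0 : Integrable fun x => k ^ 2 * ψ x ^ 2 :=
    (by fun_prop : Continuous fun x => k ^ 2 * ψ x ^ 2).integrable_of_hasCompactSupport
      ((hψc.comp_left (g := fun t => k ^ 2 * t ^ 2) (by simp)))
  have i1 : Integrable fun x => gradDot ψ ψ x :=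
    (continuous_gradDot hψ1 hψ1).integrable_of_hasCompactSupport (hasCompactSupport_gradDot hψc)
  have i2 : Integrable fun x => ψ x * lap ψ x + gradDot ψ ψ x :=
    ((hψ1.continuous.mul (continuous_lap hψ2)).integrable_of_hasCompactSupport hψc.mul_right).add i1
  have i01 : Integrable fun x => k ^ 2 * ψ x ^ 2 + gradDot ψ ψ x := i0.add i1
  have e3 : ∫ x, (k ^ 2 * ψ x - lap ψ x) * ψ x =
      k ^ 2 * (∫ x, ψ x ^ 2) + ∫ x, gradDot ψ ψ x := by
    rw [← integral_const_mul, ← integral_add i0 i1, ← sub_eq_zero, ← integral_sub _ i01,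
      ← neg_eq_zero, ← integral_neg, ← integral_mul_lap_add_gradDot hψ1 hψ2 hψc]
    · refine integral_congr_ae (.of_forall fun x => ?_)
      beta_reduce
      ring
    · refine ((i0.sub i2).add i1).congr (.of_forall fun x => ?_)
      simp only [Pi.add_apply, Pi.sub_apply]
      ring
  rw [e1, e2, e3] at key
  exact key

/-- Stability for the bilaplacian with potential `V²` implies stability for the Laplacian with
potential `V`. -/
theorem half_stability {V : EuclideanSpace ℝ (Fin N) → ℝ} (hVc : Continuous V)
    (hV : ∀ φ : EuclideanSpace ℝ (Fin N) → ℝ, ContDiff ℝ ∞ φ → HasCompactSupport φ →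
      ∫ x, V x ^ 2 * φ x ^ 2 ≤ ∫ x, lap φ x ^ 2)
    {ψ : EuclideanSpace ℝ (Fin N) → ℝ} (hψ : ContDiff ℝ ∞ ψ) (hψc : HasCompactSupport ψ) :
    ∫ x, V x * ψ x ^ 2 ≤ ∫ x, gradDot ψ ψ x := by
  obtain ⟨R, hR⟩ := hψc.isCompact.isBounded.subset_closedBall (0 : EuclideanSpace ℝ (Fin N))
  set W := (Metric.closedBall (0 : EuclideanSpace ℝ (Fin N)) R).indicator V with hWdef
  obtain ⟨C, hC⟩ := (isCompact_closedBall (0 : EuclideanSpace ℝ (Fin N)) R).exists_bound_of_continuousOn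
    hVc.continuousOn
  have hWm : Measurable W := hVc.measurable.indicator Metric.isClosed_closedBall.measurableSet
  have hWC : ∀ x, |W x| ≤ |C| := by
    intro x
    by_cases hx : x ∈ Metric.closedBall (0 : EuclideanSpace ℝ (Fin N)) R
    · rw [hWdef, Set.indicator_of_mem hx]; exact (hC x hx).trans (le_abs_self _)
    · rw [hWdef, Set.indicator_of_notMem hx]; simp
  have hWR : ∀ x, R < ‖x‖ → W x = 0 := fun x hx =>
    Set.indicator_of_notMem (by simpa using hx) _
  have hWV : ∀ x, W x ^ 2 ≤ V x ^ 2 := by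
    intro x
    by_cases hx : x ∈ Metric.closedBall (0 : EuclideanSpace ℝ (Fin N)) R
    · rw [hWdef, Set.indicator_of_mem hx]
    · rw [hWdef, Set.indicator_of_notMem hx]; simpa using sq_nonneg _
  have hW : ∀ φ : EuclideanSpace ℝ (Fin N) → ℝ, ContDiff ℝ ∞ φ → HasCompactSupport φ →
      ∫ x, W x ^ 2 * φ x ^ 2 ≤ ∫ x, lap φ x ^ 2 := by
    intro φ hφ hφc
    refine le_trans ?_ (hV φ hφ hφc)
    have hφ' := hφ.continuous
    refine integral_mono_of_nonneg (.of_forall fun x => by positivity)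
      ((by fun_prop : Continuous fun x => V x ^ 2 * φ x ^ 2).integrable_of_hasCompactSupport
      (hφc.comp_left (g := fun t => t ^ 2) (by simp)).mul_left) (.of_forall fun x => ?_)
    exact mul_le_mul_of_nonneg_right (hWV x) (sq_nonneg _)
  have e : ∀ x, W x * ψ x ^ 2 = V x * ψ x ^ 2 := by
    intro x
    by_cases hx : x ∈ Metric.closedBall (0 : EuclideanSpace ℝ (Fin N)) R
    · rw [hWdef, Set.indicator_of_mem hx]
    · rw [image_eq_zero_of_notMem_tsupport fun h => hx (hR h)]; simp
  have hlim : Filter.Tendsto (fun k : ℝ => k ^ 2 * (∫ x, ψ x ^ 2) + ∫ x, gradDot ψ ψ x)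
      (nhdsWithin 0 (Set.Ioi 0)) (nhds (∫ x, gradDot ψ ψ x)) :=
    Filter.Tendsto.mono_left (Continuous.tendsto' (by fun_prop) _ _ (by simp)) nhdsWithin_le_nhds
  simp_rw [← e]
  refine ge_of_tendsto hlim ?_
  filter_upwards [self_mem_nhdsWithin] with k hk
  exact half_stability_of_bounded hWm hWC hWR hW hψ hψc hk

end HalfStability

section Mollification

open scoped Convolution

variable {N : ℕ}

/-- A bump function supported in the ball of radius `1 / (n + 1)`. -/
noncomputable def mollifier (N n : ℕ) : ContDiffBump (0 : EuclideanSpace ℝ (Fin N)) :=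
  ⟨1 / (2 * (n + 1)), 1 / (n + 1), by positivity, by gcongr; linarith⟩

/-- Convolution with a smooth kernel supported in the ball of radius `1 / (n + 1)`. -/
noncomputable def mollify (n : ℕ) (g : EuclideanSpace ℝ (Fin N) → ℝ) :
    EuclideanSpace ℝ (Fin N) → ℝ :=
  (mollifier N n).normed volume ⋆[ContinuousLinearMap.lsmul ℝ ℝ, volume] g

theorem tendsto_mollify {g : EuclideanSpace ℝ (Fin N) → ℝ} (hg : Continuous g)
    (x : EuclideanSpace ℝ (Fin N)) :
    Filter.Tendsto (fun n => mollify n g x) Filter.atTop (nhds (g x)) :=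
  ContDiffBump.convolution_tendsto_right_of_continuous tendsto_one_div_add_atTop_nhds_zero_nat hg x

theorem abs_mollify_sub_le {g : EuclideanSpace ℝ (Fin N) → ℝ} (hg : Continuous g) (n : ℕ)
    {x : EuclideanSpace ℝ (Fin N)} {ε : ℝ}
    (h : ∀ y ∈ Metric.ball x 1, |g y - g x| ≤ ε) : |mollify n g x - g x| ≤ ε := by
  refine ContDiffBump.dist_normed_convolution_le (φ := mollifier N n) hg.aestronglyMeasurable fun y hy => ?_
  refine h y (Metric.ball_subset_ball ?_ hy)
  change (1 : ℝ) / (n + 1) ≤ 1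
  rw [div_le_one (by positivity)]
  linarith [(Nat.cast_nonneg n : (0 : ℝ) ≤ n)]

theorem abs_mollify_le {g : EuclideanSpace ℝ (Fin N) → ℝ} (hg : Continuous g) (n : ℕ) {M : ℝ}
    (h : ∀ y, |g y| ≤ M) (x : EuclideanSpace ℝ (Fin N)) : |mollify n g x| ≤ 3 * M := by
  have h1 : |mollify n g x - g x| ≤ 2 * M := abs_mollify_sub_le hg n fun y _ => by
    linarith [abs_sub (g y) (g x), h y, h x]
  have h2 := abs_add_le (mollify n g x - g x) (g x)
  rw [sub_add_cancel] at h2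
  linarith [h x]

theorem mollify_eq_zero {g : EuclideanSpace ℝ (Fin N) → ℝ} (hg : Continuous g) (n : ℕ) {R : ℝ}
    (h : ∀ y, R < ‖y‖ → g y = 0) {x : EuclideanSpace ℝ (Fin N)} (hx : R + 1 < ‖x‖) :
    mollify n g x = 0 := by
  have h0 : g x = 0 := h x (by linarith)
  have h1 : |mollify n g x - g x| ≤ 0 := abs_mollify_sub_le hg n fun y hy => by
    have h2 : R < ‖y‖ := by
      have := norm_sub_norm_le x y
      rw [mem_ball_iff_norm'] at hy
      linarith
    simp [h0, h y h2]
  simpa [h0] using h1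

theorem contDiff_mollify {g : EuclideanSpace ℝ (Fin N) → ℝ} (hg : Continuous g) (n : ℕ) :
    ContDiff ℝ ∞ (mollify n g) :=
  (ContDiffBump.hasCompactSupport_normed _).contDiff_convolution_left _
    (ContDiffBump.contDiff_normed _) hg.locallyIntegrable

theorem pd_mollify {g : EuclideanSpace ℝ (Fin N) → ℝ} (hg : ContDiff ℝ 1 g)
    (hc : HasCompactSupport g) (n : ℕ) (i : Fin N) : pd (mollify n g) i = mollify n (pd g i) := by
  ext x
  have h := hc.hasFDerivAt_convolution_right (μ := volume) (ContinuousLinearMap.lsmul ℝ ℝ)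
    (f := (mollifier N n).normed volume)
    (ContDiffBump.continuous_normed _).locallyIntegrable hg x
  have h' : fderiv ℝ (mollify n g) x = _ := h.fderiv
  rw [pd, h', convolution_precompR_apply _ (ContDiffBump.continuous_normed _).locallyIntegrable
    (hc.fderiv (𝕜 := ℝ)) (hg.continuous_fderiv one_ne_zero)]
  rfl

theorem lap_mollify {g : EuclideanSpace ℝ (Fin N) → ℝ} (hg : ContDiff ℝ 2 g)
    (hc : HasCompactSupport g) (n : ℕ) (x : EuclideanSpace ℝ (Fin N)) :
    lap (mollify n g) x = ∑ i, mollify n (pd (pd g i) i) x := by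
  rw [lap_eq_sum_pd]
  refine Finset.sum_congr rfl fun i _ => ?_
  rw [pd_mollify (hg.of_le one_le_two) hc, pd_mollify (contDiff_one_pd hg i) (hasCompactSupport_pd hc i)]

theorem exists_norm_bound_support {g : EuclideanSpace ℝ (Fin N) → ℝ} (hc : HasCompactSupport g) :
    ∃ R, ∀ y, R < ‖y‖ → y ∉ tsupport g := by
  obtain ⟨R, hR⟩ := hc.isCompact.isBounded.subset_closedBall (0 : EuclideanSpace ℝ (Fin N))
  exact ⟨R, fun y hy hy' => absurd (mem_closedBall_zero_iff.1 (hR hy')) (not_le.2 hy)⟩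

theorem tendsto_integral_of_bounded_support {F : ℕ → EuclideanSpace ℝ (Fin N) → ℝ}
    {f : EuclideanSpace ℝ (Fin N) → ℝ} {M R : ℝ} (hF : ∀ n, Continuous (F n))
    (hM : ∀ n x, |F n x| ≤ M) (hR : ∀ n x, R < ‖x‖ → F n x = 0)
    (hlim : ∀ x, Filter.Tendsto (fun n => F n x) Filter.atTop (nhds (f x))) :
    Filter.Tendsto (fun n => ∫ x, F n x) Filter.atTop (nhds (∫ x, f x)) := by
  refine tendsto_integral_of_dominated_convergence
    ((Metric.closedBall (0 : EuclideanSpace ℝ (Fin N)) R).indicator fun _ => M)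
    (fun n => (hF n).aestronglyMeasurable) ?_ (fun n => .of_forall fun x => ?_) (.of_forall hlim)
  · rw [integrable_indicator_iff Metric.isClosed_closedBall.measurableSet]
    exact integrableOn_const (isCompact_closedBall _ _).measure_lt_top.ne
  · by_cases hx : x ∈ Metric.closedBall (0 : EuclideanSpace ℝ (Fin N)) R
    · rw [Set.indicator_of_mem hx]; exact hM n x
    · rw [Set.indicator_of_notMem hx, hR n x (by simpa using hx)]; simp

theorem tendsto_integral_mul_sq_mollify {A g : EuclideanSpace ℝ (Fin N) → ℝ} (hA : Continuous A)
    (hg : Continuous g) (hc : HasCompactSupport g) :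
    Filter.Tendsto (fun n => ∫ x, A x * mollify n g x ^ 2) Filter.atTop
      (nhds (∫ x, A x * g x ^ 2)) := by
  obtain ⟨M, hM0, hM⟩ := exists_bound_of_hasCompactSupport hg hc
  obtain ⟨R, hR⟩ := exists_norm_bound_support hc
  obtain ⟨K, hK⟩ := (isCompact_closedBall (0 : EuclideanSpace ℝ (Fin N)) (R + 1)).exists_bound_of_continuousOn
    hA.continuousOn
  have h0 : ∀ n x, R + 1 < ‖x‖ → mollify n g x = 0 := fun n x =>
    mollify_eq_zero hg n fun y hy => image_eq_zero_of_notMem_tsupport (hR y hy)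
  refine tendsto_integral_of_bounded_support (M := |K| * (3 * M) ^ 2) (R := R + 1)
    (fun n => hA.mul ((contDiff_mollify hg n).continuous.pow 2)) (fun n x => ?_)
    (fun n x hx => by simp [h0 n x hx]) fun x => ((tendsto_mollify hg x).pow 2).const_mul _
  rcases le_or_gt ‖x‖ (R + 1) with hx | hx
  · rw [abs_mul, abs_pow]
    have h1 := abs_mollify_le hg n hM x
    have h2 := (hK x (by simpa using hx)).trans (le_abs_self K)
    exact mul_le_mul h2 (pow_le_pow_left₀ (abs_nonneg _) h1 2) (by positivity) (abs_nonneg _)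
  · simp [h0 n x hx]; positivity

theorem hasCompactSupport_mollify {g : EuclideanSpace ℝ (Fin N) → ℝ} (hg : Continuous g)
    (hc : HasCompactSupport g) (n : ℕ) : HasCompactSupport (mollify n g) := by
  obtain ⟨R, hR⟩ := exists_norm_bound_support hc
  refine HasCompactSupport.of_support_subset_isCompact
    (isCompact_closedBall (0 : EuclideanSpace ℝ (Fin N)) (R + 1)) fun x hx => ?_
  by_contra h
  exact hx (mollify_eq_zero hg n (fun y hy => image_eq_zero_of_notMem_tsupport (hR y hy))
    (by simpa using h))

theorem stability_of_contDiff_two {A : EuclideanSpace ℝ (Fin N) → ℝ} (hA : Continuous A)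
    (h : ∀ φ : EuclideanSpace ℝ (Fin N) → ℝ, ContDiff ℝ ∞ φ → HasCompactSupport φ →
      ∫ x, A x * φ x ^ 2 ≤ ∫ x, lap φ x ^ 2)
    {φ : EuclideanSpace ℝ (Fin N) → ℝ} (hφ : ContDiff ℝ 2 φ) (hc : HasCompactSupport φ) :
    ∫ x, A x * φ x ^ 2 ≤ ∫ x, lap φ x ^ 2 := by
  have hpp : ∀ i, Continuous (pd (pd φ i) i) := fun i => continuous_pd (contDiff_one_pd hφ i) i
  have hcc : ∀ i, HasCompactSupport (pd (pd φ i) i) := fun i =>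
    hasCompactSupport_pd (hasCompactSupport_pd hc i) i
  obtain ⟨R, hR⟩ := exists_norm_bound_support hc
  choose M hM0 hM using fun i => exists_bound_of_hasCompactSupport (hpp i) (hcc i)
  refine le_of_tendsto_of_tendsto' (tendsto_integral_mul_sq_mollify hA hφ.continuous hc)
    (tendsto_integral_of_bounded_support (R := R + 1) (M := (∑ i, 3 * M i) ^ 2)
      (F := fun n x => lap (mollify n φ) x ^ 2)
      (fun n => (continuous_lap (contDiff_infty.1 (contDiff_mollify hφ.continuous n) 2)).pow 2)
      (fun n x => ?_) (fun n x hx => ?_) fun x => ?_)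
    fun n => h _ (contDiff_mollify hφ.continuous n) (hasCompactSupport_mollify hφ.continuous hc n)
  · rw [abs_pow, lap_mollify hφ hc]
    refine pow_le_pow_left₀ (abs_nonneg _) ((Finset.abs_sum_le_sum_abs _ _).trans ?_) 2
    exact Finset.sum_le_sum fun i _ => abs_mollify_le (hpp i) n (hM i) x
  · rw [lap_mollify hφ hc, Finset.sum_eq_zero fun i _ => ?_, zero_pow two_ne_zero]
    exact mollify_eq_zero (hpp i) n (fun y hy => pd_eq_zero_of_notMem_tsupport
      (fun h => hR y hy (tsupport_pd_subset _ _ h)) i) hx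
  · simp_rw [lap_mollify hφ hc]
    exact (tendsto_finsetSum _ fun i _ => tendsto_mollify (hpp i) x).pow 2

theorem half_stability_of_contDiff_two {A : EuclideanSpace ℝ (Fin N) → ℝ} (hA : Continuous A)
    (h : ∀ φ : EuclideanSpace ℝ (Fin N) → ℝ, ContDiff ℝ ∞ φ → HasCompactSupport φ →
      ∫ x, A x * φ x ^ 2 ≤ ∫ x, gradDot φ φ x)
    {φ : EuclideanSpace ℝ (Fin N) → ℝ} (hφ : ContDiff ℝ 2 φ) (hc : HasCompactSupport φ) :
    ∫ x, A x * φ x ^ 2 ≤ ∫ x, gradDot φ φ x := by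
  have hφ1 : ContDiff ℝ 1 φ := hφ.of_le one_le_two
  have hpp : ∀ i, Continuous (pd φ i) := fun i => continuous_pd hφ1 i
  have hcc : ∀ i, HasCompactSupport (pd φ i) := fun i => hasCompactSupport_pd hc i
  obtain ⟨R, hR⟩ := exists_norm_bound_support hc
  choose M hM0 hM using fun i => exists_bound_of_hasCompactSupport (hpp i) (hcc i)
  refine le_of_tendsto_of_tendsto' (tendsto_integral_mul_sq_mollify hA hφ.continuous hc)
    (tendsto_integral_of_bounded_support (R := R + 1) (M := ∑ i, (3 * M i) * (3 * M i))
      (F := fun n => gradDot (mollify n φ) (mollify n φ))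
      (fun n => continuous_gradDot (contDiff_infty.1 (contDiff_mollify hφ.continuous n) 1)
        (contDiff_infty.1 (contDiff_mollify hφ.continuous n) 1))
      (fun n x => ?_) (fun n x hx => ?_) fun x => ?_)
    fun n => h _ (contDiff_mollify hφ.continuous n) (hasCompactSupport_mollify hφ.continuous hc n)
  · rw [gradDot]
    simp only [pd_mollify hφ1 hc]
    refine (Finset.abs_sum_le_sum_abs _ _).trans (Finset.sum_le_sum fun i _ => ?_)
    rw [abs_mul]
    have := abs_mollify_le (hpp i) n (hM i) x
    gcongr
    linarith [hM0 i]
  · rw [gradDot]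
    refine Finset.sum_eq_zero fun i _ => ?_
    rw [pd_mollify hφ1 hc, mollify_eq_zero (hpp i) n (fun y hy => pd_eq_zero_of_notMem_tsupport
      (hR y hy) i) hx, zero_mul]
  · simp only [gradDot, pd_mollify hφ1 hc]
    exact tendsto_finsetSum _ fun i _ =>
      (tendsto_mollify (hpp i) x).mul (tendsto_mollify (hpp i) x)

end Mollification

section StableSolution

variable {N : ℕ} {p : ℝ}

/-- Positive classical stable solutions of `Δ²u = u^p` on `ℝ^N`. -/
structure IsStableSolution (p : ℝ) (u : EuclideanSpace ℝ (Fin N) → ℝ) : Prop where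
  contDiff : ContDiff ℝ 4 u
  pos : ∀ x, 0 < u x
  lap_lap : ∀ x, lap (lap u) x = u x ^ p
  stable : ∀ φ : EuclideanSpace ℝ (Fin N) → ℝ, ContDiff ℝ ∞ φ → HasCompactSupport φ →
    p * ∫ x, u x ^ (p - 1) * φ x ^ 2 ≤ ∫ x, lap φ x ^ 2

theorem integral_comp_smul_add (f : EuclideanSpace ℝ (Fin N) → ℝ) {r : ℝ} (hr : 0 < r)
    (a : EuclideanSpace ℝ (Fin N)) :
    ∫ x, f (r • x + a) = (r ^ N)⁻¹ * ∫ x, f x := by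
  have h := Measure.integral_comp_smul (volume : Measure (EuclideanSpace ℝ (Fin N)))
    (fun y => f (y + a)) r
  simp only [finrank_euclideanSpace, Fintype.card_fin, smul_eq_mul] at h
  rw [h, integral_add_right_eq_self f a, abs_of_pos (by positivity)]

theorem setIntegral_closedBall_comp_smul_add (f : EuclideanSpace ℝ (Fin N) → ℝ) {r : ℝ}
    (hr : 0 < r) (a : EuclideanSpace ℝ (Fin N)) :
    ∫ x in Metric.closedBall 0 1, f (r • x + a) =
      (r ^ N)⁻¹ * ∫ x in Metric.closedBall a r, f x := by
  rw [← integral_indicator Metric.isClosed_closedBall.measurableSet,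
    ← integral_indicator Metric.isClosed_closedBall.measurableSet, ← integral_comp_smul_add _ hr a]
  congr 1
  ext x
  have : r • x + a ∈ Metric.closedBall a r ↔ x ∈ Metric.closedBall 0 1 := by
    simp [norm_smul, abs_of_pos hr, hr]
  by_cases hx : x ∈ Metric.closedBall (0 : EuclideanSpace ℝ (Fin N)) 1
  · rw [Set.indicator_of_mem hx, Set.indicator_of_mem (this.2 hx)]
  · rw [Set.indicator_of_notMem hx, Set.indicator_of_notMem (mt this.1 hx)]

namespace IsStableSolution

variable {u : EuclideanSpace ℝ (Fin N) → ℝ}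

theorem contDiff_two (hu : IsStableSolution p u) : ContDiff ℝ 2 u :=
  hu.contDiff.of_le (by norm_num)

theorem contDiff_lap (hu : IsStableSolution p u) : ContDiff ℝ 2 (lap u) :=
  _root_.contDiff_lap hu.contDiff (by norm_num [add_assoc, one_add_one_eq_two, two_add_one_eq_three])

theorem continuous_rpow (hu : IsStableSolution p u) (s : ℝ) : Continuous fun x => u x ^ s :=
  hu.contDiff.continuous.rpow_const fun x => .inl (hu.pos x).ne'

/-- The scaling and translation invariance of the problem. -/
theorem rescale (hp : 1 < p) (hu : IsStableSolution p u) {r : ℝ} (hr : 0 < r)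
    (a : EuclideanSpace ℝ (Fin N)) :
    IsStableSolution p fun y => r ^ (4 / (p - 1)) * u (r • y + a) := by
  have hp' : p - 1 ≠ 0 := by linarith
  have hr' : 0 < r ^ (4 / (p - 1)) := rpow_pos_of_pos hr _
  have hs : ∀ {n : WithTop ℕ∞}, ContDiff ℝ n fun y : EuclideanSpace ℝ (Fin N) => r • y + a :=
    (contDiff_id.const_smul r).add contDiff_const
  have hlap : ∀ y, lap (fun y => r ^ (4 / (p - 1)) * u (r • y + a)) y =
      (r ^ (4 / (p - 1)) * r ^ 2) * lap u (r • y + a) := fun y => by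
    rw [lap_const_mul (f := fun y => u (r • y + a)) _ (hu.contDiff_two.comp hs), lap_comp_smul_add r a hu.contDiff_two]
    ring
  refine ⟨contDiff_const.mul (hu.contDiff.comp hs), fun x => mul_pos hr' (hu.pos _), fun x => ?_,
    fun φ hφ hc => ?_⟩
  · rw [funext hlap, lap_const_mul (f := fun y => lap u (r • y + a)) _ (hu.contDiff_lap.comp hs),
      lap_comp_smul_add r a hu.contDiff_lap, hu.lap_lap, mul_rpow hr'.le (hu.pos _).le,
      ← rpow_mul hr.le, show 4 / (p - 1) * p = 4 / (p - 1) + 4 by field_simp; ring,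
      rpow_add hr, show r ^ (4 : ℝ) = r ^ 4 from rpow_natCast r 4]
    ring
  · set ψ : EuclideanSpace ℝ (Fin N) → ℝ := fun x => φ (r⁻¹ • (x - a)) with hψ
    have hψs : ContDiff ℝ ∞ ψ :=
      hφ.comp ((contDiff_id.sub contDiff_const).const_smul r⁻¹)
    have hψc : HasCompactSupport ψ :=
      hc.comp_homeomorph ((Homeomorph.subRight a).trans (Homeomorph.smulOfNeZero r⁻¹ (by positivity)))
    have e : φ = fun y => ψ (r • y + a) := by
      ext y; simp [hψ, smul_smul, hr.ne']
    have h := hu.stable ψ hψs hψc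
    have e1 : ∀ x, (r ^ (4 / (p - 1)) * u (r • x + a)) ^ (p - 1) * φ x ^ 2 =
        r ^ 4 * (fun z => u z ^ (p - 1) * ψ z ^ 2) (r • x + a) := fun x => by
      rw [mul_rpow hr'.le (hu.pos _).le, ← rpow_mul hr.le, div_mul_cancel₀ _ hp',
        show r ^ (4 : ℝ) = r ^ 4 from rpow_natCast r 4, e]
      ring
    have e2 : ∀ x, lap φ x ^ 2 = r ^ 4 * (fun z => lap ψ z ^ 2) (r • x + a) := fun x => by
      rw [e, lap_comp_smul_add r a (contDiff_infty.1 hψs 2)]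
      ring
    simp only [e1, e2]
    rw [integral_const_mul, integral_const_mul,
      integral_comp_smul_add (fun z => u z ^ (p - 1) * ψ z ^ 2) hr,
      integral_comp_smul_add (fun z => lap ψ z ^ 2) hr]
    have : 0 < r ^ 4 * (r ^ N)⁻¹ := by positivity
    nlinarith

theorem lap_rescale (hu : IsStableSolution p u) {r : ℝ} (hr : 0 < r)
    (a y : EuclideanSpace ℝ (Fin N)) :
    lap (fun y => r ^ (4 / (p - 1)) * u (r • y + a)) y =
      r ^ (4 / (p - 1) + 2) * lap u (r • y + a) := by
  have hs : ContDiff ℝ 2 fun y : EuclideanSpace ℝ (Fin N) => r • y + a :=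
    (contDiff_id.const_smul r).add contDiff_const
  rw [lap_const_mul (f := fun y => u (r • y + a)) _ (hu.contDiff_two.comp hs), lap_comp_smul_add r a hu.contDiff_two,
    rpow_add hr, show r ^ (2 : ℝ) = r ^ 2 from rpow_natCast r 2]
  ring

theorem stable_of_contDiff_two (hu : IsStableSolution p u)
    {φ : EuclideanSpace ℝ (Fin N) → ℝ} (hφ : ContDiff ℝ 2 φ) (hc : HasCompactSupport φ) :
    ∫ x, p * u x ^ (p - 1) * φ x ^ 2 ≤ ∫ x, lap φ x ^ 2 := by
  refine stability_of_contDiff_two (A := fun x => p * u x ^ (p - 1)) (continuous_const.mul (hu.continuous_rpow _))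
    (fun φ hφ hc => ?_) hφ hc
  have := hu.stable φ hφ hc
  rw [← integral_const_mul] at this
  simpa only [mul_assoc] using this

theorem half_stable (hp : 0 ≤ p) (hu : IsStableSolution p u)
    {φ : EuclideanSpace ℝ (Fin N) → ℝ} (hφ : ContDiff ℝ 2 φ) (hc : HasCompactSupport φ) :
    ∫ x, √p * u x ^ ((p - 1) / 2) * φ x ^ 2 ≤ ∫ x, gradDot φ φ x := by
  have hV : Continuous fun x => √p * u x ^ ((p - 1) / 2) :=
    continuous_const.mul (hu.continuous_rpow _)
  refine half_stability_of_contDiff_two hV (fun φ hφ hc => half_stability hV (fun φ hφ hc => ?_)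
    hφ hc) hφ hc
  have h := hu.stable_of_contDiff_two (contDiff_infty.1 hφ 2) hc
  refine le_trans (le_of_eq (integral_congr_ae (.of_forall fun x => ?_))) h
  simp only [mul_pow, sq_sqrt hp]
  rw [← rpow_natCast (u x ^ ((p - 1) / 2)) 2, ← rpow_mul (hu.pos x).le]
  norm_num

end IsStableSolution

end StableSolution

section Cutoff

variable {N : ℕ} {f g : EuclideanSpace ℝ (Fin N) → ℝ} {x : EuclideanSpace ℝ (Fin N)}

theorem integral_mul_lap_add_gradDot_right (hf : ContDiff ℝ 1 f) (hg : ContDiff ℝ 2 g)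
    (hc : HasCompactSupport g) : ∫ x, (f x * lap g x + gradDot f g x) = 0 := by
  have e : ∀ x, f x * lap g x + gradDot f g x = ∑ i, pd (fun y => f y * pd g i y) i x := by
    intro x
    simp only [lap_eq_sum_pd, gradDot, Finset.mul_sum, ← Finset.sum_add_distrib]
    refine Finset.sum_congr rfl fun i _ => ?_
    rw [pd_mul (hf.differentiable one_ne_zero x)
      ((contDiff_one_pd hg i).differentiable one_ne_zero x)]
  have h1 : ∀ i, ContDiff ℝ 1 fun y => f y * pd g i y := fun i => hf.mul (contDiff_one_pd hg i)
  have h2 : ∀ i, HasCompactSupport fun y => f y * pd g i y := fun i =>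
    (hasCompactSupport_pd hc i).mul_left
  simp only [e]
  rw [integral_finsetSum _ fun i _ => (continuous_pd (h1 i) i).integrable_of_hasCompactSupport
    (hasCompactSupport_pd (h2 i) i)]
  exact Finset.sum_eq_zero fun i _ => integral_pd_eq_zero (h1 i) (h2 i) i

theorem hasDerivAt_pow_succ (k : ℕ) (t : ℝ) :
    HasDerivAt (fun t : ℝ => t ^ (k + 1)) ((k + 1) * t ^ k) t := by
  simpa using hasDerivAt_pow (k + 1) t

theorem lap_pow (hf : ContDiff ℝ 2 f) (k : ℕ) :
    lap (fun y => f y ^ (k + 2)) x =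
      (k + 2) * f x ^ (k + 1) * lap f x + (k + 2) * (k + 1) * f x ^ k * gradDot f f x := by
  rw [lap_comp (φ := fun t => t ^ (k + 2)) (φ' := fun t => (k + 2) * t ^ (k + 1))
    (φ'' := fun t => (k + 2) * ((k + 1) * t ^ k)) (fun x => ?_) (fun x => ?_) hf]
  · ring
  · convert hasDerivAt_pow_succ (k + 1) (f x) using 1; push_cast; ring
  · exact (hasDerivAt_pow_succ k (f x)).const_mul _

theorem gradDot_pow_left (hf : DifferentiableAt ℝ f x) (k : ℕ) :
    gradDot (fun y => f y ^ (k + 1)) g x = (k + 1) * f x ^ k * gradDot f g x :=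
  gradDot_comp_left (φ := fun t => t ^ (k + 1)) (hasDerivAt_pow_succ k (f x)) hf

theorem gradDot_pow_self (hf : DifferentiableAt ℝ f x) (k : ℕ) :
    gradDot (fun y => f y ^ (k + 1)) (fun y => f y ^ (k + 1)) x =
      (k + 1) ^ 2 * f x ^ (2 * k) * gradDot f f x := by
  rw [gradDot_pow_left hf, gradDot_comm, gradDot_pow_left hf]
  ring

/-- Powers of a cutoff function have derivatives controlled by lower powers of it. -/
theorem exists_cutoff_pow (N k : ℕ) : ∃ (ζ : EuclideanSpace ℝ (Fin N) → ℝ) (K : ℝ), 0 ≤ K ∧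
    ContDiff ℝ ∞ ζ ∧ (∀ x, 0 ≤ ζ x) ∧ (∀ x, ζ x ≤ 1) ∧ (∀ x, ‖x‖ ≤ 1 → ζ x = 1) ∧
    tsupport ζ ⊆ Metric.closedBall 0 2 ∧ HasCompactSupport ζ ∧
    (∀ x, |lap (fun y => ζ y ^ (k + 2)) x| ≤ K * ζ x ^ k) ∧
    (∀ x, gradDot (fun y => ζ y ^ (k + 2)) (fun y => ζ y ^ (k + 2)) x ≤ K * ζ x ^ (2 * k + 2)) ∧
    (∀ x, |lap (gradDot (fun y => ζ y ^ (k + 2)) (fun y => ζ y ^ (k + 2))) x| ≤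
      K * ζ x ^ (2 * k)) := by
  obtain ⟨ζ, hζ, h0, h1, hone, hsupp, hc⟩ := exists_cutoff N
  have hζn : ∀ n : ℕ, ContDiff ℝ n ζ := contDiff_infty.1 hζ
  have hζd : Differentiable ℝ ζ := (hζn 1).differentiable one_ne_zero
  have hζ2 : ContDiff ℝ 2 ζ := hζn 2
  set q := gradDot ζ ζ with hq
  have hq2 : ContDiff ℝ 2 q := contDiff_gradDot (hζn 3) (hζn 3) (by norm_num [two_add_one_eq_three])
  have hq1 : ContDiff ℝ 1 q := hq2.of_le one_le_two
  have hqc : HasCompactSupport q := hasCompactSupport_gradDot hc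
  obtain ⟨K1, hK1, b1⟩ := exists_bound_of_hasCompactSupport (continuous_lap hζ2)
    (hasCompactSupport_lap hc)
  obtain ⟨K2, hK2, b2⟩ := exists_bound_of_hasCompactSupport hq2.continuous hqc
  obtain ⟨K3, hK3, b3⟩ := exists_bound_of_hasCompactSupport (continuous_lap hq2)
    (hasCompactSupport_lap hqc)
  obtain ⟨K4, hK4, b4⟩ := exists_bound_of_hasCompactSupport
    (continuous_gradDot (hζn 1) hq1) (hasCompactSupport_gradDot hc)
  have hpow : ∀ x (i j : ℕ), i ≤ j → ζ x ^ j ≤ ζ x ^ i := fun x i j hij =>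
    pow_le_pow_of_le_one (h0 x) (h1 x) hij
  have eQ : gradDot (fun y => ζ y ^ (k + 2)) (fun y => ζ y ^ (k + 2)) =
      fun x => (k + 2 : ℝ) ^ 2 * (ζ x ^ (2 * k + 2) * q x) := by
    ext x
    rw [gradDot_pow_self (hζd x) (k + 1)]
    push_cast
    rw [show 2 * (k + 1) = 2 * k + 2 by ring]
    ring
  set A : ℝ := (k + 2) * K1 + (k + 2) * (k + 1) * K2 with hA
  set B : ℝ := (k + 2) ^ 2 * K2 with hB
  set C : ℝ := (k + 2) ^ 2 * (K3 + 2 * ((2 * k + 2) * K4) + K2 * ((2 * k + 2) * K1 + (2 * k + 2) * (2 * k + 1) * K2)) with hC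
  have hA0 : 0 ≤ A := by positivity
  have hB0 : 0 ≤ B := by positivity
  have hC0 : 0 ≤ C := by positivity
  refine ⟨ζ, A + B + C, by positivity, hζ, h0, h1, hone, hsupp, hc, fun x => ?_, fun x => ?_,
    fun x => ?_⟩
  · have hz : 0 ≤ ζ x ^ k := pow_nonneg (h0 x) _
    rw [lap_pow hζ2]
    have hz1 : 0 ≤ ζ x ^ (k + 1) := pow_nonneg (h0 x) _
    have t1 : |(k + 2) * ζ x ^ (k + 1) * lap ζ x| ≤ (k + 2) * ζ x ^ k * K1 := by
      rw [abs_mul, abs_of_nonneg (by positivity)]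
      exact mul_le_mul (mul_le_mul_of_nonneg_left (hpow x _ _ (Nat.le_succ k)) (by positivity))
        (b1 x) (abs_nonneg _) (by positivity)
    have t2 : |(k + 2) * (k + 1) * ζ x ^ k * q x| ≤ (k + 2) * (k + 1) * ζ x ^ k * K2 := by
      rw [abs_mul, abs_of_nonneg (by positivity)]
      exact mul_le_mul_of_nonneg_left (b2 x) (by positivity)
    calc _ ≤ (k + 2) * ζ x ^ k * K1 + (k + 2) * (k + 1) * ζ x ^ k * K2 :=
          (abs_add_le _ _).trans (add_le_add t1 t2)
      _ = A * ζ x ^ k := by rw [hA]; ring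
      _ ≤ _ := by gcongr; linarith
  · have hz : 0 ≤ ζ x ^ (2 * k + 2) := pow_nonneg (h0 x) _
    rw [eQ]
    calc (k + 2 : ℝ) ^ 2 * (ζ x ^ (2 * k + 2) * q x)
        ≤ (k + 2 : ℝ) ^ 2 * (ζ x ^ (2 * k + 2) * K2) := by
          gcongr; exact (le_abs_self _).trans (b2 x)
      _ = B * ζ x ^ (2 * k + 2) := by rw [hB]; ring
      _ ≤ _ := by gcongr; linarith
  · have hz : 0 ≤ ζ x ^ (2 * k) := pow_nonneg (h0 x) _
    have hz1 : 0 ≤ ζ x ^ (2 * k + 1) := pow_nonneg (h0 x) _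
    have hz2 : 0 ≤ ζ x ^ (2 * k + 2) := pow_nonneg (h0 x) _
    rw [eQ, lap_const_mul _ ((hζ2.pow _).mul hq2), lap_mul (hζ2.pow _) hq2, lap_pow hζ2,
      gradDot_pow_left (hζd x)]
    push_cast
    have t1 : |ζ x ^ (2 * k + 2) * lap q x| ≤ ζ x ^ (2 * k) * K3 := by
      rw [abs_mul, abs_of_nonneg hz2]
      exact mul_le_mul (hpow x _ _ (by lia)) (b3 x) (abs_nonneg _) hz
    have t2 : |(2 * k + 1 + 1) * ζ x ^ (2 * k + 1) * gradDot ζ q x| ≤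
        (2 * k + 2) * ζ x ^ (2 * k) * K4 := by
      rw [abs_mul, abs_of_nonneg (by positivity)]
      refine mul_le_mul ?_ (b4 x) (abs_nonneg _) (by positivity)
      rw [show (2 * k + 1 + 1 : ℝ) = 2 * k + 2 by ring]
      exact mul_le_mul_of_nonneg_left (hpow x _ _ (Nat.le_succ _)) (by positivity)
    have t3 : |(2 * k + 2) * ζ x ^ (2 * k + 1) * lap ζ x| ≤ (2 * k + 2) * ζ x ^ (2 * k) * K1 := by
      rw [abs_mul, abs_of_nonneg (by positivity)]
      refine mul_le_mul ?_ (b1 x) (abs_nonneg _) (by positivity)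
      exact mul_le_mul_of_nonneg_left (hpow x _ _ (Nat.le_succ _)) (by positivity)
    have t4 : |(2 * k + 2) * (2 * k + 1) * ζ x ^ (2 * k) * q x| ≤
        (2 * k + 2) * (2 * k + 1) * ζ x ^ (2 * k) * K2 := by
      rw [abs_mul, abs_of_nonneg (by positivity)]
      gcongr
      exact b2 x
    have t5 : |q x * ((2 * k + 2) * ζ x ^ (2 * k + 1) * lap ζ x +
        (2 * k + 2) * (2 * k + 1) * ζ x ^ (2 * k) * q x)| ≤
        K2 * ((2 * k + 2) * ζ x ^ (2 * k) * K1 + (2 * k + 2) * (2 * k + 1) * ζ x ^ (2 * k) * K2) := by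
      rw [abs_mul]
      exact mul_le_mul (b2 x) ((abs_add_le _ _).trans (add_le_add t3 t4)) (abs_nonneg _) hK2
    rw [abs_mul, abs_of_nonneg (by positivity : (0 : ℝ) ≤ (k + 2) ^ 2)]
    calc _ ≤ (k + 2 : ℝ) ^ 2 * (ζ x ^ (2 * k) * K3 + 2 * ((2 * k + 2) * ζ x ^ (2 * k) * K4) +
          K2 * ((2 * k + 2) * ζ x ^ (2 * k) * K1 +
            (2 * k + 2) * (2 * k + 1) * ζ x ^ (2 * k) * K2)) := by
          refine mul_le_mul_of_nonneg_left ?_ (by positivity)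
          refine (abs_add_le _ _).trans (add_le_add ((abs_add_le _ _).trans (add_le_add t1 ?_)) t5)
          rw [abs_mul, abs_of_pos (two_pos : (0 : ℝ) < 2)]
          gcongr
      _ = C * ζ x ^ (2 * k) := by rw [hC]; ring
      _ ≤ _ := by gcongr; linarith

end Cutoff

section Energy

variable {N : ℕ} {p : ℝ} {u η : EuclideanSpace ℝ (Fin N) → ℝ}

theorem integrable_of_eq_zero_off {f η : EuclideanSpace ℝ (Fin N) → ℝ} (hf : Continuous f)
    (hc : HasCompactSupport η) (h : ∀ x, x ∉ tsupport η → f x = 0) : Integrable f :=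
  hf.integrable_of_hasCompactSupport (HasCompactSupport.intro hc h)

theorem lap_gradDot_eq_zero_of_notMem_tsupport {f : EuclideanSpace ℝ (Fin N) → ℝ}
    {x : EuclideanSpace ℝ (Fin N)} (hx : x ∉ tsupport f) : lap (gradDot f f) x = 0 := by
  have : tsupport (gradDot f f) ⊆ tsupport f := closure_minimal (fun _ hy => by_contra fun h =>
    hy (gradDot_eq_zero_of_notMem_tsupport h)) (isClosed_tsupport f)
  exact lap_eq_zero_of_notMem_tsupport fun h => hx (this h)

theorem integral_combination_three {f₁ f₂ f₃ : EuclideanSpace ℝ (Fin N) → ℝ} (h₁ : Integrable f₁)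
    (h₂ : Integrable f₂) (h₃ : Integrable f₃) (a b : ℝ) :
    ∫ x, (a * f₁ x + f₂ x + b * f₃ x) = a * (∫ x, f₁ x) + (∫ x, f₂ x) + b * ∫ x, f₃ x := by
  rw [integral_add (f := fun x => a * f₁ x + f₂ x) ((h₁.const_mul a).add h₂) (h₃.const_mul b),
    integral_add (h₁.const_mul a) h₂, integral_const_mul, integral_const_mul]

namespace IsStableSolution

/-- Green's identity for the equation tested against `u η²`. -/
theorem integral_green (hu : IsStableSolution p u) {ψ : EuclideanSpace ℝ (Fin N) → ℝ}
    (hψ : ContDiff ℝ 2 ψ) (hc : HasCompactSupport ψ) :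
    ∫ x, (ψ x * u x ^ p - lap u x * lap ψ x) = 0 := by
  have hψ1 : ContDiff ℝ 1 ψ := hψ.of_le one_le_two
  have hl1 : ContDiff ℝ 1 (lap u) := hu.contDiff_lap.of_le one_le_two
  have h1 := integral_mul_lap_add_gradDot hψ1 hu.contDiff_lap hc
  have h2 := integral_mul_lap_add_gradDot_right hl1 hψ hc
  have i1 : Integrable fun x => ψ x * lap (lap u) x + gradDot ψ (lap u) x :=
    integrable_of_eq_zero_off ((hψ.continuous.mul (continuous_lap hu.contDiff_lap)).add
      (continuous_gradDot hψ1 hl1)) hc fun x hx => by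
        simp [image_eq_zero_of_notMem_tsupport hx, gradDot_eq_zero_of_notMem_tsupport hx]
  have i2 : Integrable fun x => lap u x * lap ψ x + gradDot (lap u) ψ x :=
    integrable_of_eq_zero_off ((hl1.continuous.mul (continuous_lap hψ)).add
      (continuous_gradDot hl1 hψ1)) hc fun x hx => by
        rw [gradDot_comm]
        simp [lap_eq_zero_of_notMem_tsupport hx, gradDot_eq_zero_of_notMem_tsupport hx]
  have h3 := integral_sub i1 i2
  rw [h1, h2, sub_zero] at h3
  rw [← h3]
  congr 1
  ext x
  rw [hu.lap_lap, gradDot_comm (lap u)]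
  ring

theorem lap_mul_cutoff (hu : IsStableSolution p u) (hη : ContDiff ℝ 2 η)
    (x : EuclideanSpace ℝ (Fin N)) :
    lap (fun y => u y * η y) x = u x * lap η x + 2 * gradDot u η x + η x * lap u x :=
  lap_mul hu.contDiff_two hη

theorem lap_mul_cutoff_sq (hu : IsStableSolution p u) (hη : ContDiff ℝ 2 η)
    (x : EuclideanSpace ℝ (Fin N)) :
    lap (fun y => u y * η y ^ 2) x = u x * (2 * η x * lap η x + 2 * gradDot η η x) +
      4 * η x * gradDot u η x + η x ^ 2 * lap u x := by
  rw [lap_mul hu.contDiff_two (hη.pow 2)]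
  have h := lap_pow (x := x) hη 0
  have h' := gradDot_pow_left (g := u) (hη.differentiable two_ne_zero x) 1
  norm_num at h h'
  rw [h, gradDot_comm u, h', gradDot_comm u η]
  ring

theorem integral_grad_identity (hu : IsStableSolution p u)
    {Q : EuclideanSpace ℝ (Fin N) → ℝ} (hQ : ContDiff ℝ 2 Q) (hc : HasCompactSupport Q) :
    ∫ x, (u x ^ 2 * lap Q x - 2 * (u x * lap u x * Q x) - 2 * (Q x * gradDot u u x)) = 0 := by
  have hQ1 : ContDiff ℝ 1 Q := hQ.of_le one_le_two
  have hu1 : ContDiff ℝ 1 u := hu.contDiff_two.of_le one_le_two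
  have hm : HasCompactSupport fun x => u x * Q x := hc.mul_left
  have h1 := integral_mul_lap_add_gradDot (hu1.mul hQ1) hu.contDiff_two hm
  have h2 := integral_mul_lap_add_gradDot_right (hu1.pow 2) hQ hc
  have i1 : Integrable fun x => u x * Q x * lap u x + gradDot (fun x => u x * Q x) u x :=
    integrable_of_eq_zero_off (((hu1.mul hQ1).continuous.mul (continuous_lap hu.contDiff_two)).add
      (continuous_gradDot (hu1.mul hQ1) hu1)) hm fun x hx => by
        have := image_eq_zero_of_notMem_tsupport hx
        rw [this, gradDot_eq_zero_of_notMem_tsupport hx]; ring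
  have i2 : Integrable fun x => u x ^ 2 * lap Q x + gradDot (fun x => u x ^ 2) Q x :=
    integrable_of_eq_zero_off (((hu1.pow 2).continuous.mul (continuous_lap hQ)).add
      (continuous_gradDot (hu1.pow 2) hQ1)) hc fun x hx => by
        rw [gradDot_comm]
        simp [lap_eq_zero_of_notMem_tsupport hx, gradDot_eq_zero_of_notMem_tsupport hx]
  have h3 := integral_sub i2 (i1.const_mul 2)
  rw [integral_const_mul, h1, h2, mul_zero, sub_zero] at h3
  rw [← h3]
  congr 1
  ext x
  have h' := gradDot_pow_left (g := Q) (hu1.differentiable one_ne_zero x) 1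
  norm_num at h'
  rw [h', gradDot_mul_left (hu1.differentiable one_ne_zero x) (hQ1.differentiable one_ne_zero x),
    gradDot_comm Q u]
  ring

variable (hu : IsStableSolution p u) (hη : ContDiff ℝ 4 η) (hc : HasCompactSupport η)
include hu hη hc

theorem energy_one :
    (p - 1) * ∫ x, u x ^ (p + 1) * η x ^ 2 ≤
      ∫ x, (3 * (u x ^ 2 * lap η x ^ 2) + 3 * (u x ^ 2 * lap (gradDot η η) x) -
        8 * (u x * lap u x * gradDot η η x)) := by
  have hη2 : ContDiff ℝ 2 η := hη.of_le (by norm_num)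
  have hη1 : ContDiff ℝ 1 η := hη.of_le (by norm_num)
  have hu2 := hu.contDiff_two
  have hu1 : ContDiff ℝ 1 u := hu2.of_le one_le_two
  have hQ : ContDiff ℝ 2 (gradDot η η) := contDiff_gradDot hη hη (by norm_num [two_add_one_eq_three])
  have cη := hη.continuous
  have cu := hu2.continuous
  have cΛ := continuous_lap hu2
  have cL := continuous_lap hη2
  have cQ := hQ.continuous
  have clQ := continuous_lap hQ
  have cG := continuous_gradDot hu1 hu1
  have cp := hu.continuous_rpow p
  have cp1 := hu.continuous_rpow (p + 1)
  have cp2 := hu.continuous_rpow (p - 1)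
  have c1 : Continuous (lap fun x => u x * η x) := continuous_lap (hu2.mul hη2)
  have c2 : Continuous (lap fun x => u x * η x ^ 2) := continuous_lap (hu2.mul (hη2.pow 2))
  have z0 : ∀ x, x ∉ tsupport η → η x = 0 := fun x hx => image_eq_zero_of_notMem_tsupport hx
  have zL : ∀ x, x ∉ tsupport η → lap η x = 0 := fun x hx => lap_eq_zero_of_notMem_tsupport hx
  have zQ : ∀ x, x ∉ tsupport η → gradDot η η x = 0 := fun x hx =>
    gradDot_eq_zero_of_notMem_tsupport hx
  have zlQ : ∀ x, x ∉ tsupport η → lap (gradDot η η) x = 0 := fun x hx =>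
    lap_gradDot_eq_zero_of_notMem_tsupport hx
  have zg : ∀ x, x ∉ tsupport η → gradDot u η x = 0 := fun x hx => by
    rw [gradDot_comm, gradDot_eq_zero_of_notMem_tsupport hx]
  have hst := hu.stable_of_contDiff_two (hu2.mul hη2) hc.mul_left
  have hgr := hu.integral_green (hu2.mul (hη2.pow 2))
    ((hc.comp_left (g := fun t => t ^ 2) (by simp)).mul_left)
  have hid := hu.integral_grad_identity hQ (hasCompactSupport_gradDot hc)
  have i1 : Integrable fun x => p * u x ^ (p - 1) * (u x * η x) ^ 2 :=
    integrable_of_eq_zero_off (by fun_prop) hc fun x hx => by simp [z0 x hx]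
  have i2 : Integrable fun x => lap (fun x => u x * η x) x ^ 2 :=
    integrable_of_eq_zero_off (by fun_prop) hc fun x hx => by
      simp [hu.lap_mul_cutoff hη2, z0 x hx, zL x hx, zg x hx]
  have i3 : Integrable fun x => u x * η x ^ 2 * u x ^ p - lap u x * lap (fun x => u x * η x ^ 2) x :=
    integrable_of_eq_zero_off (by fun_prop) hc fun x hx => by
      simp [hu.lap_mul_cutoff_sq hη2, z0 x hx, zQ x hx]
  have i4 : Integrable fun x => u x ^ 2 * lap (gradDot η η) x -
      2 * (u x * lap u x * gradDot η η x) - 2 * (gradDot η η x * gradDot u u x) :=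
    integrable_of_eq_zero_off (by fun_prop) hc fun x hx => by simp [zQ x hx, zlQ x hx]
  have i5 : Integrable fun x => u x ^ (p + 1) * η x ^ 2 :=
    integrable_of_eq_zero_off (by fun_prop) hc fun x hx => by simp [z0 x hx]
  have i6 : Integrable fun x => 3 * (u x ^ 2 * lap η x ^ 2) +
      3 * (u x ^ 2 * lap (gradDot η η) x) - 8 * (u x * lap u x * gradDot η η x) :=
    integrable_of_eq_zero_off (by fun_prop) hc fun x hx => by simp [zL x hx, zlQ x hx, zQ x hx]
  have key : ∫ x, (1 * (lap (fun x => u x * η x) x ^ 2 - p * u x ^ (p - 1) * (u x * η x) ^ 2) +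
      (u x * η x ^ 2 * u x ^ p - lap u x * lap (fun x => u x * η x ^ 2) x) +
      3 * (u x ^ 2 * lap (gradDot η η) x - 2 * (u x * lap u x * gradDot η η x) -
        2 * (gradDot η η x * gradDot u u x)) + (p - 1) * (u x ^ (p + 1) * η x ^ 2)) ≤
      ∫ x, (3 * (u x ^ 2 * lap η x ^ 2) + 3 * (u x ^ 2 * lap (gradDot η η) x) -
        8 * (u x * lap u x * gradDot η η x)) := by
    refine integral_mono (((((i2.sub i1).const_mul 1).add i3).add (i4.const_mul 3)).add (i5.const_mul (p - 1))) i6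
      fun x => ?_
    have hux := hu.pos x
    have e1 : u x ^ p * u x = u x ^ (p + 1) := by rw [rpow_add_one hux.ne']
    have e2 : u x ^ (p - 1) * u x ^ 2 = u x ^ (p + 1) := by
      rw [← rpow_natCast (u x) 2, ← rpow_add hux]; congr 1; push_cast; ring
    have e3 : p * u x ^ (p - 1) * (u x * η x) ^ 2 = p * (u x ^ (p + 1) * η x ^ 2) := by
      rw [← e2]; ring
    have e4 : u x * η x ^ 2 * u x ^ p = u x ^ (p + 1) * η x ^ 2 := by rw [← e1]; ring
    have hcs := sq_gradDot_le u η x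
    simp only []
    rw [e3, e4, hu.lap_mul_cutoff hη2, hu.lap_mul_cutoff_sq hη2]
    nlinarith [sq_nonneg (u x * lap η x - gradDot u η x)]
  have i7 : Integrable fun x => lap (fun x => u x * η x) x ^ 2 -
      p * u x ^ (p - 1) * (u x * η x) ^ 2 := i2.sub i1
  have i8 : Integrable fun x => 1 * (lap (fun x => u x * η x) x ^ 2 -
      p * u x ^ (p - 1) * (u x * η x) ^ 2) + (u x * η x ^ 2 * u x ^ p -
      lap u x * lap (fun x => u x * η x ^ 2) x) + 3 * (u x ^ 2 * lap (gradDot η η) x -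
      2 * (u x * lap u x * gradDot η η x) - 2 * (gradDot η η x * gradDot u u x)) :=
    ((i7.const_mul 1).add i3).add (i4.const_mul 3)
  rw [integral_add i8 (i5.const_mul (p - 1)), integral_combination_three i7 i3 i4,
    integral_sub i2 i1, integral_const_mul, hgr, hid] at key
  linarith

theorem energy_two :
    1 / 2 * ∫ x, lap u x ^ 2 * η x ^ 2 ≤ (∫ x, u x ^ (p + 1) * η x ^ 2) +
      ∫ x, (4 * (u x ^ 2 * lap η x ^ 2) + 8 * (u x ^ 2 * lap (gradDot η η) x) -
        18 * (u x * lap u x * gradDot η η x)) := by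
  have hη2 : ContDiff ℝ 2 η := hη.of_le (by norm_num)
  have hη1 : ContDiff ℝ 1 η := hη.of_le (by norm_num)
  have hu2 := hu.contDiff_two
  have hu1 : ContDiff ℝ 1 u := hu2.of_le one_le_two
  have hQ : ContDiff ℝ 2 (gradDot η η) := contDiff_gradDot hη hη (by norm_num [two_add_one_eq_three])
  have cη := hη.continuous
  have cu := hu2.continuous
  have cΛ := continuous_lap hu2
  have cL := continuous_lap hη2
  have cQ := hQ.continuous
  have clQ := continuous_lap hQ
  have cG := continuous_gradDot hu1 hu1
  have cp := hu.continuous_rpow p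
  have cp1 := hu.continuous_rpow (p + 1)
  have c2 : Continuous (lap fun x => u x * η x ^ 2) := continuous_lap (hu2.mul (hη2.pow 2))
  have z0 : ∀ x, x ∉ tsupport η → η x = 0 := fun x hx => image_eq_zero_of_notMem_tsupport hx
  have zL : ∀ x, x ∉ tsupport η → lap η x = 0 := fun x hx => lap_eq_zero_of_notMem_tsupport hx
  have zQ : ∀ x, x ∉ tsupport η → gradDot η η x = 0 := fun x hx =>
    gradDot_eq_zero_of_notMem_tsupport hx
  have zlQ : ∀ x, x ∉ tsupport η → lap (gradDot η η) x = 0 := fun x hx =>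
    lap_gradDot_eq_zero_of_notMem_tsupport hx
  have hgr := hu.integral_green (hu2.mul (hη2.pow 2))
    ((hc.comp_left (g := fun t => t ^ 2) (by simp)).mul_left)
  have hid := hu.integral_grad_identity hQ (hasCompactSupport_gradDot hc)
  have i2 : Integrable fun x => lap u x ^ 2 * η x ^ 2 :=
    integrable_of_eq_zero_off (by fun_prop) hc fun x hx => by simp [z0 x hx]
  have i3 : Integrable fun x => u x * η x ^ 2 * u x ^ p - lap u x * lap (fun x => u x * η x ^ 2) x :=
    integrable_of_eq_zero_off (by fun_prop) hc fun x hx => by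
      simp [hu.lap_mul_cutoff_sq hη2, z0 x hx, zQ x hx]
  have i4 : Integrable fun x => u x ^ 2 * lap (gradDot η η) x -
      2 * (u x * lap u x * gradDot η η x) - 2 * (gradDot η η x * gradDot u u x) :=
    integrable_of_eq_zero_off (by fun_prop) hc fun x hx => by simp [zQ x hx, zlQ x hx]
  have i5 : Integrable fun x => u x ^ (p + 1) * η x ^ 2 :=
    integrable_of_eq_zero_off (by fun_prop) hc fun x hx => by simp [z0 x hx]
  have i6 : Integrable fun x => 4 * (u x ^ 2 * lap η x ^ 2) +
      8 * (u x ^ 2 * lap (gradDot η η) x) - 18 * (u x * lap u x * gradDot η η x) :=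
    integrable_of_eq_zero_off (by fun_prop) hc fun x hx => by simp [zL x hx, zlQ x hx, zQ x hx]
  have key : ∫ x, (1 / 2 * (lap u x ^ 2 * η x ^ 2) +
      (u x * η x ^ 2 * u x ^ p - lap u x * lap (fun x => u x * η x ^ 2) x) +
      8 * (u x ^ 2 * lap (gradDot η η) x - 2 * (u x * lap u x * gradDot η η x) -
        2 * (gradDot η η x * gradDot u u x))) ≤
      ∫ x, (u x ^ (p + 1) * η x ^ 2 + (4 * (u x ^ 2 * lap η x ^ 2) +
        8 * (u x ^ 2 * lap (gradDot η η) x) - 18 * (u x * lap u x * gradDot η η x))) := by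
    refine integral_mono (((i2.const_mul (1 / 2)).add i3).add (i4.const_mul 8)) (i5.add i6)
      fun x => ?_
    have hux := hu.pos x
    have e1 : u x ^ p * u x = u x ^ (p + 1) := by rw [rpow_add_one hux.ne']
    have e4 : u x * η x ^ 2 * u x ^ p = u x ^ (p + 1) * η x ^ 2 := by rw [← e1]; ring
    have hcs := sq_gradDot_le u η x
    simp only []
    rw [e4, hu.lap_mul_cutoff_sq hη2]
    nlinarith [sq_nonneg (η x * lap u x + 4 * (u x * lap η x)),
      sq_nonneg (η x * lap u x + 8 * gradDot u η x)]
  rw [integral_combination_three i2 i3 i4, integral_add i5 i6, hgr, hid] at key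
  linarith

end IsStableSolution

end Energy

section EnergyBound

variable {N : ℕ} {p : ℝ}

theorem setIntegral_le_integral_of_eqOn {f g : EuclideanSpace ℝ (Fin N) → ℝ}
    {s : Set (EuclideanSpace ℝ (Fin N))} (hs : MeasurableSet s) (hg : Integrable g)
    (h0 : ∀ x, 0 ≤ g x) (h : ∀ x ∈ s, f x = g x) : ∫ x in s, f x ≤ ∫ x, g x :=
  (setIntegral_congr_fun hs h).trans_le (setIntegral_le_integral hg (.of_forall h0))

/-- A lower power of `u` is absorbed by a higher one, up to a constant. -/
theorem sq_mul_pow_le_absorb (hp : 1 < p) {k : ℕ} (hk : 4 ≤ k * (p - 1)) {δ t z : ℝ} (hδ : 0 < δ)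
    (ht : 0 < t) (hz : 0 ≤ z) (hz1 : z ≤ 1) :
    t ^ 2 * z ^ (2 * k) ≤ δ * (t ^ (p + 1) * (z ^ (k + 2)) ^ 2) + δ⁻¹ ^ (2 / (p - 1)) := by
  have hp' : 0 < p - 1 := by linarith
  have hA : 0 ≤ δ⁻¹ ^ (2 / (p - 1)) := by positivity
  have e1 : t ^ (p + 1) = t ^ 2 * t ^ (p - 1) := by
    rw [← rpow_natCast t 2, ← rpow_add ht]; congr 1; push_cast; ring
  rcases le_or_gt δ⁻¹ (t ^ (p - 1) * z ^ 4) with h | h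
  · have h' : 1 ≤ δ * (t ^ (p - 1) * z ^ 4) := by
      calc 1 = δ * δ⁻¹ := (mul_inv_cancel₀ hδ.ne').symm
        _ ≤ _ := by gcongr
    have h0 : 0 ≤ t ^ 2 * z ^ (2 * k) := by positivity
    calc t ^ 2 * z ^ (2 * k) ≤ t ^ 2 * z ^ (2 * k) * (δ * (t ^ (p - 1) * z ^ 4)) :=
          le_mul_of_one_le_right h0 h'
      _ = δ * (t ^ (p + 1) * (z ^ (k + 2)) ^ 2) := by rw [e1]; ring
      _ ≤ _ := by linarith
  · have h1 : t ^ 2 * z ^ (2 * k) = (t ^ (p - 1) * z ^ ((k : ℝ) * (p - 1))) ^ (2 / (p - 1)) := by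
      rw [mul_rpow (by positivity) (by positivity), ← rpow_mul ht.le, ← rpow_mul hz,
        mul_assoc, mul_div_cancel₀ _ hp'.ne', ← rpow_natCast t 2, ← rpow_natCast z (2 * k)]
      push_cast
      rw [mul_comm (k : ℝ)]
    have h2 : z ^ ((k : ℝ) * (p - 1)) ≤ z ^ 4 := by
      rcases hz.eq_or_lt with rfl | hz0
      · rw [zero_rpow (by linarith)]; norm_num
      · rw [← rpow_natCast z 4]
        exact rpow_le_rpow_of_exponent_ge hz0 hz1 (by push_cast; exact hk)
    have h3 : t ^ 2 * z ^ (2 * k) ≤ δ⁻¹ ^ (2 / (p - 1)) := by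
      rw [h1]
      refine rpow_le_rpow (by positivity) ?_ (by positivity)
      exact (mul_le_mul_of_nonneg_left h2 (by positivity)).trans h.le
    have : 0 ≤ δ * (t ^ (p + 1) * (z ^ (k + 2)) ^ 2) := by positivity
    linarith

set_option maxHeartbeats 2000000 in
theorem exists_energy_bound (N : ℕ) (hp : 1 < p) :
    ∃ C, ∀ u : EuclideanSpace ℝ (Fin N) → ℝ, IsStableSolution p u →
      ∫ x in Metric.closedBall 0 1, (lap u x ^ 2 + u x ^ (p + 1)) ≤ C := by
  have hp' : 0 < p - 1 := by linarith
  obtain ⟨k, hk⟩ := exists_nat_ge (4 / (p - 1))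
  rw [div_le_iff₀ hp'] at hk
  obtain ⟨ζ, K, hK, hζ, h0, h1, hone, hsupp, hc, b1, b2, b3⟩ := exists_cutoff_pow N k
  set η : EuclideanSpace ℝ (Fin N) → ℝ := fun y => ζ y ^ (k + 2) with hη
  have hζn : ∀ n : ℕ, ContDiff ℝ n ζ := contDiff_infty.1 hζ
  have hη4 : ContDiff ℝ 4 η := (hζn 4).pow _
  have hη2 : ContDiff ℝ 2 η := hη4.of_le (by norm_num)
  have hηc : HasCompactSupport η := hc.comp_left (g := fun t => t ^ (k + 2)) (by simp)
  have hQ : ContDiff ℝ 2 (gradDot η η) :=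
    contDiff_gradDot hη4 hη4 (by norm_num [two_add_one_eq_three])
  have cη := hη4.continuous
  have cζ := (hζn 1).continuous
  have cL := continuous_lap hη2
  have cQ := hQ.continuous
  have clQ := continuous_lap hQ
  have z0 : ∀ x, x ∉ tsupport η → η x = 0 := fun x hx => image_eq_zero_of_notMem_tsupport hx
  have zL : ∀ x, x ∉ tsupport η → lap η x = 0 := fun x hx => lap_eq_zero_of_notMem_tsupport hx
  have zQ : ∀ x, x ∉ tsupport η → gradDot η η x = 0 := fun x hx =>
    gradDot_eq_zero_of_notMem_tsupport hx
  have zlQ : ∀ x, x ∉ tsupport η → lap (gradDot η η) x = 0 := fun x hx =>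
    lap_gradDot_eq_zero_of_notMem_tsupport hx
  have zζ : ∀ x, x ∉ tsupport ζ → ζ x = 0 := fun x hx => image_eq_zero_of_notMem_tsupport hx
  have hk0 : 2 * k ≠ 0 := by
    rintro h
    have : k = 0 := by lia
    rw [this] at hk; norm_num at hk
  set ε : ℝ := 1 / (4 * (8 / (p - 1) + 18)) with hε
  have hε0 : 0 < ε := by positivity
  set A1 : ℝ := 3 * K ^ 2 + 3 * K + 8 * (K ^ 2 / (4 * ε)) with hA1
  set A2 : ℝ := 4 * K ^ 2 + 8 * K + 18 * (K ^ 2 / (4 * ε)) with hA2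
  set A3 : ℝ := A1 / (p - 1) + A2 with hA3
  set C0 : ℝ := 4 * A3 + (A1 + 8 * ε * (4 * A3)) / (p - 1) + 1 with hC0
  have hA10 : 0 ≤ A1 := by positivity
  have hA20 : 0 ≤ A2 := by positivity
  have hA30 : 0 ≤ A3 := by positivity
  have hC00 : 0 < C0 := by positivity
  set δ : ℝ := 1 / (2 * C0) with hδ
  have hδ0 : 0 < δ := by positivity
  set M : ℝ := δ⁻¹ ^ (2 / (p - 1)) with hM
  have hM0 : 0 ≤ M := by positivity
  set vol : ℝ := ∫ _ in Metric.closedBall (0 : EuclideanSpace ℝ (Fin N)) 2, M with hvol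
  refine ⟨2 * C0 * vol, fun u hu => ?_⟩
  have cu := hu.contDiff_two.continuous
  have cΛ := continuous_lap hu.contDiff_two
  have cp := hu.continuous_rpow (p + 1)
  have iZ : Integrable fun x => lap u x ^ 2 * η x ^ 2 :=
    integrable_of_eq_zero_off (by fun_prop) hηc fun x hx => by simp [z0 x hx]
  have iX : Integrable fun x => u x ^ (p + 1) * η x ^ 2 :=
    integrable_of_eq_zero_off (by fun_prop) hηc fun x hx => by simp [z0 x hx]
  have iY : Integrable fun x => u x ^ 2 * ζ x ^ (2 * k) :=
    integrable_of_eq_zero_off (by fun_prop) hc fun x hx => by rw [zζ x hx, zero_pow hk0, mul_zero]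
  have bL : ∀ x, u x ^ 2 * lap η x ^ 2 ≤ K ^ 2 * (u x ^ 2 * ζ x ^ (2 * k)) := fun x => by
    have h := pow_le_pow_left₀ (abs_nonneg _) (b1 x) 2
    rw [sq_abs] at h
    calc _ ≤ u x ^ 2 * (K * ζ x ^ k) ^ 2 := by gcongr
      _ = _ := by ring
  have bQ : ∀ x, u x ^ 2 * lap (gradDot η η) x ≤ K * (u x ^ 2 * ζ x ^ (2 * k)) := fun x => by
    calc _ ≤ u x ^ 2 * (K * ζ x ^ (2 * k)) := by
          gcongr; exact (le_abs_self _).trans (b3 x)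
      _ = _ := by ring
  have bΛ : ∀ x, -(u x * lap u x * gradDot η η x) ≤
      ε * (lap u x ^ 2 * η x ^ 2) + K ^ 2 / (4 * ε) * (u x ^ 2 * ζ x ^ (2 * k)) := fun x => by
    have hu0 := (hu.pos x).le
    have hz : 0 ≤ ζ x ^ k := pow_nonneg (h0 x) _
    have hz2 : 0 ≤ η x := pow_nonneg (h0 x) _
    have e1 : -(u x * lap u x * gradDot η η x) ≤ u x * |lap u x| * (K * ζ x ^ (2 * k + 2)) := by
      calc -(u x * lap u x * gradDot η η x) = u x * -lap u x * gradDot η η x := by ring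
        _ ≤ u x * |lap u x| * gradDot η η x := by
          have := gradDot_self_nonneg η x
          gcongr; exact neg_le_abs _
        _ ≤ _ := by gcongr; exact b2 x
    have e2 : ζ x ^ (2 * k + 2) = η x * ζ x ^ k := by rw [hη]; ring
    have e3 : ζ x ^ (2 * k) = (ζ x ^ k) ^ 2 := by ring
    rw [e2] at e1
    rw [e3, ← sq_abs (lap u x)]
    set a := |lap u x| * η x
    set b := u x * ζ x ^ k
    have e4 : K * (a * b) ≤ ε * a ^ 2 + K ^ 2 / (4 * ε) * b ^ 2 := by
      have : ε * a ^ 2 + K ^ 2 / (4 * ε) * b ^ 2 - K * (a * b) = ε * (a - K / (2 * ε) * b) ^ 2 := by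
        field_simp; ring
      have h := mul_nonneg hε0.le (sq_nonneg (a - K / (2 * ε) * b))
      linarith
    calc _ ≤ _ := e1
      _ = K * (a * b) := by simp only [a, b]; ring
      _ ≤ _ := e4
      _ = _ := by simp only [a, b]; ring
  have E1 := hu.energy_one hη4 hηc
  have E2 := hu.energy_two hη4 hηc
  have F1 : ∫ x, (3 * (u x ^ 2 * lap η x ^ 2) + 3 * (u x ^ 2 * lap (gradDot η η) x) -
        8 * (u x * lap u x * gradDot η η x)) ≤
      ∫ x, (A1 * (u x ^ 2 * ζ x ^ (2 * k)) + 8 * ε * (lap u x ^ 2 * η x ^ 2)) := by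
    refine integral_mono ?_ ((iY.const_mul _).add (iZ.const_mul _)) fun x => ?_
    · exact integrable_of_eq_zero_off (by fun_prop) hηc fun x hx => by
        simp [zL x hx, zlQ x hx, zQ x hx]
    · have := bL x; have := bQ x; have := bΛ x
      simp only [hA1]
      linarith
  have F2 : ∫ x, (4 * (u x ^ 2 * lap η x ^ 2) + 8 * (u x ^ 2 * lap (gradDot η η) x) -
        18 * (u x * lap u x * gradDot η η x)) ≤
      ∫ x, (A2 * (u x ^ 2 * ζ x ^ (2 * k)) + 18 * ε * (lap u x ^ 2 * η x ^ 2)) := by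
    refine integral_mono ?_ ((iY.const_mul _).add (iZ.const_mul _)) fun x => ?_
    · exact integrable_of_eq_zero_off (by fun_prop) hηc fun x hx => by
        simp [zL x hx, zlQ x hx, zQ x hx]
    · have := bL x; have := bQ x; have := bΛ x
      simp only [hA2]
      linarith
  rw [integral_add (iY.const_mul _) (iZ.const_mul _), integral_const_mul, integral_const_mul] at F1 F2
  have F3 : ∫ x, u x ^ 2 * ζ x ^ (2 * k) ≤ δ * (∫ x, u x ^ (p + 1) * η x ^ 2) + vol := by
    rw [hvol, ← integral_indicator Metric.isClosed_closedBall.measurableSet, ← integral_const_mul,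
      ← integral_add (iX.const_mul δ)]
    · refine integral_mono iY ((iX.const_mul δ).add ?_) fun x => ?_
      · rw [integrable_indicator_iff Metric.isClosed_closedBall.measurableSet]
        exact integrableOn_const (isCompact_closedBall _ _).measure_lt_top.ne
      · simp only []
        by_cases hx : x ∈ Metric.closedBall (0 : EuclideanSpace ℝ (Fin N)) 2
        · rw [Set.indicator_of_mem hx]
          exact sq_mul_pow_le_absorb hp hk hδ0 (hu.pos x) (h0 x) (h1 x)
        · rw [Set.indicator_of_notMem hx, zζ x fun h => hx (hsupp h), zero_pow hk0, mul_zero]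
          have := rpow_nonneg (hu.pos x).le (p + 1)
          positivity
    · rw [integrable_indicator_iff Metric.isClosed_closedBall.measurableSet]
      exact integrableOn_const (isCompact_closedBall _ _).measure_lt_top.ne
  have G1 : ∫ x in Metric.closedBall 0 1, (lap u x ^ 2 + u x ^ (p + 1)) ≤
      ∫ x, (lap u x ^ 2 * η x ^ 2 + u x ^ (p + 1) * η x ^ 2) := by
    refine setIntegral_le_integral_of_eqOn Metric.isClosed_closedBall.measurableSet (iZ.add iX)
      (fun x => ?_) fun x hx => ?_
    · have := rpow_nonneg (hu.pos x).le (p + 1)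
      positivity
    · simp [hη, hone x (by simpa using hx)]
  refine G1.trans ?_
  rw [integral_add iZ iX]
  have hX0 : 0 ≤ ∫ x, u x ^ (p + 1) * η x ^ 2 := integral_nonneg fun x => by
    have := rpow_nonneg (hu.pos x).le (p + 1)
    positivity
  have hY0 : 0 ≤ ∫ x, u x ^ 2 * ζ x ^ (2 * k) := integral_nonneg fun x => by
    have := h0 x
    positivity
  have hZ0 : 0 ≤ ∫ x, lap u x ^ 2 * η x ^ 2 := integral_nonneg fun x => by positivity
  set X := ∫ x, u x ^ (p + 1) * η x ^ 2
  set Y := ∫ x, u x ^ 2 * ζ x ^ (2 * k)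
  set Z := ∫ x, lap u x ^ 2 * η x ^ 2
  have s1 : (p - 1) * X ≤ A1 * Y + 8 * ε * Z := E1.trans F1
  have s2 : 1 / 2 * Z ≤ X + (A2 * Y + 18 * ε * Z) := E2.trans (by linarith)
  have s1' : X ≤ (A1 * Y + 8 * ε * Z) / (p - 1) := by rw [le_div_iff₀ hp']; linarith
  have s3 : (8 / (p - 1) + 18) * ε = 1 / 4 := by rw [hε]; field_simp
  have s4 : Z ≤ 4 * A3 * Y := by
    have e : (A1 * Y + 8 * ε * Z) / (p - 1) + (A2 * Y + 18 * ε * Z) =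
        A3 * Y + (8 / (p - 1) + 18) * ε * Z := by rw [hA3]; ring
    rw [s3] at e
    linarith
  have s5 : X ≤ (A1 + 8 * ε * (4 * A3)) / (p - 1) * Y := by
    refine s1'.trans ?_
    rw [div_mul_eq_mul_div]
    gcongr
    nlinarith
  have s6 : Z + X ≤ C0 * Y := by rw [hC0]; nlinarith
  have s7 : C0 * Y ≤ C0 * (δ * X + vol) := by gcongr
  have s8 : C0 * δ = 1 / 2 := by rw [hδ]; field_simp
  nlinarith
end EnergyBound

section PosPartPow

theorem hasDerivAt_max_zero_pow (n : ℕ) (t : ℝ) :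
    HasDerivAt (fun t : ℝ => max t 0 ^ (n + 2)) ((n + 2) * max t 0 ^ (n + 1)) t := by
  rcases lt_trichotomy t 0 with h | rfl | h
  · have e : (fun t : ℝ => max t 0 ^ (n + 2)) =ᶠ[nhds t] fun _ => 0 := by
      filter_upwards [gt_mem_nhds h] with s hs
      simp [max_eq_right hs.le]
    simpa [max_eq_right h.le] using (hasDerivAt_const t (0 : ℝ)).congr_of_eventuallyEq e
  · have h : (fun t : ℝ => max t 0 ^ (n + 2)) =O[nhds 0] fun t : ℝ => ‖t - 0‖ ^ (n + 2) := by
      refine Asymptotics.IsBigO.of_bound 1 (.of_forall fun t => ?_)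
      simp only [sub_zero, one_mul, norm_pow, norm_eq_abs, abs_abs]
      refine pow_le_pow_left₀ (abs_nonneg _) ?_ _
      rw [abs_of_nonneg (le_max_right _ _)]
      exact max_le (le_abs_self _) (abs_nonneg _)
    have h' := h.hasFDerivAt (𝕜 := ℝ) (by lia)
    simpa [HasDerivAt, HasDerivAtFilter] using h'.hasDerivAt
  · have e : (fun t : ℝ => max t 0 ^ (n + 2)) =ᶠ[nhds t] fun t => t ^ (n + 2) := by
      filter_upwards [lt_mem_nhds h] with s hs
      simp [max_eq_left hs.le]
    rw [max_eq_left h.le]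
    have := (hasDerivAt_pow (n + 2) t).congr_of_eventuallyEq e
    push_cast at this
    exact this

theorem contDiff_max_zero_pow (n : ℕ) : ContDiff ℝ n fun t : ℝ => max t 0 ^ (n + 1) := by
  induction n with
  | zero => exact contDiff_zero.2 (by fun_prop)
  | succ n ih =>
    have e : deriv (fun t : ℝ => max t 0 ^ (n + 1 + 1)) =
        fun t => ((n + 2 : ℕ) : ℝ) * max t 0 ^ (n + 1) :=
      funext fun t => by simpa using (hasDerivAt_max_zero_pow n t).deriv
    push_cast
    refine contDiff_succ_iff_deriv.2 ⟨fun t => (hasDerivAt_max_zero_pow n t).differentiableAt,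
      by simp, ?_⟩
    rw [e]
    exact contDiff_const.mul ih

end PosPartPow

section MeanValue

variable {N : ℕ}

theorem fderiv_apply_eq_sum_pd (f : EuclideanSpace ℝ (Fin N) → ℝ)
    (x v : EuclideanSpace ℝ (Fin N)) : fderiv ℝ f x v = ∑ i, v i * pd f i x := by
  have hv : v = ∑ i, v i • EuclideanSpace.single i (1 : ℝ) := by
    ext j
    simp [Finset.sum_apply, Pi.single_apply]
  conv_lhs => rw [hv]
  simp [pd]

theorem pd_norm_sq (i : Fin N) (x : EuclideanSpace ℝ (Fin N)) :
    pd (fun y => 1 - ‖y‖ ^ 2) i x = -(2 * x i) := by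
  have h := ((hasStrictFDerivAt_norm_sq x).hasFDerivAt.const_sub 1).fderiv
  rw [pd, h]
  simp [EuclideanSpace.inner_single_right]

/-- The weak form of the monotonicity of weighted averages of a subharmonic function. -/
theorem integral_radial_deriv_nonneg {G : EuclideanSpace ℝ (Fin N) → ℝ} (hG : ContDiff ℝ 2 G)
    (hlap : ∀ x, 0 ≤ lap G x) {t : ℝ} (ht : 0 < t) :
    0 ≤ ∫ x, max (1 - ‖x‖ ^ 2) 0 * fderiv ℝ G (t • x) x := by
  set H : EuclideanSpace ℝ (Fin N) → ℝ := fun x => max (1 - ‖x‖ ^ 2) 0 ^ 2 with hH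
  have hn : ContDiff ℝ 1 fun x : EuclideanSpace ℝ (Fin N) => 1 - ‖x‖ ^ 2 :=
    contDiff_const.sub (contDiff_norm_sq ℝ)
  have hH1 : ContDiff ℝ 1 H := (contDiff_max_zero_pow 1).comp hn
  have hz : ∀ x : EuclideanSpace ℝ (Fin N), x ∉ Metric.closedBall 0 1 →
      max (1 - ‖x‖ ^ 2) 0 = 0 := fun x hx => by
    have : 1 < ‖x‖ := by simpa using hx
    exact max_eq_right (by nlinarith)
  have hc : HasCompactSupport H := HasCompactSupport.intro
    (isCompact_closedBall (0 : EuclideanSpace ℝ (Fin N)) 1) fun x hx => by simp [hH, hz x hx]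
  set g : EuclideanSpace ℝ (Fin N) → ℝ := fun x => G (t • x + 0) with hg
  have hg2 : ContDiff ℝ 2 g := hG.comp ((contDiff_id.const_smul t).add contDiff_const)
  have h := integral_mul_lap_add_gradDot hH1 hg2 hc
  have e : ∀ x, H x * lap g x + gradDot H g x = t ^ 2 * (H x * lap G (t • x)) -
      4 * t * (max (1 - ‖x‖ ^ 2) 0 * fderiv ℝ G (t • x) x) := fun x => by
    rw [hg, lap_comp_smul_add t 0 hG, gradDot, fderiv_apply_eq_sum_pd, Finset.mul_sum,
      Finset.mul_sum, add_zero]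
    rw [sub_eq_add_neg, ← Finset.sum_neg_distrib]
    congr 1
    · ring
    · refine Finset.sum_congr rfl fun i _ => ?_
      have h2 := pd_comp (φ := fun t => max t 0 ^ (0 + 2)) (f := fun x => 1 - ‖x‖ ^ 2)
        (hasDerivAt_max_zero_pow 0 (1 - ‖x‖ ^ 2)) (hn.differentiable one_ne_zero x) i
      rw [pd_comp_smul_add t 0 (hG.differentiable two_ne_zero)]
      norm_num at h2
      rw [h2, pd_norm_sq, add_zero]
      ring
  have cG := continuous_lap hG
  have cF : Continuous fun x => fderiv ℝ G (t • x) x :=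
    ((hG.continuous_fderiv two_ne_zero).comp (continuous_id.const_smul t)).clm_apply continuous_id
  have i1 : Integrable fun x => H x * lap G (t • x) :=
    (hH1.continuous.mul (by fun_prop)).integrable_of_hasCompactSupport hc.mul_right
  have i2 : Integrable fun x => max (1 - ‖x‖ ^ 2) 0 * fderiv ℝ G (t • x) x := by
    refine Continuous.integrable_of_hasCompactSupport ?_ (HasCompactSupport.intro
      (isCompact_closedBall (0 : EuclideanSpace ℝ (Fin N)) 1) fun x hx => by simp [hz x hx])
    exact (hn.continuous.max continuous_const).mul cF
  simp only [e] at h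
  rw [integral_sub (i1.const_mul _) (i2.const_mul _), integral_const_mul, integral_const_mul] at h
  have h0 : 0 ≤ ∫ x, H x * lap G (t • x) :=
    integral_nonneg fun x => mul_nonneg (by positivity) (hlap _)
  have h1 : 0 ≤ 4 * t * ∫ x, max (1 - ‖x‖ ^ 2) 0 * fderiv ℝ G (t • x) x := by
    have := mul_nonneg (sq_nonneg t) h0
    linarith
  exact nonneg_of_mul_nonneg_right h1 (by positivity)

theorem integral_sub_mul_nonneg {G : EuclideanSpace ℝ (Fin N) → ℝ} (hG : ContDiff ℝ 2 G)
    (hlap : ∀ x, 0 ≤ lap G x) :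
    0 ≤ ∫ x in Metric.closedBall 0 1, max (1 - ‖x‖ ^ 2) 0 * (G x - G 0) := by
  have hft : ∀ x, max (1 - ‖x‖ ^ 2) 0 * (G x - G 0) =
      ∫ t in Set.Ioc (0 : ℝ) 1, max (1 - ‖x‖ ^ 2) 0 * fderiv ℝ G (t • x) x := fun x => by
    rw [integral_const_mul, ← intervalIntegral.integral_of_le zero_le_one]
    have hd : ∀ t ∈ Set.uIcc (0 : ℝ) 1, HasDerivAt (fun t : ℝ => G (t • x))
        (fderiv ℝ G (t • x) x) t := fun t _ => by
      have h1 : HasDerivAt (fun t : ℝ => t • x) x t := by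
        simpa using (hasDerivAt_id t).smul_const x
      exact ((hG.differentiable two_ne_zero _).hasFDerivAt).comp_hasDerivAt t h1
    have hc : Continuous fun t : ℝ => fderiv ℝ G (t • x) x :=
      ((hG.continuous_fderiv two_ne_zero).comp (continuous_id.smul continuous_const)).clm_apply
        continuous_const
    rw [intervalIntegral.integral_eq_sub_of_hasDerivAt hd (hc.intervalIntegrable _ _)]
    simp
  simp only [hft]
  have hc : Continuous fun z : EuclideanSpace ℝ (Fin N) × ℝ =>
      max (1 - ‖z.1‖ ^ 2) 0 * fderiv ℝ G (z.2 • z.1) z.1 := by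
    refine Continuous.mul (by fun_prop) ?_
    exact ((hG.continuous_fderiv two_ne_zero).comp (continuous_snd.smul continuous_fst)).clm_apply
      continuous_fst
  have hi : IntegrableOn (fun z : EuclideanSpace ℝ (Fin N) × ℝ =>
      max (1 - ‖z.1‖ ^ 2) 0 * fderiv ℝ G (z.2 • z.1) z.1)
      (Metric.closedBall 0 1 ×ˢ Set.Ioc 0 1) (volume.prod volume) :=
    (hc.continuousOn.integrableOn_compact ((isCompact_closedBall _ _).prod isCompact_Icc)).mono_set
      (Set.prod_mono le_rfl Set.Ioc_subset_Icc_self)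
  rw [IntegrableOn, ← Measure.prod_restrict] at hi
  rw [integral_integral_swap (f := fun x t => max (1 - ‖x‖ ^ 2) 0 * fderiv ℝ G (t • x) x) hi]
  refine setIntegral_nonneg measurableSet_Ioc fun t ht => ?_
  rw [setIntegral_eq_integral_of_forall_compl_eq_zero]
  · exact integral_radial_deriv_nonneg hG hlap ht.1
  · intro x hx
    have : 1 < ‖x‖ := by simpa using hx
    rw [max_eq_right (by nlinarith), zero_mul]

/-- The mean value inequality for nonnegative subharmonic functions. -/
theorem exists_mean_value_bound (N : ℕ) : ∃ C, 0 ≤ C ∧ ∀ G : EuclideanSpace ℝ (Fin N) → ℝ,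
    ContDiff ℝ 2 G → (∀ x, 0 ≤ lap G x) → (∀ x, 0 ≤ G x) →
      G 0 ≤ C * ∫ x in Metric.closedBall 0 1, G x := by
  set K : EuclideanSpace ℝ (Fin N) → ℝ := fun x => max (1 - ‖x‖ ^ 2) 0 with hK
  have cK : Continuous K := by fun_prop
  have K0 : ∀ x, 0 ≤ K x := fun x => le_max_right _ _
  have K1 : ∀ x, K x ≤ 1 := fun x => max_le (by nlinarith [norm_nonneg x]) zero_le_one
  have hz : ∀ x, x ∉ Metric.closedBall 0 1 → K x = 0 := fun x hx => by
    have : 1 < ‖x‖ := by simpa using hx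
    exact max_eq_right (by nlinarith)
  have hpos : 0 < ∫ x in Metric.closedBall 0 1, K x := by
    rw [setIntegral_eq_integral_of_forall_compl_eq_zero hz]
    exact cK.integral_pos_of_hasCompactSupport_nonneg_nonzero
      (HasCompactSupport.intro (isCompact_closedBall _ _) hz) K0 (x := 0) (by simp [hK])
  have hB : ∀ {f : EuclideanSpace ℝ (Fin N) → ℝ}, Continuous f →
      IntegrableOn f (Metric.closedBall 0 1) := fun hf =>
    hf.continuousOn.integrableOn_compact (isCompact_closedBall _ _)
  refine ⟨(∫ x in Metric.closedBall 0 1, K x)⁻¹, by positivity, fun G hG hlap hG0 => ?_⟩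
  have cG := hG.continuous
  have h := integral_sub_mul_nonneg hG hlap
  have e : ∫ x in Metric.closedBall 0 1, K x * (G x - G 0) =
      (∫ x in Metric.closedBall 0 1, K x * G x) - (∫ x in Metric.closedBall 0 1, K x) * G 0 := by
    rw [← integral_mul_const, ← integral_sub (hB (by fun_prop)) (hB (by fun_prop))]
    simp only [mul_sub]
  have h2 : ∫ x in Metric.closedBall 0 1, K x * G x ≤ ∫ x in Metric.closedBall 0 1, G x :=
    integral_mono (hB (by fun_prop)) (hB (by fun_prop)) fun x =>
      mul_le_of_le_one_left (hG0 x) (K1 x)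
  rw [inv_mul_eq_div, le_div_iff₀ hpos]
  linarith

end MeanValue

section Comparison

variable {N : ℕ} {p : ℝ}

/-- A convex nondecreasing `C²` function on the line, vanishing on `(-∞, 0]` and dominated by the
square of the positive part. -/
noncomputable def convexCutoff (t : ℝ) : ℝ := max t 0 ^ 4 / (1 + t ^ 2)

theorem convexCutoff_nonneg (t : ℝ) : 0 ≤ convexCutoff t := by
  unfold convexCutoff; positivity

theorem convexCutoff_le (t : ℝ) : convexCutoff t ≤ max t 0 ^ 2 := by
  rw [convexCutoff, div_le_iff₀ (by positivity)]
  rcases le_total t 0 with h | h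
  · simp [max_eq_right h]
  · rw [max_eq_left h]; nlinarith [sq_nonneg t, sq_nonneg (t ^ 2)]

theorem le_convexCutoff {t : ℝ} (ht : 1 ≤ t) : t ^ 2 / 2 ≤ convexCutoff t := by
  rw [convexCutoff, max_eq_left (by linarith), div_le_div_iff₀ (by norm_num) (by positivity)]
  have : 1 ≤ t ^ 2 := by nlinarith
  nlinarith [sq_nonneg t]

theorem contDiff_convexCutoff : ContDiff ℝ 2 convexCutoff :=
  ((contDiff_max_zero_pow 3).of_le (by norm_num)).div
    (contDiff_const.add (contDiff_id.pow 2)) fun t => (by positivity : (0:ℝ) < 1 + t ^ 2).ne'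

theorem hasDerivAt_convexCutoff (t : ℝ) : HasDerivAt convexCutoff
    ((4 * max t 0 ^ 3 + 2 * max t 0 ^ 5) / (1 + t ^ 2) ^ 2) t := by
  have h1 : HasDerivAt (fun t : ℝ => 1 + t ^ 2) (2 * t) t := by
    simpa using (hasDerivAt_pow 2 t).const_add 1
  refine ((hasDerivAt_max_zero_pow 2 t).div h1 (by positivity)).congr_deriv ?_
  rw [div_eq_div_iff (by positivity) (by positivity)]
  push_cast
  rcases le_total t 0 with h | h
  · simp [max_eq_right h]
  · rw [max_eq_left h]; ring

theorem hasDerivAt_convexCutoff_deriv (t : ℝ) :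
    HasDerivAt (fun t => (4 * max t 0 ^ 3 + 2 * max t 0 ^ 5) / (1 + t ^ 2) ^ 2)
      ((12 * max t 0 ^ 2 + 6 * max t 0 ^ 4 + 2 * max t 0 ^ 6) / (1 + t ^ 2) ^ 3) t := by
  have h1 : HasDerivAt (fun t : ℝ => (1 + t ^ 2) ^ 2) (4 * t * (1 + t ^ 2)) t := by
    have h0 : HasDerivAt (fun t : ℝ => 1 + t ^ 2) (2 * t) t := by
      simpa using (hasDerivAt_pow 2 t).const_add 1
    refine (h0.pow 2).congr_deriv ?_
    push_cast; ring
  refine ((((hasDerivAt_max_zero_pow 1 t).const_mul 4).add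
    ((hasDerivAt_max_zero_pow 3 t).const_mul 2)).div h1 (by positivity)).congr_deriv ?_
  rw [div_eq_div_iff (by positivity) (by positivity)]
  push_cast
  simp only [Pi.add_apply]
  rcases le_total t 0 with h | h
  · simp [max_eq_right h]
  · rw [max_eq_left h]; ring

theorem lap_convexCutoff_nonneg {w : EuclideanSpace ℝ (Fin N) → ℝ} (hw : ContDiff ℝ 2 w)
    (h : ∀ x, 0 < w x → 0 ≤ lap w x) (x : EuclideanSpace ℝ (Fin N)) :
    0 ≤ lap (fun y => convexCutoff (w y)) x := by
  rw [lap_comp (fun x => hasDerivAt_convexCutoff (w x))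
    (φ'' := fun t => (12 * max t 0 ^ 2 + 6 * max t 0 ^ 4 + 2 * max t 0 ^ 6) / (1 + t ^ 2) ^ 3)
    (fun x => hasDerivAt_convexCutoff_deriv (w x)) hw]
  have hg := gradDot_self_nonneg w x
  rcases le_or_gt (w x) 0 with hx | hx
  · simp [max_eq_right hx]
  · have := h x hx
    positivity

namespace IsStableSolution

variable {u : EuclideanSpace ℝ (Fin N) → ℝ}

theorem hasDerivAt_rpow (hu : IsStableSolution p u) (s : ℝ) (x : EuclideanSpace ℝ (Fin N)) :
    HasDerivAt (fun t : ℝ => t ^ s) (s * u x ^ (s - 1)) (u x) :=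
  hasDerivAt_rpow_const (.inl (hu.pos x).ne')

theorem contDiff_rpow (hu : IsStableSolution p u) (s : ℝ) : ContDiff ℝ 2 fun x => u x ^ s :=
  hu.contDiff_two.rpow_const_of_ne fun x => (hu.pos x).ne'

theorem lap_comparison (hp : 1 < p) (hu : IsStableSolution p u) {c : ℝ} (hc : 0 < c)
    (hc2 : c ^ 2 * ((p + 1) / 2) = 1) (x : EuclideanSpace ℝ (Fin N)) :
    c⁻¹ * u x ^ ((p - 1) / 2) * (c * u x ^ ((p + 1) / 2) + lap u x) ≤
      lap (fun y => c * u y ^ ((p + 1) / 2) + lap u y) x := by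
  have hux := hu.pos x
  rw [lap_add (contDiff_const.mul (hu.contDiff_rpow _)) hu.contDiff_lap, hu.lap_lap,
    lap_const_mul _ (hu.contDiff_rpow _),
    lap_comp (φ := fun t => t ^ ((p + 1) / 2)) (φ' := fun t => (p + 1) / 2 * t ^ ((p + 1) / 2 - 1))
      (φ'' := fun t => (p + 1) / 2 * (((p + 1) / 2 - 1) * t ^ ((p + 1) / 2 - 1 - 1)))
      (fun x => hu.hasDerivAt_rpow _ x) (fun x => (hu.hasDerivAt_rpow _ x).const_mul _)
      hu.contDiff_two]
  have e1 : (p + 1) / 2 - 1 = (p - 1) / 2 := by ring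
  rw [e1]
  have e2 : u x ^ ((p - 1) / 2) * u x ^ ((p + 1) / 2) = u x ^ p := by
    rw [← rpow_add hux]; congr 1; ring
  have e3 : c⁻¹ = c * ((p + 1) / 2) := by field_simp; linarith
  have e4 : c⁻¹ * c = 1 := inv_mul_cancel₀ hc.ne'
  have h1 : 0 ≤ c * ((p + 1) / 2 * ((p - 1) / 2 * u x ^ ((p - 1) / 2 - 1)) * gradDot u u x) := by
    have := gradDot_self_nonneg u x
    have : 0 ≤ p - 1 := by linarith
    positivity
  have e5 : c⁻¹ * u x ^ ((p - 1) / 2) * (c * u x ^ ((p + 1) / 2) + lap u x) =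
      u x ^ p + c * ((p + 1) / 2) * u x ^ ((p - 1) / 2) * lap u x := by
    rw [← e2, ← e3]
    linear_combination u x ^ ((p - 1) / 2) * u x ^ ((p + 1) / 2) * e4
  rw [e5]
  linarith

/-- Souplet's pointwise estimate. -/
theorem comparison (hp : 1 < p) (hu : IsStableSolution p u) {c : ℝ} (hc : 0 < c)
    (hc2 : c ^ 2 * ((p + 1) / 2) = 1) (x₀ : EuclideanSpace ℝ (Fin N)) :
    c * u x₀ ^ ((p + 1) / 2) ≤ -lap u x₀ := by
  have hp' : 0 < p - 1 := by linarith
  obtain ⟨E, hE⟩ := exists_energy_bound N hp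
  obtain ⟨C, hC0, hC⟩ := exists_mean_value_bound N
  have hc1 : c ^ 2 ≤ 1 := by nlinarith
  set κ := 4 / (p - 1) with hκ
  have hκ0 : 0 < κ := by positivity
  set w : EuclideanSpace ℝ (Fin N) → ℝ := fun y => c * u y ^ ((p + 1) / 2) + lap u y with hw
  have main : ∀ r : ℝ, 0 < r → convexCutoff (r ^ (κ + 2) * w x₀) ≤ C * (2 * E) := by
    intro r hr
    have hv := hu.rescale hp hr x₀
    set v : EuclideanSpace ℝ (Fin N) → ℝ := fun y => r ^ κ * u (r • y + x₀) with hvdef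
    set W : EuclideanSpace ℝ (Fin N) → ℝ := fun y => c * v y ^ ((p + 1) / 2) + lap v y with hW
    have hWd : ContDiff ℝ 2 W := (contDiff_const.mul (hv.contDiff_rpow _)).add hv.contDiff_lap
    have hW0 : W 0 = r ^ (κ + 2) * w x₀ := by
      rw [hW]
      simp only []
      rw [hvdef, hu.lap_rescale hr, mul_rpow (rpow_pos_of_pos hr _).le (hu.pos _).le, ← rpow_mul hr.le,
        show κ * ((p + 1) / 2) = κ + 2 by rw [hκ]; field_simp; ring]
      simp only [smul_zero, zero_add, hw]
      ring
    have hsub := lap_convexCutoff_nonneg hWd fun x hx => by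
      have h := hv.lap_comparison hp hc hc2 x
      exact (mul_nonneg (mul_nonneg (inv_pos.2 hc).le (rpow_nonneg (hv.pos x).le _)) hx.le).trans h
    have hmv := hC _ (contDiff_convexCutoff.comp hWd) hsub fun x => convexCutoff_nonneg _
    simp only [Function.comp_apply] at hmv
    rw [hW0] at hmv
    refine hmv.trans (mul_le_mul_of_nonneg_left ?_ hC0)
    have hB : ∀ {f : EuclideanSpace ℝ (Fin N) → ℝ}, Continuous f →
        IntegrableOn f (Metric.closedBall 0 1) := fun hf =>
      hf.continuousOn.integrableOn_compact (isCompact_closedBall _ _)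
    have cl := hv.contDiff_lap.continuous
    have cr := hv.continuous_rpow (p + 1)
    calc ∫ x in Metric.closedBall 0 1, convexCutoff (W x)
        ≤ ∫ x in Metric.closedBall 0 1, 2 * (lap v x ^ 2 + v x ^ (p + 1)) := by
          refine integral_mono (hB (contDiff_convexCutoff.continuous.comp hWd.continuous))
            (hB (by fun_prop)) fun x => ?_
          simp only []
          have e : v x ^ (p + 1) = (v x ^ ((p + 1) / 2)) ^ 2 := by
            rw [← rpow_natCast, ← rpow_mul (hv.pos x).le]; congr 1; push_cast; ring
          have h1 : max (W x) 0 ^ 2 ≤ W x ^ 2 := by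
            rcases le_total (W x) 0 with h | h
            · rw [max_eq_right h]; simpa using sq_nonneg (W x)
            · rw [max_eq_left h]
          refine (convexCutoff_le _).trans (h1.trans ?_)
          rw [e, hW]
          simp only []
          set a := v x ^ ((p + 1) / 2)
          nlinarith [sq_nonneg (c * a - lap v x), mul_nonneg (sub_nonneg.2 hc1) (sq_nonneg a)]
      _ = 2 * ∫ x in Metric.closedBall 0 1, (lap v x ^ 2 + v x ^ (p + 1)) := integral_const_mul _ _
      _ ≤ 2 * E := by gcongr; exact hE v hv
  by_contra! hcon
  have hw0 : 0 < w x₀ := by rw [hw]; simp only []; linarith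
  have hlim : Filter.Tendsto (fun r : ℝ => r ^ (κ + 2) * w x₀) Filter.atTop Filter.atTop :=
    (tendsto_rpow_atTop (by positivity)).atTop_mul_const hw0
  obtain ⟨r, hr, hr1⟩ := ((hlim.eventually_ge_atTop (2 * (|C * (2 * E)| + 1))).and
    (Filter.eventually_gt_atTop 0)).exists
  set T := r ^ (κ + 2) * w x₀
  have hA := abs_nonneg (C * (2 * E))
  have h1 := le_convexCutoff (t := T) (by linarith)
  have h2 := main r hr1
  have h3 := le_abs_self (C * (2 * E))
  nlinarith

end IsStableSolution

end Comparison

section PowerTest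

variable {N : ℕ} {p : ℝ} {w η : EuclideanSpace ℝ (Fin N) → ℝ}

theorem contDiff_rpow_of_pos {n : WithTop ℕ∞} (hw : ContDiff ℝ n w) (h0 : ∀ x, 0 < w x) (s : ℝ) :
    ContDiff ℝ n fun x => w x ^ s :=
  hw.rpow_const_of_ne fun x => (h0 x).ne'

theorem gradDot_rpow_left {g : EuclideanSpace ℝ (Fin N) → ℝ} {x : EuclideanSpace ℝ (Fin N)}
    (hw : DifferentiableAt ℝ w x) (h0 : 0 < w x) (s : ℝ) :
    gradDot (fun y => w y ^ s) g x = s * w x ^ (s - 1) * gradDot w g x :=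
  gradDot_comp_left (hasDerivAt_rpow_const (.inl h0.ne')) hw

theorem gradDot_sq_right {g : EuclideanSpace ℝ (Fin N) → ℝ} {x : EuclideanSpace ℝ (Fin N)}
    (hη : DifferentiableAt ℝ η x) : gradDot g (fun y => η y ^ 2) x = 2 * η x * gradDot g η x := by
  have h := gradDot_pow_left (g := g) hη 1
  norm_num at h
  rw [gradDot_comm, h, gradDot_comm g]

theorem integral_rpow_mul_lap_sq (hw : ContDiff ℝ 2 w) (h0 : ∀ x, 0 < w x) (hη : ContDiff ℝ 2 η)
    (hc : HasCompactSupport η) (s : ℝ) :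
    ∫ x, (w x ^ s * lap (fun y => η y ^ 2) x + 2 * s * (w x ^ (s - 1) * (η x * gradDot w η x))) =
      0 := by
  have hm : HasCompactSupport fun x => η x ^ 2 := hc.comp_left (g := fun t => t ^ 2) (by simp)
  rw [← integral_mul_lap_add_gradDot_right ((contDiff_rpow_of_pos hw h0 s).of_le one_le_two)
    (hη.pow 2) hm]
  congr 1
  ext x
  rw [gradDot_rpow_left (hw.differentiable two_ne_zero x) (h0 x),
    gradDot_sq_right (hη.differentiable two_ne_zero x)]
  ring

theorem integral_rpow_mul_sq_mul_lap (hw : ContDiff ℝ 2 w) (h0 : ∀ x, 0 < w x)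
    (hη : ContDiff ℝ 2 η) (hc : HasCompactSupport η) (s : ℝ) :
    ∫ x, (w x ^ (s - 1) * η x ^ 2 * lap w x + (s - 1) * (w x ^ (s - 2) * η x ^ 2 * gradDot w w x) +
      2 * (w x ^ (s - 1) * (η x * gradDot w η x))) = 0 := by
  have hm : HasCompactSupport fun x => w x ^ (s - 1) * η x ^ 2 :=
    (hc.comp_left (g := fun t => t ^ 2) (by simp)).mul_left
  have hr := contDiff_rpow_of_pos hw h0 (s - 1)
  rw [← integral_mul_lap_add_gradDot ((hr.mul (hη.pow 2)).of_le one_le_two) hw hm]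
  congr 1
  ext x
  rw [gradDot_mul_left (hr.differentiable two_ne_zero x)
    ((hη.pow 2).differentiable two_ne_zero x),
    gradDot_rpow_left (hw.differentiable two_ne_zero x) (h0 x), gradDot_comm (fun y => η y ^ 2),
    gradDot_sq_right (hη.differentiable two_ne_zero x), show s - 1 - 1 = s - 2 by ring]
  ring

theorem gradDot_rpow_mul_self (hw : ContDiff ℝ 2 w) (h0 : ∀ x, 0 < w x)
    (hη : ContDiff ℝ 2 η) (s : ℝ) (x : EuclideanSpace ℝ (Fin N)) :
    gradDot (fun y => w y ^ (s / 2) * η y) (fun y => w y ^ (s / 2) * η y) x =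
      s ^ 2 / 4 * (w x ^ (s - 2) * η x ^ 2 * gradDot w w x) +
        s * (w x ^ (s - 1) * (η x * gradDot w η x)) + w x ^ s * gradDot η η x := by
  have dw := hw.differentiable two_ne_zero x
  have dη := hη.differentiable two_ne_zero x
  have dr := (contDiff_rpow_of_pos hw h0 (s / 2)).differentiable two_ne_zero x
  have e : ∀ g : EuclideanSpace ℝ (Fin N) → ℝ, gradDot (fun y => w y ^ (s / 2) * η y) g x =
      w x ^ (s / 2) * gradDot η g x + η x * (s / 2 * w x ^ (s / 2 - 1) * gradDot w g x) := fun g => by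
    rw [gradDot_mul_left dr dη, gradDot_rpow_left dw (h0 x)]
  have e1 : w x ^ (s / 2 - 1) * w x ^ (s / 2 - 1) = w x ^ (s - 2) := by
    rw [← rpow_add (h0 x)]; congr 1; ring
  have e2 : w x ^ (s / 2 - 1) * w x ^ (s / 2) = w x ^ (s - 1) := by
    rw [← rpow_add (h0 x)]; congr 1; ring
  have e3 : w x ^ (s / 2) * w x ^ (s / 2) = w x ^ s := by
    rw [← rpow_add (h0 x)]; congr 1; ring
  rw [e, gradDot_comm η fun y => w y ^ (s / 2) * η y, e, gradDot_comm w fun y => w y ^ (s / 2) * η y,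
    e, gradDot_comm η w, ← e1, ← e2, ← e3]
  ring

/-- The localised energy estimate obtained by testing against `w ^ (s - 1) η²`. -/
theorem rpow_energy_eq (hw : ContDiff ℝ 2 w) (h0 : ∀ x, 0 < w x)
    (hη : ContDiff ℝ 2 η) (hc : HasCompactSupport η) {s : ℝ} (hs : s ≠ 0) :
    (s - 1) * ∫ x, w x ^ (s - 2) * η x ^ 2 * gradDot w w x =
      (∫ x, -lap w x * w x ^ (s - 1) * η x ^ 2) +
        s⁻¹ * ∫ x, w x ^ s * lap (fun y => η y ^ 2) x := by
  have h1 := integral_rpow_mul_lap_sq hw h0 hη hc s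
  have h2 := integral_rpow_mul_sq_mul_lap hw h0 hη hc s
  have cw := hw.continuous
  have cη := hη.continuous
  have cG := continuous_gradDot (hw.of_le one_le_two) (hw.of_le one_le_two)
  have cH := continuous_gradDot (hw.of_le one_le_two) (hη.of_le one_le_two)
  have cL := continuous_lap hw
  have cM := continuous_lap (hη.pow 2)
  have cr := fun s => (contDiff_rpow_of_pos hw h0 s).continuous
  have c1 := cr (s - 1)
  have c2 := cr (s - 2)
  have c0 := cr s
  have z0 : ∀ x, x ∉ tsupport η → η x = 0 := fun x hx => image_eq_zero_of_notMem_tsupport hx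
  have zm : ∀ x, x ∉ tsupport η → lap (fun y => η y ^ 2) x = 0 := fun x hx => by
    have h := lap_pow (x := x) hη 0
    norm_num at h
    rw [h, z0 x hx, gradDot_eq_zero_of_notMem_tsupport hx]; ring
  have i1 : Integrable fun x => w x ^ (s - 2) * η x ^ 2 * gradDot w w x :=
    integrable_of_eq_zero_off (by fun_prop) hc fun x hx => by simp [z0 x hx]
  have i2 : Integrable fun x => -lap w x * w x ^ (s - 1) * η x ^ 2 :=
    integrable_of_eq_zero_off (by fun_prop) hc fun x hx => by simp [z0 x hx]
  have i3 : Integrable fun x => w x ^ s * lap (fun y => η y ^ 2) x :=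
    integrable_of_eq_zero_off (by fun_prop) hc fun x hx => by simp [zm x hx]
  have i4 : Integrable fun x => w x ^ s * lap (fun y => η y ^ 2) x +
      2 * s * (w x ^ (s - 1) * (η x * gradDot w η x)) :=
    integrable_of_eq_zero_off (by fun_prop) hc fun x hx => by simp [zm x hx, z0 x hx]
  have i5 : Integrable fun x => w x ^ (s - 1) * η x ^ 2 * lap w x +
      (s - 1) * (w x ^ (s - 2) * η x ^ 2 * gradDot w w x) +
      2 * (w x ^ (s - 1) * (η x * gradDot w η x)) :=
    integrable_of_eq_zero_off (by fun_prop) hc fun x hx => by simp [z0 x hx]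
  have key := integral_combination_three i4 i5 i4 (-s⁻¹) 0
  rw [h1, h2] at key
  have key2 := integral_combination_three i1 (i2.const_mul (-1)) i3 (s - 1) (-s⁻¹)
  rw [integral_const_mul] at key2
  have : ∫ x, ((s - 1) * (w x ^ (s - 2) * η x ^ 2 * gradDot w w x) +
      -1 * (-lap w x * w x ^ (s - 1) * η x ^ 2) + -s⁻¹ * (w x ^ s * lap (fun y => η y ^ 2) x)) = 0 := by
    rw [← show (_ : ℝ) = 0 from key.trans (by ring)]
    congr 1
    ext x
    field_simp
    ring
  linarith

theorem integral_gradDot_rpow_mul (hw : ContDiff ℝ 2 w) (h0 : ∀ x, 0 < w x)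
    (hη : ContDiff ℝ 2 η) (hc : HasCompactSupport η) (s : ℝ) :
    ∫ x, gradDot (fun y => w y ^ (s / 2) * η y) (fun y => w y ^ (s / 2) * η y) x =
      s ^ 2 / 4 * (∫ x, w x ^ (s - 2) * η x ^ 2 * gradDot w w x) +
        ∫ x, w x ^ s * (gradDot η η x - 1 / 2 * lap (fun y => η y ^ 2) x) := by
  have h1 := integral_rpow_mul_lap_sq hw h0 hη hc s
  have cw := hw.continuous
  have cη := hη.continuous
  have cG := continuous_gradDot (hw.of_le one_le_two) (hw.of_le one_le_two)
  have cH := continuous_gradDot (hw.of_le one_le_two) (hη.of_le one_le_two)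
  have cQ := continuous_gradDot (hη.of_le one_le_two) (hη.of_le one_le_two)
  have cM := continuous_lap (hη.pow 2)
  have cr := fun s => (contDiff_rpow_of_pos hw h0 s).continuous
  have c1 := cr (s - 1)
  have c2 := cr (s - 2)
  have c0 := cr s
  have z0 : ∀ x, x ∉ tsupport η → η x = 0 := fun x hx => image_eq_zero_of_notMem_tsupport hx
  have zq : ∀ x, x ∉ tsupport η → gradDot η η x = 0 := fun x hx =>
    gradDot_eq_zero_of_notMem_tsupport hx
  have zm : ∀ x, x ∉ tsupport η → lap (fun y => η y ^ 2) x = 0 := fun x hx => by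
    have h := lap_pow (x := x) hη 0
    norm_num at h
    rw [h, z0 x hx, zq x hx]; ring
  have i1 : Integrable fun x => w x ^ (s - 2) * η x ^ 2 * gradDot w w x :=
    integrable_of_eq_zero_off (by fun_prop) hc fun x hx => by simp [z0 x hx]
  have i3 : Integrable fun x => w x ^ s * (gradDot η η x - 1 / 2 * lap (fun y => η y ^ 2) x) :=
    integrable_of_eq_zero_off (by fun_prop) hc fun x hx => by simp [zm x hx, zq x hx]
  have i4 : Integrable fun x => w x ^ s * lap (fun y => η y ^ 2) x +
      2 * s * (w x ^ (s - 1) * (η x * gradDot w η x)) :=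
    integrable_of_eq_zero_off (by fun_prop) hc fun x hx => by simp [zm x hx, z0 x hx]
  have key := integral_combination_three i1 i3 i4 (s ^ 2 / 4) (1 / 2)
  rw [h1, mul_zero, add_zero] at key
  rw [← key]
  congr 1
  ext x
  rw [gradDot_rpow_mul_self hw h0 hη]
  ring

/-- Stability tested against `w ^ (s / 2) η`. -/
theorem IsStableSolution.rpow_test {u : EuclideanSpace ℝ (Fin N) → ℝ} (hp : 0 ≤ p)
    (hu : IsStableSolution p u) (hw : ContDiff ℝ 2 w) (h0 : ∀ x, 0 < w x)
    (hη : ContDiff ℝ 2 η) (hc : HasCompactSupport η) {s : ℝ} (hs : 1 < s) :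
    4 * (s - 1) * √p / s ^ 2 * ∫ x, u x ^ ((p - 1) / 2) * w x ^ s * η x ^ 2 ≤
      (∫ x, -lap w x * w x ^ (s - 1) * η x ^ 2) +
        (s⁻¹ * (∫ x, w x ^ s * lap (fun y => η y ^ 2) x) + 4 * (s - 1) / s ^ 2 *
          ∫ x, w x ^ s * (gradDot η η x - 1 / 2 * lap (fun y => η y ^ 2) x)) := by
  have hs0 : 0 < s := by linarith
  have hs1 : 0 < s - 1 := by linarith
  have h := hu.half_stable hp ((contDiff_rpow_of_pos hw h0 (s / 2)).mul hη) hc.mul_left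
  rw [integral_gradDot_rpow_mul hw h0 hη hc] at h
  have he := rpow_energy_eq hw h0 hη hc hs0.ne'
  have e : ∫ x, √p * u x ^ ((p - 1) / 2) * (w x ^ (s / 2) * η x) ^ 2 =
      √p * ∫ x, u x ^ ((p - 1) / 2) * w x ^ s * η x ^ 2 := by
    rw [← integral_const_mul]
    congr 1
    ext x
    rw [mul_pow, ← rpow_natCast (w x ^ (s / 2)), ← rpow_mul (h0 x).le]
    push_cast
    rw [div_mul_cancel₀ _ two_ne_zero]
    ring
  rw [e] at h
  have h2 := mul_le_mul_of_nonneg_left h (by positivity : 0 ≤ 4 * (s - 1) / s ^ 2)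
  rw [← add_assoc, ← he]
  refine (le_of_eq ?_).trans (h2.trans (le_of_eq ?_))
  · ring
  · field_simp

end PowerTest

section Coupling

variable {N : ℕ} {p : ℝ} {u w η : EuclideanSpace ℝ (Fin N) → ℝ}

namespace IsStableSolution

theorem rpow_le_neg_lap (hp : 1 < p) (hu : IsStableSolution p u) (x : EuclideanSpace ℝ (Fin N)) :
    u x ^ ((p + 1) / 2) ≤ √((p + 1) / 2) * -lap u x := by
  have hp' : 0 < (p + 1) / 2 := by linarith
  have hs := sqrt_pos.2 hp'
  have h := hu.comparison hp (inv_pos.2 hs)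
    (by rw [inv_pow, sq_sqrt hp'.le, inv_mul_cancel₀ hp'.ne']) x
  rwa [inv_mul_le_iff₀ hs] at h

theorem neg_lap_pos (hp : 1 < p) (hu : IsStableSolution p u) (x : EuclideanSpace ℝ (Fin N)) :
    0 < -lap u x := by
  have h := (rpow_pos_of_pos (hu.pos x) ((p + 1) / 2)).trans_le (hu.rpow_le_neg_lap hp x)
  exact (pos_iff_pos_of_mul_pos h).1 (sqrt_pos.2 (by linarith))

theorem lap_neg_lap (hu : IsStableSolution p u) (x : EuclideanSpace ℝ (Fin N)) :
    lap (fun y => -lap u y) x = -u x ^ p := by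
  rw [lap_neg hu.contDiff_lap, hu.lap_lap]

end IsStableSolution

theorem integral_mul_le_of_abs_le {f g : EuclideanSpace ℝ (Fin N) → ℝ} {K R : ℝ}
    (hf : Continuous f) (hg : Continuous g) (f0 : ∀ x, 0 ≤ f x) (hK : ∀ x, |g x| ≤ K)
    (hs : ∀ x, x ∉ Metric.closedBall 0 R → g x = 0) :
    ∫ x, f x * g x ≤ K * ∫ x in Metric.closedBall 0 R, f x := by
  have e : ∫ x, f x * g x = ∫ x in Metric.closedBall 0 R, f x * g x :=
    (setIntegral_eq_integral_of_forall_compl_eq_zero fun x hx => by rw [hs x hx, mul_zero]).symm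
  rw [e, ← integral_const_mul]
  refine integral_mono ((hf.mul hg).continuousOn.integrableOn_compact (isCompact_closedBall _ _))
    ((hf.const_mul K).continuousOn.integrableOn_compact (isCompact_closedBall _ _)) fun x => ?_
  simp only []
  rw [mul_comm K]
  exact mul_le_mul_of_nonneg_left ((le_abs_self _).trans (hK x)) (f0 x)

theorem exists_rpow_test_bound (hp : 0 ≤ p) (hη : ContDiff ℝ 2 η) (hc : HasCompactSupport η)
    (hs : tsupport η ⊆ Metric.closedBall 0 2) {s : ℝ} (h1 : 1 < s) :
    ∃ K, 0 ≤ K ∧ ∀ u w : EuclideanSpace ℝ (Fin N) → ℝ, IsStableSolution p u → ContDiff ℝ 2 w →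
      (∀ x, 0 < w x) →
      (4 * (s - 1) * √p / s ^ 2 * ∫ x, u x ^ ((p - 1) / 2) * w x ^ s * η x ^ 2 ≤
        (∫ x, -lap w x * w x ^ (s - 1) * η x ^ 2) + K * ∫ x in Metric.closedBall 0 2, w x ^ s) ∧
      (s - 1) * ∫ x, w x ^ (s - 2) * η x ^ 2 * gradDot w w x ≤
        (∫ x, -lap w x * w x ^ (s - 1) * η x ^ 2) + K * ∫ x in Metric.closedBall 0 2, w x ^ s := by
  have hm : HasCompactSupport fun x => η x ^ 2 := hc.comp_left (g := fun t => t ^ 2) (by simp)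
  have cM := continuous_lap (hη.pow 2)
  have cQ := continuous_gradDot (hη.of_le one_le_two) (hη.of_le one_le_two)
  have hlc := hasCompactSupport_lap hm
  have hgc := hasCompactSupport_gradDot (g := η) hc
  have zq : ∀ x, x ∉ Metric.closedBall 0 2 → gradDot η η x = 0 := fun x hx =>
    gradDot_eq_zero_of_notMem_tsupport fun h => hx (hs h)
  have zm : ∀ x, x ∉ Metric.closedBall 0 2 → lap (fun y => η y ^ 2) x = 0 := fun x hx => by
    have h := lap_pow (x := x) hη 0
    norm_num at h
    rw [h, image_eq_zero_of_notMem_tsupport fun h => hx (hs h), zq x hx]; ring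
  obtain ⟨K₁, hK₁, hb₁⟩ := exists_bound_of_hasCompactSupport cM hlc
  obtain ⟨K₂, hK₂, hb₂⟩ := exists_bound_of_hasCompactSupport cQ hgc
  have hs0 : 0 < s := by linarith
  have hs1 : 0 < s - 1 := by linarith
  refine ⟨s⁻¹ * K₁ + 4 * (s - 1) / s ^ 2 * (K₂ + 1 / 2 * K₁), by positivity,
    fun u w hu hw h0 => ?_⟩
  have cw := (contDiff_rpow_of_pos hw h0 s).continuous
  have w0 : ∀ x, 0 ≤ w x ^ s := fun x => rpow_nonneg (h0 x).le s
  have J0 : 0 ≤ ∫ x in Metric.closedBall 0 2, w x ^ s := integral_nonneg w0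
  have i1 := integral_mul_le_of_abs_le cw cM w0 hb₁ zm
  have i2 := integral_mul_le_of_abs_le (g := fun x => gradDot η η x - 1 / 2 * lap (fun y => η y ^ 2) x)
    cw (by fun_prop) w0 (K := K₂ + 1 / 2 * K₁) (R := 2) (fun x => by
      refine (abs_sub _ _).trans (add_le_add (hb₂ x) ?_)
      rw [abs_mul, abs_of_pos (by norm_num : (0 : ℝ) < 1 / 2)]
      gcongr
      exact hb₁ x) fun x hx => by rw [zq x hx, zm x hx]; ring
  have i1' := mul_le_mul_of_nonneg_left i1 (by positivity : 0 ≤ s⁻¹)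
  have i2' := mul_le_mul_of_nonneg_left i2 (by positivity : 0 ≤ 4 * (s - 1) / s ^ 2)
  constructor
  · refine (hu.rpow_test hp hw h0 hη hc h1).trans ?_
    linarith
  · rw [rpow_energy_eq hw h0 hη hc hs0.ne']
    have : 0 ≤ 4 * (s - 1) / s ^ 2 * (K₂ + 1 / 2 * K₁) * ∫ x in Metric.closedBall 0 2, w x ^ s := by
      positivity
    linarith

theorem mul_integral_le_of_le_combination {f f₁ f₂ f₃ f₄ : EuclideanSpace ℝ (Fin N) → ℝ}
    (i : Integrable f) (i₁ : Integrable f₁) (i₂ : Integrable f₂) (i₃ : Integrable f₃)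
    (i₄ : Integrable f₄) {δ a b c : ℝ}
    (h : ∀ x, δ * f x ≤ (a * f₁ x - f₂ x) + b * (c * f₃ x - f₄ x)) :
    δ * ∫ x, f x ≤ (a * (∫ x, f₁ x) - ∫ x, f₂ x) + b * (c * (∫ x, f₃ x) - ∫ x, f₄ x) := by
  have j₁ := (i₁.const_mul a).sub i₂
  have j₂ := ((i₃.const_mul c).sub i₄).const_mul b
  have hm := integral_mono (i.const_mul δ) (j₁.add j₂) h
  rw [integral_const_mul, integral_add' j₁ j₂, integral_sub' (i₁.const_mul a) i₂,
    integral_const_mul] at hm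
  simp only [Pi.sub_apply] at hm
  rwa [integral_const_mul, integral_sub (i₃.const_mul c) i₄, integral_const_mul] at hm

theorem rpow_coupling_lower {s a₁ a₂ b x y : ℝ} (hs : 2 ≤ s) (hb : 0 < b) (hx : 0 < x)
    (hy : 0 < y) :
    (a₁ - b⁻¹) * x ^ s + b ^ (s - 2) * (a₂ - b) * y ^ s ≤
      (a₁ * x ^ s - y * x ^ (s - 1)) + b ^ (s - 2) * (a₂ * y ^ s - x * y ^ (s - 1)) := by
  have e : ∀ {t : ℝ}, 0 < t → t ^ s = t * t ^ (s - 1) := fun ht => by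
    rw [← rpow_one_add' ht.le (by linarith)]; congr 1; ring
  have e2 : b ^ (s - 1) = b * b ^ (s - 2) := by
    rw [← rpow_one_add' hb.le (by linarith)]; congr 1; ring
  have hm : 0 ≤ (x - b * y) * (x ^ (s - 1) - (b * y) ^ (s - 1)) := by
    have : 0 < b * y := mul_pos hb hy
    rcases le_total x (b * y) with h | h
    · exact mul_nonneg_of_nonpos_of_nonpos (by linarith)
        (sub_nonpos.2 (rpow_le_rpow hx.le h (by linarith)))
    · exact mul_nonneg (by linarith) (sub_nonneg.2 (rpow_le_rpow this.le h (by linarith)))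
  rw [mul_rpow hb.le hy.le, e2] at hm
  have h := mul_nonneg (inv_pos.2 hb).le hm
  rw [e hx, e hy]
  have hi : b⁻¹ * b = 1 := inv_mul_cancel₀ hb.ne'
  have : b⁻¹ * ((x - b * y) * (x ^ (s - 1) - b * b ^ (s - 2) * y ^ (s - 1))) =
      b⁻¹ * (x * x ^ (s - 1)) - y * x ^ (s - 1) - b ^ (s - 2) * (x * y ^ (s - 1)) +
        b ^ (s - 2) * b * (y * y ^ (s - 1)) := by
    linear_combination (-(y * x ^ (s - 1)) - b ^ (s - 2) * (x * y ^ (s - 1)) +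
        b ^ (s - 2) * b * (y * y ^ (s - 1))) * hi
  rw [this] at h
  linarith

set_option maxHeartbeats 1000000 in
theorem exists_coupled_bound (hp : 1 < p) (hη : ContDiff ℝ 2 η) (hc : HasCompactSupport η)
    (hsupp : tsupport η ⊆ Metric.closedBall 0 2) {s : ℝ} (hs : 2 ≤ s)
    (h : 1 < 4 * ((p + 1) * s / 2 - 1) * √p / ((p + 1) * s / 2) ^ 2 * (4 * (s - 1) * √p / s ^ 2)) :
    ∃ C, 0 ≤ C ∧ ∀ u : EuclideanSpace ℝ (Fin N) → ℝ, IsStableSolution p u →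
      ∫ x, u x ^ ((p - 1) / 2) * (u x ^ ((p + 1) * s / 2) + (-lap u x) ^ s) * η x ^ 2 ≤
        C * ∫ x in Metric.closedBall 0 2, (-lap u x) ^ s := by
  have hq : 1 < (p + 1) * s / 2 := by nlinarith
  have hs0 : 0 < s := by linarith
  have hs1 : 0 < s - 1 := by linarith
  have hp0 : 0 ≤ p := by linarith
  have hsp : 0 < √p := sqrt_pos.2 (by linarith)
  obtain ⟨K₁, hK₁, H₁⟩ := exists_rpow_test_bound (N := N) hp0 hη hc hsupp hq
  obtain ⟨K₂, hK₂, H₂⟩ := exists_rpow_test_bound (N := N) hp0 hη hc hsupp (by linarith : 1 < s)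
  set a₁ := 4 * ((p + 1) * s / 2 - 1) * √p / ((p + 1) * s / 2) ^ 2 with ha₁
  set a₂ := 4 * (s - 1) * √p / s ^ 2 with ha₂
  have pa₁ : 0 < a₁ := by
    have : 0 < (p + 1) * s / 2 - 1 := by linarith
    positivity
  have pa₂ : 0 < a₂ := by positivity
  obtain ⟨b, hb1, hb2⟩ : ∃ b, a₁⁻¹ < b ∧ b < a₂ :=
    exists_between (by rwa [inv_lt_iff_one_lt_mul₀' pa₁])
  have hb : 0 < b := (inv_pos.2 pa₁).trans hb1
  have hB : 0 < b ^ (s - 2) := rpow_pos_of_pos hb _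
  set B := b ^ (s - 2) with hBdef
  have d1 : 0 < a₁ - b⁻¹ := sub_pos.2 (inv_lt_of_inv_lt₀ pa₁ hb1)
  have d2 : 0 < B * (a₂ - b) := mul_pos hB (by linarith)
  set δ := min (a₁ - b⁻¹) (B * (a₂ - b)) with hδ
  have hδ0 : 0 < δ := lt_min d1 d2
  refine ⟨δ⁻¹ * (K₁ * √((p + 1) / 2) ^ s + B * K₂), by positivity, fun u hu => ?_⟩
  have hv0 := hu.neg_lap_pos hp
  have hv2 : ContDiff ℝ 2 fun x => -lap u x := hu.contDiff_lap.neg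
  obtain ⟨t1, -⟩ := H₁ u u hu hu.contDiff_two hu.pos
  obtain ⟨t2, -⟩ := H₂ u _ hu hv2 hv0
  have cη := hη.continuous
  have cu := hu.contDiff_two.continuous
  have cv := hu.contDiff_lap.continuous
  have cr := fun s => (contDiff_rpow_of_pos hu.contDiff_two hu.pos s).continuous
  have cs := fun s => (contDiff_rpow_of_pos hv2 hv0 s).continuous
  have cp := cr ((p - 1) / 2)
  have c1 := cr ((p + 1) * s / 2)
  have c2 := cr ((p + 1) * s / 2 - 1)
  have c3 := cr p
  have c4 := cs s
  have c5 := cs (s - 1)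
  have z0 : ∀ x, x ∉ tsupport η → η x = 0 := fun x hx => image_eq_zero_of_notMem_tsupport hx
  have i1 : Integrable fun x => u x ^ ((p - 1) / 2) * u x ^ ((p + 1) * s / 2) * η x ^ 2 :=
    integrable_of_eq_zero_off (by fun_prop) hc fun x hx => by simp [z0 x hx]
  have i2 : Integrable fun x => -lap u x * u x ^ ((p + 1) * s / 2 - 1) * η x ^ 2 :=
    integrable_of_eq_zero_off (by fun_prop) hc fun x hx => by simp [z0 x hx]
  have i3 : Integrable fun x => u x ^ ((p - 1) / 2) * (-lap u x) ^ s * η x ^ 2 :=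
    integrable_of_eq_zero_off (by fun_prop) hc fun x hx => by simp [z0 x hx]
  have i4 : Integrable fun x => -lap (fun y => -lap u y) x * (-lap u x) ^ (s - 1) * η x ^ 2 := by
    simp only [hu.lap_neg_lap, neg_neg]
    exact integrable_of_eq_zero_off (by fun_prop) hc fun x hx => by simp [z0 x hx]
  have i5 : Integrable fun x => u x ^ ((p - 1) / 2) * (u x ^ ((p + 1) * s / 2) + (-lap u x) ^ s) *
      η x ^ 2 :=
    integrable_of_eq_zero_off (by fun_prop) hc fun x hx => by simp [z0 x hx]
  have main : δ * (∫ x, u x ^ ((p - 1) / 2) * (u x ^ ((p + 1) * s / 2) + (-lap u x) ^ s) *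
      η x ^ 2) ≤ (a₁ * (∫ x, u x ^ ((p - 1) / 2) * u x ^ ((p + 1) * s / 2) * η x ^ 2) -
        ∫ x, -lap u x * u x ^ ((p + 1) * s / 2 - 1) * η x ^ 2) +
      B * (a₂ * (∫ x, u x ^ ((p - 1) / 2) * (-lap u x) ^ s * η x ^ 2) -
        ∫ x, -lap (fun y => -lap u y) x * (-lap u x) ^ (s - 1) * η x ^ 2) := by
    refine mul_integral_le_of_le_combination i5 i1 i2 i3 i4 fun x => ?_
    rw [hu.lap_neg_lap, neg_neg]
    have hux := hu.pos x
    have hl := rpow_coupling_lower (a₁ := a₁) (a₂ := a₂) hs hb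
      (rpow_pos_of_pos hux ((p + 1) / 2)) (hv0 x)
    rw [← rpow_mul hux.le, ← rpow_mul hux.le, show (p + 1) / 2 * s = (p + 1) * s / 2 by ring] at hl
    have e1 : u x ^ ((p + 1) * s / 2 - 1) =
        u x ^ ((p - 1) / 2) * u x ^ ((p + 1) / 2 * (s - 1)) := by
      rw [← rpow_add hux]; congr 1; ring
    have e2 : u x ^ p = u x ^ ((p - 1) / 2) * u x ^ ((p + 1) / 2) := by
      rw [← rpow_add hux]; congr 1; ring
    have hX : 0 ≤ u x ^ ((p + 1) * s / 2) := rpow_nonneg hux.le _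
    have hY : 0 ≤ (-lap u x) ^ s := rpow_nonneg (hv0 x).le _
    have hl2 : δ * (u x ^ ((p + 1) * s / 2) + (-lap u x) ^ s) ≤
        (a₁ - b⁻¹) * u x ^ ((p + 1) * s / 2) + B * (a₂ - b) * (-lap u x) ^ s := by
      rw [mul_add]
      exact add_le_add (mul_le_mul_of_nonneg_right (min_le_left _ _) hX)
        (mul_le_mul_of_nonneg_right (min_le_right _ _) hY)
    have hl3 := mul_le_mul_of_nonneg_left (hl2.trans hl)
      (mul_nonneg (rpow_nonneg hux.le ((p - 1) / 2)) (sq_nonneg (η x)))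
    rw [e1, e2]
    refine (le_of_eq ?_).trans (hl3.trans (le_of_eq ?_)) <;> ring
  have J : ∫ x in Metric.closedBall 0 2, u x ^ ((p + 1) * s / 2) ≤
      √((p + 1) / 2) ^ s * ∫ x in Metric.closedBall 0 2, (-lap u x) ^ s := by
    rw [← integral_const_mul]
    refine integral_mono (c1.continuousOn.integrableOn_compact (isCompact_closedBall _ _))
      ((c4.const_mul _).continuousOn.integrableOn_compact (isCompact_closedBall _ _)) fun x => ?_
    simp only []
    rw [← mul_rpow (sqrt_nonneg _) (hv0 x).le, show (p + 1) * s / 2 = (p + 1) / 2 * s by ring,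
      rpow_mul (hu.pos x).le]
    exact rpow_le_rpow (rpow_nonneg (hu.pos x).le _) (hu.rpow_le_neg_lap hp x) hs0.le
  rw [mul_assoc, ← div_eq_inv_mul, le_div_iff₀ hδ0, mul_comm _ δ]
  have t1' := mul_le_mul_of_nonneg_left J hK₁
  have t2' := mul_le_mul_of_nonneg_left (sub_le_iff_le_add'.2 t2) hB.le
  refine main.trans ?_
  linarith

end Coupling

section Gain

variable {N : ℕ} {p : ℝ} {u w η : EuclideanSpace ℝ (Fin N) → ℝ}

theorem gradDot_quotient_le {v : EuclideanSpace ℝ (Fin N) → ℝ} (hu : ContDiff ℝ 2 u)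
    (u0 : ∀ x, 0 < u x) (hv : ContDiff ℝ 2 v) (v0 : ∀ x, 0 < v x) (hη : ContDiff ℝ 2 η) (s : ℝ)
    (x : EuclideanSpace ℝ (Fin N)) :
    gradDot (fun y => v y ^ s * η y ^ 2 * u y ^ (-1 : ℝ)) u x ≤
      s ^ 2 / 2 * (v x ^ (s - 2) * η x ^ 2 * gradDot v v x) + 2 * (v x ^ s * gradDot η η x) := by
  have du := hu.differentiable two_ne_zero x
  have dv := hv.differentiable two_ne_zero x
  have dη := hη.differentiable two_ne_zero x
  have dr := (contDiff_rpow_of_pos hv v0 s).differentiable two_ne_zero x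
  have dz := (contDiff_rpow_of_pos hu u0 (-1)).differentiable two_ne_zero x
  have de := (hη.pow 2).differentiable two_ne_zero x
  rw [gradDot_mul_left (f := fun y => v y ^ s * η y ^ 2) (dr.mul de) dz,
    gradDot_rpow_left du (u0 x), gradDot_mul_left dr de,
    gradDot_rpow_left dv (v0 x), gradDot_comm (fun y => η y ^ 2), gradDot_sq_right dη,
    gradDot_comm u η]
  have h1 := two_mul_gradDot_le (s * v x ^ ((s - 2) / 2) * η x) (v x ^ (s / 2) * u x ^ (-1 : ℝ) * η x)
    v u x
  have h2 := two_mul_gradDot_le (2 * v x ^ (s / 2)) (v x ^ (s / 2) * u x ^ (-1 : ℝ) * η x) η u x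
  have e1 : v x ^ ((s - 2) / 2) * v x ^ ((s - 2) / 2) = v x ^ (s - 2) := by
    rw [← rpow_add (v0 x)]; congr 1; ring
  have e2 : v x ^ ((s - 2) / 2) * v x ^ (s / 2) = v x ^ (s - 1) := by
    rw [← rpow_add (v0 x)]; congr 1; ring
  have e3 : v x ^ (s / 2) * v x ^ (s / 2) = v x ^ s := by
    rw [← rpow_add (v0 x)]; congr 1; ring
  have e4 : u x ^ (-1 - 1 : ℝ) = u x ^ (-1 : ℝ) * u x ^ (-1 : ℝ) := by
    rw [← rpow_add (u0 x)]; congr 1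
  rw [e4, ← e1, ← e2, ← e3]
  linarith

/-- The integrability gain along the iteration. -/
theorem exists_gain (N : ℕ) (hp : 1 < p) {s : ℝ} (hs : 2 ≤ s)
    (h : 1 < 4 * ((p + 1) * s / 2 - 1) * √p / ((p + 1) * s / 2) ^ 2 * (4 * (s - 1) * √p / s ^ 2)) :
    ∃ C, 0 ≤ C ∧ ∀ u : EuclideanSpace ℝ (Fin N) → ℝ, IsStableSolution p u →
      ∫ x in Metric.closedBall 0 1, (-lap u x) ^ (s + (p - 1) / (p + 1)) ≤
        C * ∫ x in Metric.closedBall 0 2, (-lap u x) ^ s := by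
  obtain ⟨η, hη_smooth, η0, -, η1, hsupp, hc⟩ := exists_cutoff N
  have hη : ContDiff ℝ 2 η := contDiff_infty.1 hη_smooth 2
  have cQ := continuous_gradDot (hη.of_le one_le_two) (hη.of_le one_le_two)
  obtain ⟨K₀, hK₀, hb₀⟩ := exists_bound_of_hasCompactSupport cQ (hasCompactSupport_gradDot hc)
  obtain ⟨K, hK, HK⟩ := exists_rpow_test_bound (N := N) (p := p) (by linarith) hη hc hsupp
    (by linarith : 1 < s)
  obtain ⟨A, hA, HA⟩ := exists_coupled_bound hp hη hc hsupp hs h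
  have hs1 : 0 < s - 1 := by linarith
  set L := √((p + 1) / 2) ^ (2 / (p + 1)) with hL
  have hL0 : 0 ≤ L := rpow_nonneg (sqrt_nonneg _) _
  refine ⟨L * (s ^ 2 / 2 * ((s - 1)⁻¹ * (A + K)) + 2 * K₀), by positivity, fun u hu => ?_⟩
  have v0 := hu.neg_lap_pos hp
  have hv2 : ContDiff ℝ 2 fun x => -lap u x := hu.contDiff_lap.neg
  obtain ⟨-, t⟩ := HK u _ hu hv2 v0
  have tA := HA u hu
  have hu2 := hu.contDiff_two
  have cη := hη.continuous
  have cu := hu2.continuous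
  have cv := hu.contDiff_lap.continuous
  have cr := fun s => (contDiff_rpow_of_pos hu2 hu.pos s).continuous
  have cs := fun s => (contDiff_rpow_of_pos hv2 v0 s).continuous
  have cG := continuous_gradDot (hv2.of_le one_le_two) (hv2.of_le one_le_two)
  have c0 := cr ((p - 1) / 2)
  have c1 := cr ((p + 1) * s / 2)
  have c2 := cr (-1)
  have c3 := cr p
  have c4 := cs s
  have c5 := cs (s - 1)
  have c6 := cs (s - 2)
  have c7 := cs (s + 1)
  have z0 : ∀ x, x ∉ tsupport η → η x = 0 := fun x hx => image_eq_zero_of_notMem_tsupport hx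
  have zq : ∀ x, x ∉ tsupport η → gradDot η η x = 0 := fun x hx =>
    gradDot_eq_zero_of_notMem_tsupport hx
  have hψ : ContDiff ℝ 2 fun y => (-lap u y) ^ s * η y ^ 2 * u y ^ (-1 : ℝ) :=
    ((contDiff_rpow_of_pos hv2 v0 s).mul (hη.pow 2)).mul (contDiff_rpow_of_pos hu2 hu.pos _)
  have hψc : HasCompactSupport fun y => (-lap u y) ^ s * η y ^ 2 * u y ^ (-1 : ℝ) :=
    ((hc.comp_left (g := fun t => t ^ 2) (by simp)).mul_left).mul_right
  have hgreen := integral_mul_lap_add_gradDot (hψ.of_le one_le_two) hu2 hψc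
  have cψ := continuous_gradDot (hψ.of_le one_le_two) (hu2.of_le one_le_two)
  have i1 : Integrable fun x => (-lap u x) ^ (s - 2) * η x ^ 2 *
      gradDot (fun y => -lap u y) (fun y => -lap u y) x :=
    integrable_of_eq_zero_off (by fun_prop) hc fun x hx => by simp [z0 x hx]
  have i2 : Integrable fun x => (-lap u x) ^ s * gradDot η η x :=
    integrable_of_eq_zero_off (by fun_prop) hc fun x hx => by simp [zq x hx]
  have i3 : Integrable fun x => (-lap u x) ^ (s + 1) * u x ^ (-1 : ℝ) * η x ^ 2 :=
    integrable_of_eq_zero_off (by fun_prop) hc fun x hx => by simp [z0 x hx]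
  have i4 : Integrable fun x => -lap (fun y => -lap u y) x * (-lap u x) ^ (s - 1) * η x ^ 2 := by
    simp only [hu.lap_neg_lap, neg_neg]
    exact integrable_of_eq_zero_off (by fun_prop) hc fun x hx => by simp [z0 x hx]
  have i5 : Integrable fun x => u x ^ ((p - 1) / 2) * (u x ^ ((p + 1) * s / 2) + (-lap u x) ^ s) *
      η x ^ 2 :=
    integrable_of_eq_zero_off (by fun_prop) hc fun x hx => by simp [z0 x hx]
  have i6 : Integrable fun x => (-lap u x) ^ s * η x ^ 2 * u x ^ (-1 : ℝ) * lap u x +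
      gradDot (fun y => (-lap u y) ^ s * η y ^ 2 * u y ^ (-1 : ℝ)) u x := by
    refine integrable_of_eq_zero_off (by fun_prop) hψc fun x hx => ?_
    rw [gradDot_eq_zero_of_notMem_tsupport hx, image_eq_zero_of_notMem_tsupport hx]; ring
  have J0 : 0 ≤ ∫ x in Metric.closedBall 0 2, (-lap u x) ^ s :=
    integral_nonneg fun x => rpow_nonneg (v0 x).le _
  have b2 := integral_mul_le_of_abs_le c4 cQ (fun x => rpow_nonneg (v0 x).le _) hb₀
    fun x hx => zq x fun hh => hx (hsupp hh)
  have b4 : ∫ x, -lap (fun y => -lap u y) x * (-lap u x) ^ (s - 1) * η x ^ 2 ≤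
      ∫ x, u x ^ ((p - 1) / 2) * (u x ^ ((p + 1) * s / 2) + (-lap u x) ^ s) * η x ^ 2 := by
    refine integral_mono i4 i5 fun x => ?_
    simp only []
    rw [hu.lap_neg_lap, neg_neg]
    have hux := hu.pos x
    have e2 : u x ^ p = u x ^ ((p - 1) / 2) * u x ^ ((p + 1) / 2) := by
      rw [← rpow_add hux]; congr 1; ring
    rw [e2, mul_assoc (u x ^ ((p - 1) / 2)), show (p + 1) * s / 2 = (p + 1) / 2 * s by ring,
      rpow_mul hux.le]
    refine mul_le_mul_of_nonneg_right (mul_le_mul_of_nonneg_left ?_ (rpow_nonneg hux.le _))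
      (sq_nonneg _)
    set X := u x ^ ((p + 1) / 2)
    have hX : 0 < X := rpow_pos_of_pos hux _
    have hY := v0 x
    set Y := -lap u x
    have e : ∀ {t : ℝ}, 0 < t → t ^ s = t * t ^ (s - 1) := fun ht => by
      rw [← rpow_one_add' ht.le (by linarith)]; congr 1; ring
    have pX := rpow_nonneg hX.le s
    have pY := rpow_nonneg hY.le s
    rcases le_total X Y with hXY | hXY
    · have := mul_le_mul_of_nonneg_right hXY (rpow_nonneg hY.le (s - 1))
      rw [← e hY] at this
      linarith
    · have := mul_le_mul_of_nonneg_left (rpow_le_rpow hY.le hXY hs1.le) hX.le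
      rw [← e hX] at this
      linarith
  have b3 : ∫ x, (-lap u x) ^ (s + 1) * u x ^ (-1 : ℝ) * η x ^ 2 ≤
      s ^ 2 / 2 * (∫ x, (-lap u x) ^ (s - 2) * η x ^ 2 *
        gradDot (fun y => -lap u y) (fun y => -lap u y) x) +
      2 * ∫ x, (-lap u x) ^ s * gradDot η η x := by
    have := integral_mono (i3.add i6) ((i1.const_mul (s ^ 2 / 2)).add (i2.const_mul 2)) fun x => by
      simp only [Pi.add_apply]
      have hg := gradDot_quotient_le hu2 hu.pos hv2 v0 hη s x
      have e : (-lap u x) ^ (s + 1) = (-lap u x) ^ s * -lap u x := rpow_add_one (v0 x).ne' s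
      rw [e]
      linarith
    rw [integral_add' i3 i6, hgreen, integral_add' (i1.const_mul _) (i2.const_mul _),
      integral_const_mul, integral_const_mul, add_zero] at this
    exact this
  have b1 : ∫ x in Metric.closedBall 0 1, (-lap u x) ^ (s + (p - 1) / (p + 1)) ≤
      L * ∫ x, (-lap u x) ^ (s + 1) * u x ^ (-1 : ℝ) * η x ^ 2 := by
    rw [← integral_const_mul]
    have c8 := cs (s + (p - 1) / (p + 1))
    have n3 : ∀ x, 0 ≤ L * ((-lap u x) ^ (s + 1) * u x ^ (-1 : ℝ) * η x ^ 2) := fun x =>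
      mul_nonneg hL0 (mul_nonneg (mul_nonneg (rpow_nonneg (v0 x).le _) (rpow_nonneg (hu.pos x).le _))
        (sq_nonneg _))
    refine (setIntegral_mono_on (c8.continuousOn.integrableOn_compact (isCompact_closedBall _ _))
      (i3.const_mul L).integrableOn measurableSet_closedBall fun x hx => ?_).trans
      (setIntegral_le_integral (i3.const_mul L) (.of_forall n3))
    rw [η1 x (by simpa using hx), one_pow, mul_one]
    have hux := hu.pos x
    have hvx := v0 x
    have hle : u x ≤ L * (-lap u x) ^ (2 / (p + 1)) := by
      have h1 := rpow_le_rpow (rpow_nonneg hux.le _) (hu.rpow_le_neg_lap hp x)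
        (div_nonneg zero_le_two (by linarith) : 0 ≤ 2 / (p + 1))
      rwa [mul_rpow (sqrt_nonneg _) hvx.le, ← rpow_mul hux.le,
        show (p + 1) / 2 * (2 / (p + 1)) = 1 by
          have : p + 1 ≠ 0 := by linarith
          field_simp, rpow_one] at h1
    have e1 : (-lap u x) ^ (s + 1) =
        (-lap u x) ^ (s + (p - 1) / (p + 1)) * (-lap u x) ^ (2 / (p + 1)) := by
      rw [← rpow_add hvx]
      congr 1
      have : p + 1 ≠ 0 := by linarith
      field_simp
      ring
    rw [e1, rpow_neg_one]
    have := mul_le_mul_of_nonneg_left hle (rpow_nonneg hvx.le (s + (p - 1) / (p + 1)))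
    rw [← div_eq_mul_inv, mul_div_assoc', le_div_iff₀ hux]
    linarith
  have t' : ∫ x, (-lap u x) ^ (s - 2) * η x ^ 2 *
      gradDot (fun y => -lap u y) (fun y => -lap u y) x ≤
      (s - 1)⁻¹ * ((A + K) * ∫ x in Metric.closedBall 0 2, (-lap u x) ^ s) := by
    rw [← div_eq_inv_mul, le_div_iff₀ hs1, mul_comm]
    linarith
  have t'' := mul_le_mul_of_nonneg_left t' (by positivity : 0 ≤ s ^ 2 / 2)
  refine b1.trans ((mul_le_mul_of_nonneg_left (b3.trans (add_le_add t''
    (mul_le_mul_of_nonneg_left b2 zero_le_two))) hL0).trans (le_of_eq ?_))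
  ring

end Gain

section Exponents

variable {p s b : ℝ}

/-- The exponents for which the coupled stability estimates close. -/
def IsAdmissibleExponent (p s : ℝ) : Prop :=
  (p + 1) ^ 2 * s ^ 4 < 32 * p * ((p + 1) * s - 2) * (s - 1)

theorem IsAdmissibleExponent.one_lt (hp : 1 < p) (hs : 2 ≤ s) (h : IsAdmissibleExponent p s) :
    1 < 4 * ((p + 1) * s / 2 - 1) * √p / ((p + 1) * s / 2) ^ 2 * (4 * (s - 1) * √p / s ^ 2) := by
  have hp0 : 0 < p + 1 := by linarith
  have hs0 : 0 < s := by linarith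
  have e : √p * √p = p := mul_self_sqrt (by linarith)
  rw [div_mul_div_comm, lt_div_iff₀ (by positivity)]
  unfold IsAdmissibleExponent at h
  have : 4 * ((p + 1) * s / 2 - 1) * √p * (4 * (s - 1) * √p) =
      32 * p * ((p + 1) * s - 2) * (s - 1) / 4 := by
    linear_combination 4 * ((p + 1) * s / 2 - 1) * (4 * (s - 1)) * e
  rw [this]
  linarith

theorem isAdmissibleExponent_two (hp : 1 < p) : IsAdmissibleExponent p 2 := by
  unfold IsAdmissibleExponent
  nlinarith

theorem isAdmissibleExponent_five_mul (hp : 1 < p) (h : 2 ≤ 5 * ((p - 1) / (p + 1))) :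
    IsAdmissibleExponent p (5 * ((p - 1) / (p + 1))) := by
  have hp0 : 0 < p + 1 := by linarith
  obtain ⟨t, rfl⟩ : ∃ t, p = t + 1 := ⟨p - 1, by ring⟩
  have ht : 4 / 3 ≤ t := by
    rw [mul_div_assoc', le_div_iff₀ hp0] at h
    linarith
  unfold IsAdmissibleExponent
  have e1 : (t + 1 + 1) ^ 2 * (5 * ((t + 1 - 1) / (t + 1 + 1))) ^ 4 =
      625 * t ^ 4 / (t + 2) ^ 2 := by
    have : t + 2 ≠ 0 := by linarith
    rw [show t + 1 + 1 = t + 2 by ring]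
    field_simp
    ring
  have e2 : 32 * (t + 1) * ((t + 1 + 1) * (5 * ((t + 1 - 1) / (t + 1 + 1))) - 2) *
      (5 * ((t + 1 - 1) / (t + 1 + 1)) - 1) =
      32 * (t + 1) * (5 * t - 2) * (4 * t - 2) * (t + 2) / (t + 2) ^ 2 := by
    have : t + 2 ≠ 0 := by linarith
    rw [show t + 1 + 1 = t + 2 by ring]
    field_simp
    ring
  rw [e1, e2]
  refine div_lt_div_of_pos_right ?_ (by positivity)
  have h2 : 4 / 3 * t ≤ t ^ 2 := by nlinarith
  have h3 : 4 / 3 * t ^ 2 ≤ t ^ 3 := by nlinarith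
  have h4 : 0 ≤ t ^ 4 := by positivity
  nlinarith

theorem IsAdmissibleExponent.of_le (hp : 1 < p) (hb : IsAdmissibleExponent p b) (hs : 2 ≤ s)
    (hsb : s ≤ b) : IsAdmissibleExponent p s := by
  have ha := isAdmissibleExponent_two hp
  unfold IsAdmissibleExponent at *
  rcases hs.eq_or_lt with rfl | h2s
  · exact ha
  have hs0 : 0 < s := by linarith
  have hb0 : 0 < b := by linarith
  rw [← sub_pos] at ha hb ⊢
  have key : (32 * p * ((p + 1) * s - 2) * (s - 1) - (p + 1) ^ 2 * s ^ 4) * (4 * b ^ 2 * (b - 2)) =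
      s ^ 2 * (b ^ 2 * (b - s) * (32 * p * ((p + 1) * 2 - 2) * (2 - 1) - (p + 1) ^ 2 * 2 ^ 4) +
        4 * (s - 2) * (32 * p * ((p + 1) * b - 2) * (b - 1) - (p + 1) ^ 2 * b ^ 4)) +
      (b - 2) * (s - 2) * (b - s) * (4 * (p + 1) ^ 2 * s ^ 2 * b ^ 2 +
        64 * p * (p + 3) * s * b - 64 * p * (b * s + 2 * b + 2 * s)) := by
    ring
  have hbr : 0 ≤ 4 * (p + 1) ^ 2 * s ^ 2 * b ^ 2 +
        64 * p * (p + 3) * s * b - 64 * p * (b * s + 2 * b + 2 * s) := by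
    have h1 : 2 * b ≤ b * s := by nlinarith
    have h2 : 2 * s ≤ b * s := by nlinarith
    have h3 : 0 < p * (b * s) := by positivity
    have h4 : 0 ≤ 4 * (p + 1) ^ 2 * s ^ 2 * b ^ 2 := by positivity
    nlinarith [mul_le_mul_of_nonneg_left h1 (by linarith : 0 ≤ p),
      mul_le_mul_of_nonneg_left h2 (by linarith : 0 ≤ p), mul_pos (by linarith : 0 < p) h3]
  have hpos : 0 < s ^ 2 * (b ^ 2 * (b - s) *
      (32 * p * ((p + 1) * 2 - 2) * (2 - 1) - (p + 1) ^ 2 * 2 ^ 4) +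
        4 * (s - 2) * (32 * p * ((p + 1) * b - 2) * (b - 1) - (p + 1) ^ 2 * b ^ 4)) := by
    have h1 : 0 ≤ b - s := by linarith
    have h2 : 0 < s - 2 := by linarith
    positivity
  have h3 : 0 ≤ (b - 2) * (s - 2) * (b - s) :=
    mul_nonneg (mul_nonneg (by linarith) (by linarith)) (by linarith)
  have h4 : 0 < 4 * b ^ 2 * (b - 2) := mul_pos (by positivity) (by linarith)
  refine (pos_iff_pos_of_mul_pos (b := 4 * b ^ 2 * (b - 2)) ?_).2 h4
  rw [key]
  exact add_pos_of_pos_of_nonneg hpos (mul_nonneg h3 hbr)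

theorem exists_isAdmissibleExponent (hp : 1 < p) :
    ∃ b, 2 < b ∧ 5 * ((p - 1) / (p + 1)) < b ∧ IsAdmissibleExponent p b := by
  have hm : IsAdmissibleExponent p (max 2 (5 * ((p - 1) / (p + 1)))) := by
    rcases le_total 2 (5 * ((p - 1) / (p + 1))) with h | h
    · rw [max_eq_right h]; exact isAdmissibleExponent_five_mul hp h
    · rw [max_eq_left h]; exact isAdmissibleExponent_two hp
  have ho : IsOpen {s | IsAdmissibleExponent p s} :=
    isOpen_lt (by fun_prop) (by fun_prop)
  obtain ⟨b, hb, hb'⟩ := ((Filter.Eventually.filter_mono nhdsWithin_le_nhds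
    (ho.mem_nhds hm)).and (self_mem_nhdsWithin (s := Set.Ioi (max 2 (5 * ((p - 1) / (p + 1))))))).exists
  exact ⟨b, (le_max_left _ _).trans_lt hb', (le_max_right _ _).trans_lt hb', hb⟩

end Exponents

section Iteration

variable {N : ℕ} {p : ℝ} {u : EuclideanSpace ℝ (Fin N) → ℝ}

/-- Uniform boundedness on the unit ball of the `s`-th moment of `-Δu` over all stable solutions. -/
def HasMomentBound (N : ℕ) (p s : ℝ) : Prop :=
  ∃ C, ∀ u : EuclideanSpace ℝ (Fin N) → ℝ, IsStableSolution p u →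
    ∫ x in Metric.closedBall 0 1, (-lap u x) ^ s ≤ C

namespace IsStableSolution

theorem continuous_neg_lap_rpow (hp : 1 < p) (hu : IsStableSolution p u) (s : ℝ) :
    Continuous fun x => (-lap u x) ^ s :=
  (contDiff_rpow_of_pos hu.contDiff_lap.neg (hu.neg_lap_pos hp) s).continuous

theorem integrableOn_neg_lap_rpow (hp : 1 < p) (hu : IsStableSolution p u) (s r : ℝ) :
    IntegrableOn (fun x => (-lap u x) ^ s) (Metric.closedBall 0 r) :=
  (hu.continuous_neg_lap_rpow hp s).continuousOn.integrableOn_compact (isCompact_closedBall _ _)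

end IsStableSolution

theorem HasMomentBound.closedBall (hp : 1 < p) {s : ℝ} (h : HasMomentBound N p s) :
    ∃ C, ∀ u : EuclideanSpace ℝ (Fin N) → ℝ, IsStableSolution p u → ∀ r : ℝ, 0 < r →
      r ^ ((4 / (p - 1) + 2) * s) * (r ^ N)⁻¹ * ∫ x in Metric.closedBall 0 r, (-lap u x) ^ s ≤
        C := by
  obtain ⟨C, hC⟩ := h
  refine ⟨C, fun u hu r hr => ?_⟩
  refine le_trans (le_of_eq ?_) (hC _ (hu.rescale hp hr 0))
  have e : ∀ x, (-lap (fun y => r ^ (4 / (p - 1)) * u (r • y + 0)) x) ^ s =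
      r ^ ((4 / (p - 1) + 2) * s) * (-lap u (r • x + 0)) ^ s := fun x => by
    rw [hu.lap_rescale hr, ← mul_neg, mul_rpow (rpow_pos_of_pos hr _).le (hu.neg_lap_pos hp _).le,
      ← rpow_mul hr.le]
  simp only [e]
  rw [integral_const_mul, setIntegral_closedBall_comp_smul_add (fun x => (-lap u x) ^ s) hr]
  ring

theorem hasMomentBound_two (N : ℕ) (hp : 1 < p) : HasMomentBound N p 2 := by
  obtain ⟨C, hC⟩ := exists_energy_bound N hp
  refine ⟨C, fun u hu => le_trans ?_ (hC u hu)⟩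
  have cl := hu.contDiff_lap.continuous
  have cr := hu.continuous_rpow (p + 1)
  have c : Continuous fun x => lap u x ^ 2 + u x ^ (p + 1) := by fun_prop
  refine integral_mono (hu.integrableOn_neg_lap_rpow hp 2 1)
    (c.continuousOn.integrableOn_compact (isCompact_closedBall _ _)) fun x => ?_
  simp only []
  rw [rpow_two, neg_sq]
  exact le_add_of_nonneg_right (rpow_nonneg (hu.pos x).le _)

theorem HasMomentBound.of_le_of_le (hp : 1 < p) {a b s : ℝ} (ha : HasMomentBound N p a)
    (hb : HasMomentBound N p b) (has : a ≤ s) (hsb : s ≤ b) : HasMomentBound N p s := by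
  obtain ⟨A, hA⟩ := ha
  obtain ⟨B, hB⟩ := hb
  refine ⟨A + B, fun u hu => le_trans ?_ (add_le_add (hA u hu) (hB u hu))⟩
  have ia := hu.integrableOn_neg_lap_rpow hp a 1
  have ib := hu.integrableOn_neg_lap_rpow hp b 1
  rw [← integral_add ia ib]
  refine integral_mono (hu.integrableOn_neg_lap_rpow hp s 1) (ia.add ib) fun x => ?_
  have hv := hu.neg_lap_pos hp x
  have h1 := rpow_nonneg hv.le a
  have h2 := rpow_nonneg hv.le b
  simp only []
  rcases le_total (-lap u x) 1 with h | h
  · linarith [rpow_le_rpow_of_exponent_ge hv h has]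
  · linarith [rpow_le_rpow_of_exponent_le h hsb]

theorem HasMomentBound.add (hp : 1 < p) {s : ℝ} (hs : 2 ≤ s) (ha : IsAdmissibleExponent p s)
    (h : HasMomentBound N p s) : HasMomentBound N p (s + (p - 1) / (p + 1)) := by
  obtain ⟨C, hC⟩ := h.closedBall hp
  obtain ⟨D, hD0, hD⟩ := exists_gain N hp hs (ha.one_lt hp hs)
  have h2 : (0 : ℝ) < 2 ^ ((4 / (p - 1) + 2) * s) * (2 ^ N)⁻¹ :=
    mul_pos (rpow_pos_of_pos two_pos _) (by positivity)
  refine ⟨D * (C / (2 ^ ((4 / (p - 1) + 2) * s) * (2 ^ N)⁻¹)), fun u hu => (hD u hu).trans ?_⟩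
  refine mul_le_mul_of_nonneg_left ?_ hD0
  rw [le_div_iff₀ h2, mul_comm]
  exact hC u hu 2 two_pos

theorem hasMomentBound_of_le (hp : 1 < p) {b : ℝ} (hb2 : 2 ≤ b) (hb : IsAdmissibleExponent p b) :
    HasMomentBound N p (b + (p - 1) / (p + 1)) := by
  set θ := (p - 1) / (p + 1) with hθ
  have hθ0 : 0 < θ := div_pos (by linarith) (by linarith)
  have h2 := hasMomentBound_two N hp
  have main : ∀ n : ℕ, ∀ s, 2 ≤ s → s ≤ b + θ → s ≤ 2 + n * θ → HasMomentBound N p s := by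
    intro n
    induction n with
    | zero =>
      intro s hs _ hs'
      have : s = 2 := by simp at hs'; linarith
      rwa [this]
    | succ n ih =>
      intro s hs hsb hsn
      push_cast at hsn
      rcases le_total s (2 + θ) with h | h
      · exact h2.of_le_of_le hp (h2.add hp le_rfl (isAdmissibleExponent_two hp)) hs h
      · have := (ih (s - θ) (by linarith) (by linarith) (by linarith)).add hp (by linarith)
          (hb.of_le hp (by linarith) (by linarith))
        rwa [← hθ, sub_add_cancel] at this
  obtain ⟨n, hn⟩ := exists_nat_ge ((b + θ - 2) / θ)
  rw [div_le_iff₀ hθ0] at hn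
  exact main n _ (by linarith) le_rfl (by linarith)

theorem not_isStableSolution (hN : N ≤ 12) (hp : 1 < p) : ¬IsStableSolution p u := by
  intro hu
  obtain ⟨b, hb2, hb5, hb⟩ := exists_isAdmissibleExponent hp
  obtain ⟨C, hC⟩ := (hasMomentBound_of_le (N := N) hp hb2.le hb).closedBall hp
  set σ := b + (p - 1) / (p + 1) with hσ
  have hpos : 0 < ∫ x in Metric.closedBall 0 1, (-lap u x) ^ σ := by
    rw [setIntegral_pos_iff_support_of_nonneg_ae
      (.of_forall fun x => rpow_nonneg (hu.neg_lap_pos hp x).le _)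
      (hu.integrableOn_neg_lap_rpow hp σ 1)]
    have : Function.support (fun x => (-lap u x) ^ σ) = Set.univ :=
      Set.eq_univ_of_forall fun x => (rpow_pos_of_pos (hu.neg_lap_pos hp x) σ).ne'
    rw [this, Set.univ_inter]
    exact Metric.measure_closedBall_pos _ _ one_pos
  set I := ∫ x in Metric.closedBall 0 1, (-lap u x) ^ σ
  have hexp : 0 < (4 / (p - 1) + 2) * σ - N := by
    have hp1 : 0 < p - 1 := by linarith
    have hp2 : 0 < p + 1 := by linarith
    have h1 : 6 * ((p - 1) / (p + 1)) < σ := by linarith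
    have h2 := mul_lt_mul_of_pos_left h1 (by positivity : 0 < 4 / (p - 1) + 2)
    have h3 : (4 / (p - 1) + 2) * (6 * ((p - 1) / (p + 1))) = 12 := by field_simp; ring
    have h4 : (N : ℝ) ≤ 12 := by exact_mod_cast hN
    linarith
  have hlim : Filter.Tendsto (fun r : ℝ => r ^ ((4 / (p - 1) + 2) * σ - N) * I) Filter.atTop
      Filter.atTop := (tendsto_rpow_atTop hexp).atTop_mul_const hpos
  obtain ⟨r, hr, hr1⟩ := ((hlim.eventually_gt_atTop C).and
    (Filter.eventually_ge_atTop 1)).exists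
  have hr0 : 0 < r := by linarith
  refine absurd (hC u hu r hr0) (not_le.2 (hr.trans_le ?_))
  rw [rpow_sub hr0, rpow_natCast, ← div_eq_mul_inv]
  refine mul_le_mul_of_nonneg_left (setIntegral_mono_set (hu.integrableOn_neg_lap_rpow hp σ r)
    (.of_forall fun x => rpow_nonneg (hu.neg_lap_pos hp x).le _)
    (Metric.closedBall_subset_closedBall hr1).eventuallyLE)
    (div_nonneg (rpow_pos_of_pos hr0 _).le (by positivity))

end Iteration

/-- For `5 ≤ N ≤ 12` and any `p > 1`, there is no classical stable solution of
`Δ²u = u^p`, `u > 0` in `ℝ^N`. -/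
theorem no_stable_solution_dim_le_twelve
    (N : ℕ) (hN : 5 ≤ N) (hN' : N ≤ 12) (p : ℝ) (hp : 1 < p) :
    ¬ ∃ u : EuclideanSpace ℝ (Fin N) → ℝ,
        ContDiff ℝ 4 u ∧ (∀ x, 0 < u x) ∧
        (∀ x, lap (lap u) x = u x ^ p) ∧
        (∀ φ : EuclideanSpace ℝ (Fin N) → ℝ, ContDiff ℝ (⊤ : ℕ∞) φ →
          HasCompactSupport φ →
          p * ∫ x, u x ^ (p - 1) * φ x ^ 2 ≤ ∫ x, (lap φ x) ^ 2) := by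
  rintro ⟨u, hu, hpos, heq, hst⟩
  exact not_isStableSolution hN' hp ⟨hu, hpos, heq, hst⟩
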